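/- Let (W,S) be a finite Coxeter system and let ΓW be the ℚ-linear span, inside the space of class functions on W, of the induced trivial characters {1_{W_I}^W : I ⊆ S}. A class function f on W belongs to ΓW if and only if f takes values in ℚ and f is constant on the λ-set C(λ) for every Coxeter class λ of (W,S). -/

import Mathlib

open scoped Classical

variable {B : Type*} {W : Type*} [Group W] {M : CoxeterMatrix B}

/-- The parabolic subgroup `W_I` generated by the simple reflections indexed by `I`. -/
def parabolic (cs : CoxeterSystem M W) (I : Set B) : Subgroup W :=
  Subgroup.closure (cs.simple '' I)

/-- `X_I`: minimal length coset representatives of `W / W_I`. -/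
def minReps (cs : CoxeterSystem M W) (I : Set B) : Set W :=
  {w : W | ∀ i ∈ I, cs.length w < cs.length (w * cs.simple i)}

/-- `I ∼_W J`: the subsets of simple reflections are conjugate under `W`. -/
def ConjSubsets (cs : CoxeterSystem M W) (I J : Set B) : Prop :=
  ∃ w : W, (fun x => w * x * w⁻¹) '' (cs.simple '' I) = cs.simple '' J

theorem conjSubsets_equivalence (cs : CoxeterSystem M W) : Equivalence (ConjSubsets cs) where
  refl I := ⟨1, by simp⟩
  symm := by
    rintro I J ⟨w, h⟩
    refine ⟨w⁻¹, ?_⟩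
    rw [← h, Set.image_image]
    simp [mul_assoc]
  trans := by
    rintro I J K ⟨w, h⟩ ⟨v, h'⟩
    refine ⟨v * w, ?_⟩
    rw [← h', ← h]
    simp [Set.image_image, mul_assoc]

/-- The setoid of Coxeter classes. -/
def coxSetoid (cs : CoxeterSystem M W) : Setoid (Set B) :=
  ⟨ConjSubsets cs, conjSubsets_equivalence cs⟩

/-- The set of Coxeter classes `Λ(W)`. -/
def CoxeterClass (cs : CoxeterSystem M W) := Quotient (coxSetoid cs)

/-- `C` is a conjugacy class of the parabolic subgroup `W_I`. -/
def IsConjClassOfParabolic (cs : CoxeterSystem M W) (I : Set B) (C : Set W) : Prop :=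
  ∃ v ∈ parabolic cs I, C = {x : W | ∃ u ∈ parabolic cs I, u * v * u⁻¹ = x}

/-- `C` is an `I`-cuspidal class: a conjugacy class of `W_I` meeting no proper
parabolic subgroup of `W_I`. -/
def IsCuspidalClass (cs : CoxeterSystem M W) (I : Set B) (C : Set W) : Prop :=
  IsConjClassOfParabolic cs I C ∧ ∀ K : Set B, K ⊂ I → C ∩ (parabolic cs K : Set W) = ∅

/-- `w` is an `I`-element: `C(w) ∩ W_I` is an `I`-cuspidal class. -/
def IsElementOf (cs : CoxeterSystem M W) (I : Set B) (w : W) : Prop :=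
  IsCuspidalClass cs I ({x : W | IsConj w x} ∩ (parabolic cs I : Set W))

/-- The λ-set `C(λ)` of the Coxeter class of `I`: the set of `λ(I)`-elements. -/
def lambdaSet (cs : CoxeterSystem M W) (I : Set B) : Set W :=
  {w : W | ∃ J : Set B, ConjSubsets cs I J ∧ IsElementOf cs J w}

/-- The λ-set of a Coxeter class. -/
def lambdaSetQ (cs : CoxeterSystem M W) (lam : CoxeterClass cs) : Set W :=
  {w : W | ∃ I : Set B, Quotient.mk (coxSetoid cs) I = lam ∧ IsElementOf cs I w}

/-- The induced character `1_{W_I}^W` of the trivial character of `W_I`,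
as a `ℚ`-valued function on `W`. -/
noncomputable def indTriv (cs : CoxeterSystem M W) (I : Set B) : W → ℚ :=
  fun w => (Nat.card {g : W | g ∈ minReps cs I ∧ g⁻¹ * w * g ∈ parabolic cs I} : ℚ)

namespace CoxeterSystem

variable (cs : CoxeterSystem M W)

/-- The involution `(t, ε) ↦ (sᵢ t sᵢ, ε + [t = sᵢ])` of `W × ℤ/2`. -/
noncomputable def signedConj (i : B) : Equiv.Perm (W × ZMod 2) :=
  Function.Involutive.toPerm
    (fun p => (cs.simple i * p.1 * cs.simple i, p.2 + if p.1 = cs.simple i then 1 else 0)) (by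
      rintro ⟨t, e⟩
      have h : cs.simple i * t * cs.simple i = cs.simple i ↔ t = cs.simple i := by
        constructor
        · intro h
          have := congrArg (fun x => cs.simple i * x * cs.simple i) h
          simpa [mul_assoc] using this
        · rintro rfl; simp
      have h2 : (1 : ZMod 2) + 1 = 0 := by decide
      ext
      · simp [mul_assoc]
      · by_cases ht : t = cs.simple i
        · simp [ht, add_assoc, h2]
        · simp [h, ht])

theorem signedConj_apply (i : B) (p : W × ZMod 2) :
    cs.signedConj i p =
      (cs.simple i * p.1 * cs.simple i, p.2 + if p.1 = cs.simple i then 1 else 0) := rfl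

theorem signedConj_mul_pow (i j : B) (m : ℕ) (p : W × ZMod 2) :
    ((cs.signedConj i * cs.signedConj j) ^ m) p =
      ((cs.simple i * cs.simple j) ^ m * p.1 * ((cs.simple i * cs.simple j) ^ m)⁻¹,
        p.2 + ∑ l ∈ Finset.range (2 * m),
          if p.1 = cs.simple j * (cs.simple i * cs.simple j) ^ l then 1 else 0) := by
  set r := cs.simple i * cs.simple j with hr
  have hjr : ∀ k : ℕ, (r ^ k)⁻¹ * cs.simple j = cs.simple j * r ^ k := by
    intro k
    have h1 : cs.simple j * r * cs.simple j = r⁻¹ := by simp [hr, mul_assoc]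
    have h2 : (cs.simple j * r * cs.simple j) ^ k = cs.simple j * r ^ k * cs.simple j := by
      have := conj_pow (i := k) (a := cs.simple j) (b := r)
      simpa using this
    rw [← inv_pow, ← h1, h2]
    simp [mul_assoc]
  induction m with
  | zero => simp
  | succ m ih =>
    rw [pow_succ', Equiv.Perm.mul_apply, ih, Equiv.Perm.mul_apply, signedConj_apply,
      signedConj_apply]
    have e1 : (r ^ m * p.1 * (r ^ m)⁻¹ = cs.simple j) ↔ p.1 = cs.simple j * r ^ (2 * m) := by
      rw [mul_inv_eq_iff_eq_mul, ← eq_inv_mul_iff_mul_eq, ← mul_assoc, hjr, mul_assoc,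
        ← pow_add, two_mul]
    have e2 : (cs.simple j * (r ^ m * p.1 * (r ^ m)⁻¹) * cs.simple j = cs.simple i) ↔
        p.1 = cs.simple j * r ^ (2 * m + 1) := by
      have : cs.simple j * r ^ (2 * m + 1) = (r ^ m)⁻¹ * (cs.simple j * r) * r ^ m := by
        rw [← mul_assoc, hjr, mul_assoc, mul_assoc, ← pow_succ', ← pow_add]
        congr 2; ring
      rw [this]
      constructor
      · intro h
        have h' := congrArg (fun x => (r ^ m)⁻¹ * (cs.simple j * x * cs.simple j) * r ^ m) h
        simpa [mul_assoc, hr] using h'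
      · intro h
        rw [h]
        simp [mul_assoc, hr]
    have hl : (2 * (m + 1)) = 2 * m + 1 + 1 := by ring
    rw [hl, Finset.sum_range_succ, Finset.sum_range_succ]
    ext
    · simp only [pow_succ', mul_inv_rev, hr, inv_simple, mul_assoc]
    · simp only [e1, e2, add_assoc]

theorem signedConj_isLiftable : M.IsLiftable cs.signedConj := by
  intro i j
  ext1 p
  rw [signedConj_mul_pow]
  have h : ∀ l, cs.simple j * (cs.simple i * cs.simple j) ^ (M i j + l) =
      cs.simple j * (cs.simple i * cs.simple j) ^ l := by
    intro l; rw [pow_add, simple_mul_simple_pow]; simp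
  rw [two_mul, Finset.sum_range_add]
  simp only [h, simple_mul_simple_pow, CharTwo.add_self_eq_zero]
  simp

theorem lift_signedConj_wordProd (ω : List B) (t : W) :
    cs.lift ⟨cs.signedConj, cs.signedConj_isLiftable⟩ (cs.wordProd ω) (t, 0) =
      (cs.wordProd ω * t * (cs.wordProd ω)⁻¹, ((cs.rightInvSeq ω).count t : ZMod 2)) := by
  induction ω with
  | nil => simp
  | cons i ω ih =>
    rw [wordProd_cons, map_mul, Equiv.Perm.mul_apply, ih, lift_apply_simple, signedConj_apply]
    have e : cs.wordProd ω * t * (cs.wordProd ω)⁻¹ = cs.simple i ↔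
        (cs.wordProd ω)⁻¹ * cs.simple i * cs.wordProd ω = t := by
      rw [mul_inv_eq_iff_eq_mul, mul_assoc, inv_mul_eq_iff_eq_mul, eq_comm]
    ext
    · simp [mul_assoc]
    · simp [rightInvSeq, List.count_cons, e]

/-- The exchange condition. -/
theorem exchange {ω : List B} {i : B}
    (h : cs.length (cs.wordProd ω * cs.simple i) < cs.length (cs.wordProd ω)) :
    ∃ j < ω.length, cs.wordProd ω * cs.simple i = cs.wordProd (ω.eraseIdx j) := by
  obtain ⟨ω', hω', hw⟩ := cs.exists_isReduced (cs.wordProd ω * cs.simple i)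
  have hw' : cs.wordProd ω = cs.wordProd (ω' ++ [i]) := by
    rw [wordProd_append, ← hw]; simp
  have hred : cs.IsReduced (ω' ++ [i]) := by
    unfold IsReduced
    rw [← hw', List.length_append, List.length_singleton, ← hω'.eq, ← hw]
    rcases cs.length_mul_simple (cs.wordProd ω) i with h1 | h1 <;> omega
  have hmem : cs.simple i ∈ cs.rightInvSeq (ω' ++ [i]) := by
    rw [← List.concat_eq_append, rightInvSeq_concat]; simp
  have hcount := List.count_eq_one_of_mem hred.nodup_rightInvSeq hmem
  have h1 := cs.lift_signedConj_wordProd ω (cs.simple i)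
  rw [hw', lift_signedConj_wordProd, hcount] at h1
  have h2 := congrArg Prod.snd h1
  simp only [Nat.cast_one] at h2
  have h3 : cs.simple i ∈ cs.rightInvSeq ω := by
    by_contra hn
    rw [List.count_eq_zero_of_not_mem hn] at h2
    simp at h2
  obtain ⟨j, hj, hj'⟩ := List.getElem_of_mem h3
  refine ⟨j, by simpa using hj, ?_⟩
  rw [← wordProd_mul_getD_rightInvSeq, List.getD_eq_getElem _ _ hj, hj']

theorem wordProd_mem_parabolic {I : Set B} {ω : List B} (h : ∀ i ∈ ω, i ∈ I) :
    cs.wordProd ω ∈ parabolic cs I := by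
  induction ω with
  | nil => simp
  | cons i ω ih =>
    rw [wordProd_cons]
    refine mul_mem (Subgroup.subset_closure ⟨i, h i (by simp), rfl⟩)
      (ih fun j hj => h j (by simp [hj]))

theorem simple_mem_parabolic {I : Set B} {i : B} (h : i ∈ I) : cs.simple i ∈ parabolic cs I :=
  Subgroup.subset_closure ⟨i, h, rfl⟩

theorem parabolic_mono {I J : Set B} (h : I ⊆ J) : parabolic cs I ≤ parabolic cs J :=
  Subgroup.closure_mono (Set.image_mono h)

theorem parabolic_empty : parabolic cs ∅ = ⊥ := by simp [parabolic]

theorem parabolic_univ : parabolic cs Set.univ = ⊤ := by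
  rw [parabolic, Set.image_univ, subgroup_closure_range_simple]

theorem exists_word_of_mem_parabolic {I : Set B} {w : W} (h : w ∈ parabolic cs I) :
    ∃ ω : List B, (∀ i ∈ ω, i ∈ I) ∧ w = cs.wordProd ω := by
  induction h using Subgroup.closure_induction with
  | mem x hx =>
    obtain ⟨i, hi, rfl⟩ := hx
    exact ⟨[i], by simpa using hi, by simp⟩
  | one => exact ⟨[], by simp, by simp⟩
  | mul x y _ _ hx hy =>
    obtain ⟨ω, h1, rfl⟩ := hx
    obtain ⟨ω', h2, rfl⟩ := hy
    refine ⟨ω ++ ω', ?_, by rw [wordProd_append]⟩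
    intro i hi
    rcases List.mem_append.1 hi with h | h
    exacts [h1 i h, h2 i h]
  | inv x _ hx =>
    obtain ⟨ω, h1, rfl⟩ := hx
    exact ⟨ω.reverse, by simpa using h1, by simp⟩

theorem exists_isReduced_sublist (ω : List B) :
    ∃ ω' : List B, ω'.Sublist ω ∧ cs.IsReduced ω' ∧ cs.wordProd ω' = cs.wordProd ω := by
  induction ω using List.reverseRecOn with
  | nil => exact ⟨[], by simp, by simp [IsReduced], rfl⟩
  | append_singleton ω i ih =>
    obtain ⟨ω', h1, h2, h3⟩ := ih
    rcases cs.length_mul_simple (cs.wordProd ω') i with h | h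
    · refine ⟨ω' ++ [i], h1.append_right _, ?_, by simp [wordProd_append, h3]⟩
      unfold IsReduced
      rw [wordProd_append, wordProd_singleton, h, h2.eq]; simp
    · obtain ⟨j, hj, hj'⟩ := cs.exchange (ω := ω') (i := i) (by omega)
      refine ⟨ω'.eraseIdx j, ?_, ?_, ?_⟩
      · exact ((List.eraseIdx_sublist _ _).trans h1).trans (List.sublist_append_left _ _)
      · unfold IsReduced
        rw [← hj', List.length_eraseIdx_of_lt hj, ← h2.eq]; omega
      · rw [← hj', h3, wordProd_append, wordProd_singleton]

theorem exists_isReduced_of_mem_parabolic {I : Set B} {w : W} (h : w ∈ parabolic cs I) :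
    ∃ ω : List B, (∀ i ∈ ω, i ∈ I) ∧ cs.IsReduced ω ∧ w = cs.wordProd ω := by
  obtain ⟨ω, h1, rfl⟩ := cs.exists_word_of_mem_parabolic h
  obtain ⟨ω', h2, h3, h4⟩ := cs.exists_isReduced_sublist ω
  exact ⟨ω', fun i hi => h1 i (h2.subset hi), h3, h4.symm⟩

theorem exists_rightDescent_mem {I : Set B} {w : W} (h : w ∈ parabolic cs I) (hw : w ≠ 1) :
    ∃ i ∈ I, cs.length (w * cs.simple i) + 1 = cs.length w := by
  obtain ⟨ω, h1, h2, rfl⟩ := cs.exists_isReduced_of_mem_parabolic h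
  obtain rfl | ⟨ω', i, rfl⟩ := ω.eq_nil_or_concat'
  · simp at hw
  · refine ⟨i, h1 i (by simp), ?_⟩
    rw [h2.eq, wordProd_append]
    simp only [wordProd_singleton, simple_mul_simple_cancel_right, List.length_append,
      List.length_singleton, add_left_inj]
    have := h2.take ω'.length
    simpa [IsReduced] using this

theorem exists_leftDescent_mem {I : Set B} {w : W} (h : w ∈ parabolic cs I) (hw : w ≠ 1) :
    ∃ i ∈ I, cs.length (cs.simple i * w) + 1 = cs.length w := by
  obtain ⟨i, hi, h1⟩ := cs.exists_rightDescent_mem (inv_mem h) (by simpa using hw)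
  refine ⟨i, hi, ?_⟩
  rw [← length_inv, ← cs.length_inv w]
  simpa using h1

theorem length_mul_of_forall_le {I : Set B} {x u : W}
    (hx : ∀ v ∈ parabolic cs I, cs.length x ≤ cs.length (x * v)) (hu : u ∈ parabolic cs I) :
    cs.length (x * u) = cs.length x + cs.length u := by
  obtain ⟨ω, h1, h2, rfl⟩ := cs.exists_isReduced_of_mem_parabolic hu
  clear hu
  induction ω using List.reverseRecOn with
  | nil => simp
  | append_singleton ω i ih =>
    have hr : cs.IsReduced ω := by simpa using h2.take ω.length
    have hω : ∀ j ∈ ω, j ∈ I := fun j hj => h1 j (by simp [hj])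
    have ih' := ih hω hr
    rw [h2.eq, wordProd_append, wordProd_singleton, ← mul_assoc, List.length_append,
      List.length_singleton]
    rcases cs.length_mul_simple (x * cs.wordProd ω) i with h | h
    · rw [h, ih', hr.eq]; ring
    · exfalso
      obtain ⟨ξ, hξ, rfl⟩ := cs.exists_isReduced x
      have := cs.exchange (ω := ξ ++ ω) (i := i) (by rw [wordProd_append]; omega)
      obtain ⟨j, hj, hj'⟩ := this
      rw [wordProd_append] at hj'
      rcases lt_or_ge j ξ.length with hlt | hge
      · rw [List.eraseIdx_append_of_lt_length hlt, wordProd_append] at hj'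
        have hw : cs.wordProd ω ∈ parabolic cs I := cs.wordProd_mem_parabolic hω
        have h5 := hx (cs.wordProd ω * cs.simple i * (cs.wordProd ω)⁻¹)
          (mul_mem (mul_mem hw (cs.simple_mem_parabolic (h1 i (by simp)))) (inv_mem hw))
        have h6 : cs.wordProd ξ * (cs.wordProd ω * cs.simple i * (cs.wordProd ω)⁻¹) =
            cs.wordProd (ξ.eraseIdx j) := by
          rw [← mul_assoc, ← mul_assoc, hj']; group
        rw [h6, hξ.eq] at h5
        have h7 := cs.length_wordProd_le (ξ.eraseIdx j)
        rw [List.length_eraseIdx_of_lt hlt] at h7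
        omega
      · rw [List.eraseIdx_append_of_length_le hge, wordProd_append, mul_assoc,
          mul_right_inj] at hj'
        have h7 := cs.length_wordProd_le (ω.eraseIdx (j - ξ.length))
        rw [List.length_eraseIdx_of_lt (by rw [List.length_append] at hj; omega), ← hj'] at h7
        have h8 := h2.eq
        rw [wordProd_append, wordProd_singleton, List.length_append, List.length_singleton] at h8
        rw [List.length_append] at hj
        omega

theorem exists_forall_le (I : Set B) (w : W) : ∃ u ∈ parabolic cs I,
    ∀ v ∈ parabolic cs I, cs.length (w * u) ≤ cs.length (w * u * v) := by
  let S : Set ℕ := {n | ∃ u ∈ parabolic cs I, cs.length (w * u) = n}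
  have hS : S.Nonempty := ⟨_, 1, one_mem _, rfl⟩
  obtain ⟨u, hu, h⟩ := Nat.sInf_mem hS
  refine ⟨u, hu, fun v hv => ?_⟩
  rw [h]
  exact Nat.sInf_le ⟨u * v, mul_mem hu hv, by rw [mul_assoc]⟩

theorem forall_le_of_mem_minReps {I : Set B} {x : W} (hx : x ∈ minReps cs I) :
    ∀ v ∈ parabolic cs I, cs.length x ≤ cs.length (x * v) := by
  obtain ⟨u, hu, h⟩ := cs.exists_forall_le I x
  by_cases hu1 : u⁻¹ = 1
  · rw [inv_eq_one] at hu1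
    simpa [hu1] using h
  · exfalso
    obtain ⟨i, hi, h1⟩ := cs.exists_rightDescent_mem (inv_mem hu) hu1
    have h2 := cs.length_mul_of_forall_le h (inv_mem hu)
    have h3 := cs.length_mul_of_forall_le h
      (mul_mem (inv_mem hu) (cs.simple_mem_parabolic hi))
    rw [mul_inv_cancel_right] at h2
    rw [← mul_assoc, mul_inv_cancel_right] at h3
    have := hx i hi
    omega

theorem length_mul_of_mem_minReps {I : Set B} {x u : W} (hx : x ∈ minReps cs I)
    (hu : u ∈ parabolic cs I) : cs.length (x * u) = cs.length x + cs.length u :=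
  cs.length_mul_of_forall_le (cs.forall_le_of_mem_minReps hx) hu

theorem exists_mem_minReps (I : Set B) (w : W) : ∃ u ∈ parabolic cs I, w * u ∈ minReps cs I := by
  obtain ⟨u, hu, h⟩ := cs.exists_forall_le I w
  refine ⟨u, hu, fun i hi => ?_⟩
  exact lt_of_le_of_ne (h _ (cs.simple_mem_parabolic hi)) (cs.length_mul_simple_ne _ i).symm

theorem eq_of_mem_minReps {I : Set B} {x y : W} (hx : x ∈ minReps cs I) (hy : y ∈ minReps cs I)
    (h : x⁻¹ * y ∈ parabolic cs I) : x = y := by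
  have h1 := cs.length_mul_of_mem_minReps hx h
  have h2 := cs.length_mul_of_mem_minReps hy (inv_mem h)
  rw [mul_inv_cancel_left] at h1
  rw [mul_inv_rev, inv_inv, mul_inv_cancel_left] at h2
  have h3 : cs.length (x⁻¹ * y) = 0 := by omega
  rwa [length_eq_zero_iff, inv_mul_eq_one] at h3

/-- Every double coset `W_I w W_J` has an element that is minimal in its left and right cosets. -/
theorem exists_doubleCoset_rep (I J : Set B) (w : W) :
    ∃ a ∈ parabolic cs I, ∃ b ∈ parabolic cs J, ∃ d : W, w = a * d * b ∧
      d ∈ minReps cs J ∧ d⁻¹ ∈ minReps cs I := by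
  let S : Set ℕ := {n | ∃ a ∈ parabolic cs I, ∃ b ∈ parabolic cs J, cs.length (a * w * b) = n}
  have hS : S.Nonempty := ⟨_, 1, one_mem _, 1, one_mem _, rfl⟩
  obtain ⟨a, ha, b, hb, h⟩ := Nat.sInf_mem hS
  refine ⟨a⁻¹, inv_mem ha, b⁻¹, inv_mem hb, a * w * b, by group, ?_, ?_⟩
  · intro i hi
    refine lt_of_le_of_ne ?_ (cs.length_mul_simple_ne _ i).symm
    rw [h]
    exact Nat.sInf_le ⟨a, ha, b * cs.simple i, mul_mem hb (cs.simple_mem_parabolic hi),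
      by simp only [mul_assoc]⟩
  · intro i hi
    refine lt_of_le_of_ne ?_ (cs.length_mul_simple_ne _ i).symm
    rw [length_inv, h, ← length_inv, mul_inv_rev, inv_inv, inv_simple]
    exact Nat.sInf_le ⟨cs.simple i * a, mul_mem (cs.simple_mem_parabolic hi) ha, b, hb,
      by simp only [mul_assoc]⟩

/-- Kilmoyer's theorem on intersections of parabolic subgroups. -/
theorem conj_mem_parabolic_of_doubleCoset_rep {I J : Set B} {d u v : W}
    (hJ : d ∈ minReps cs J) (hI : d⁻¹ ∈ minReps cs I) (hu : u ∈ parabolic cs I)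
    (hv : v ∈ parabolic cs J) (h : u * d = d * v) :
    u ∈ parabolic cs {i | i ∈ I ∧ ∃ j ∈ J, cs.simple i = d * cs.simple j * d⁻¹} := by
  induction hn : cs.length v generalizing u v with
  | zero =>
    rw [length_eq_zero_iff] at hn
    subst hn
    have : u = 1 := by simpa using h
    rw [this]; exact one_mem _
  | succ n ih =>
    have hv1 : v ≠ 1 := by rintro rfl; simp at hn
    obtain ⟨j, hj, h1⟩ := cs.exists_rightDescent_mem hv hv1
    have hlen : ∀ u' ∈ parabolic cs I, cs.length (u' * d) = cs.length u' + cs.length d := by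
      intro u' hu'
      have := cs.length_mul_of_mem_minReps hI (inv_mem hu')
      rw [← mul_inv_rev, length_inv, length_inv, length_inv] at this
      omega
    have hvj := mul_mem hv (cs.simple_mem_parabolic hj)
    have h2 := cs.length_mul_of_mem_minReps hJ hv
    have h3 := cs.length_mul_of_mem_minReps hJ hvj
    obtain ⟨ω, hω1, hω2, rfl⟩ := cs.exists_isReduced_of_mem_parabolic hu
    obtain ⟨ξ, hξ, rfl⟩ := cs.exists_isReduced d
    obtain ⟨k, hk, hk'⟩ := cs.exchange (ω := ω ++ ξ) (i := j) (by
      rw [wordProd_append, h, mul_assoc]; omega)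
    rw [wordProd_append] at hk'
    rcases lt_or_ge k ω.length with hlt | hge
    · rw [List.eraseIdx_append_of_lt_length hlt, wordProd_append] at hk'
      have hu' : cs.wordProd (ω.eraseIdx k) ∈ parabolic cs I :=
        cs.wordProd_mem_parabolic fun i hi => hω1 i ((List.eraseIdx_sublist _ _).subset hi)
      set u := cs.wordProd ω
      set u' := cs.wordProd (ω.eraseIdx k)
      set d := cs.wordProd ξ
      have ih' := ih hu' hvj (by rw [← hk', h, mul_assoc]) (by omega)
      have hr : u⁻¹ * u' ∈ parabolic cs I := mul_mem (inv_mem hu) hu'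
      have hr2 : u⁻¹ * u' * d = d * cs.simple j := by
        rw [mul_assoc, ← hk']; group
      have hr3 := hlen _ hr
      rw [hr2] at hr3
      have hr4 := cs.length_mul_of_mem_minReps hJ (cs.simple_mem_parabolic hj)
      rw [length_simple] at hr4
      have hr5 : cs.length (u⁻¹ * u') = 1 := by omega
      have hne : u⁻¹ * u' ≠ 1 := by intro h0; rw [h0] at hr5; simp at hr5
      obtain ⟨i, hi, hi'⟩ := cs.exists_rightDescent_mem hr hne
      have hi2 : cs.length (u⁻¹ * u' * cs.simple i) = 0 := by omega
      rw [length_eq_zero_iff, mul_eq_one_iff_eq_inv, inv_simple] at hi2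
      have hu2 : u' = u * cs.simple i := by rwa [inv_mul_eq_iff_eq_mul] at hi2
      have : u = u' * cs.simple i := by rw [hu2]; simp
      rw [this]
      refine mul_mem ih' (cs.simple_mem_parabolic ⟨hi, j, hj, ?_⟩)
      rw [← hr2, ← hi2]; group
    · exfalso
      rw [List.eraseIdx_append_of_length_le hge, wordProd_append, mul_assoc,
          mul_right_inj] at hk'
      have h7 := cs.length_wordProd_le (ξ.eraseIdx (k - ω.length))
      rw [List.length_append] at hk
      rw [List.length_eraseIdx_of_lt (by omega), ← hk'] at h7
      have h8 := cs.length_mul_of_mem_minReps hJ (cs.simple_mem_parabolic hj)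
      rw [length_simple, hξ.eq] at h8
      omega

end CoxeterSystem

section GeometricRepresentation

open Polynomial.Chebyshev in
theorem reflection_mul_reflection_pow_eq_one {V : Type*} [AddCommGroup V] [Module ℝ V]
    {x y : V} {f g : Module.Dual ℝ V} (hf : f x = 2) (hg : g y = 2) {m : ℕ} (hm : 2 < m)
    (h : f y * g x = 4 * Real.cos (Real.pi / m) ^ 2) :
    (Module.reflection hf * Module.reflection hg) ^ m = 1 := by
  have hm0 : (m : ℝ) ≠ 0 := by positivity
  set φ : ℝ := 2 * (Real.pi / m) with hφ
  have ht : 2 * Real.cos φ = f y * g x - 2 := by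
    rw [h, hφ, Real.cos_two_mul]; ring
  have hs : Real.sin φ ≠ 0 := by
    apply ne_of_gt
    apply Real.sin_pos_of_pos_of_lt_pi
    · rw [hφ]; positivity
    · rw [hφ, ← mul_div_assoc, div_lt_iff₀ (by positivity)]
      have : (2 : ℝ) < m := by exact_mod_cast hm
      nlinarith [Real.pi_pos]
  ext z
  rw [Module.reflection_mul_reflection_pow_apply hf hg m z _ ht]
  rcases Nat.even_or_odd' m with ⟨k, hk | hk⟩
  · have e1 : ((m : ℤ) - 2) / 2 = k - 1 := by omega
    have e2 : ((m : ℤ) - 1) / 2 = k - 1 := by omega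
    have h0 : (S ℝ (k - 1)).eval (2 * Real.cos φ) = 0 := by
      have := S_two_mul_real_cos φ ((k : ℤ) - 1)
      have h2 : (((k : ℤ) - 1 : ℤ) + 1 : ℝ) * φ = Real.pi := by
        have hk0 : (k : ℝ) ≠ 0 := by rintro h0; apply hm0; rw [hk]; push_cast; rw [h0]; simp
        rw [hφ, hk]; push_cast; field_simp; ring
      rw [h2, Real.sin_pi] at this
      exact (mul_eq_zero.1 this).resolve_right hs
    rw [e1, e2, h0]; simp
  · have e1 : ((m : ℤ) - 2) / 2 = k - 1 := by omega
    have e2 : ((m : ℤ) - 1) / 2 = k := by omega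
    have e3 : ((m : ℤ) - 3) / 2 = k - 1 := by omega
    have e4 : (m : ℤ) / 2 = k := by omega
    have h0 : (S ℝ k).eval (2 * Real.cos φ) + (S ℝ (k - 1)).eval (2 * Real.cos φ) = 0 := by
      have h1 := S_two_mul_real_cos φ ((k : ℤ) - 1)
      have h2 := S_two_mul_real_cos φ (k : ℤ)
      have h3 : (((k : ℤ) - 1 : ℤ) + 1 : ℝ) * φ = 2 * Real.pi - ((k : ℤ) + 1 : ℝ) * φ := by
        rw [hφ]; push_cast; rw [hk] at hm0 ⊢; push_cast at hm0 ⊢; field_simp; ring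
      rw [h3, Real.sin_two_pi_sub] at h1
      refine (mul_eq_zero.1 (?_ : _ * Real.sin φ = 0)).resolve_right hs
      linear_combination h1 + h2
    rw [e1, e2, e3, e4, h0]; simp

theorem reflection_mul_reflection_sq_eq_one {V : Type*} [AddCommGroup V] [Module ℝ V]
    {x y : V} {f g : Module.Dual ℝ V} (hf : f x = 2) (hg : g y = 2)
    (h : f y = 0) (h' : g x = 0) :
    (Module.reflection hf * Module.reflection hg) ^ 2 = 1 := by
  ext z
  rw [pow_two]
  simp only [LinearEquiv.mul_apply, Module.reflection_apply, map_sub, map_smul, hf, hg, h, h',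
    LinearEquiv.coe_one, id]
  module

end GeometricRepresentation

namespace CoxeterMatrix

variable (M)

/-- The entry `-cos (π / m)` of the Gram matrix of the simple roots. -/
noncomputable def gram (i j : B) : ℝ := - Real.cos (Real.pi / M i j)

theorem gram_self (i : B) : M.gram i i = 1 := by simp [gram]

theorem gram_comm (i j : B) : M.gram i j = M.gram j i := by rw [gram, gram, M.symmetric]

/-- The coroot of a simple root, as a linear form on the span of the simple roots. -/
noncomputable def coroot (i : B) : Module.Dual ℝ (B →₀ ℝ) :=
  Finsupp.linearCombination ℝ (fun j => 2 * M.gram i j)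

theorem coroot_single (i j : B) (a : ℝ) :
    M.coroot i (Finsupp.single j a) = a * (2 * M.gram i j) := by
  simp [coroot]

theorem coroot_self (i : B) : M.coroot i (Finsupp.single i 1) = 2 := by
  rw [coroot_single, gram_self]; norm_num

/-- The simple reflection in the geometric representation. -/
noncomputable def geomReflection (i : B) : (B →₀ ℝ) ≃ₗ[ℝ] (B →₀ ℝ) :=
  Module.reflection (M.coroot_self i)

theorem geomReflection_apply (i : B) (v : B →₀ ℝ) :
    M.geomReflection i v = v - M.coroot i v • Finsupp.single i 1 :=
  Module.reflection_apply _ _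

theorem isLiftable_geomReflection : M.IsLiftable M.geomReflection := by
  intro i j
  by_cases hij : i = j
  · subst hij
    rw [M.diagonal, pow_one]
    ext1 v
    exact Module.involutive_reflection (M.coroot_self i) v
  have h1 : M i j ≠ 1 := M.off_diagonal i j hij
  rcases lt_trichotomy (M i j) 2 with h | h | h
  · have : M i j = 0 := by omega
    rw [this, pow_zero]
  · have h0 : M.gram i j = 0 := by simp [gram, h]
    rw [h]
    apply reflection_mul_reflection_sq_eq_one
    · rw [coroot_single, h0]; simp
    · rw [coroot_single, gram_comm, h0]; simp
  · apply reflection_mul_reflection_pow_eq_one _ _ h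
    rw [coroot_single, coroot_single, M.gram_comm j i, gram]; ring

end CoxeterMatrix

namespace CoxeterSystem

variable (cs : CoxeterSystem M W)

/-- The geometric representation. -/
noncomputable def geomRep : W →* ((B →₀ ℝ) ≃ₗ[ℝ] (B →₀ ℝ)) :=
  cs.lift ⟨M.geomReflection, M.isLiftable_geomReflection⟩

theorem geomRep_simple (i : B) : cs.geomRep (cs.simple i) = M.geomReflection i :=
  cs.lift_apply_simple _ i

theorem simple_injective : Function.Injective cs.simple := by
  intro i j h
  by_contra hij
  have h1 := congrArg (fun w => cs.geomRep w (Finsupp.single i 1)) h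
  simp only [geomRep_simple, CoxeterMatrix.geomReflection_apply, M.coroot_self] at h1
  have h2 := DFunLike.congr_fun h1 i
  norm_num [Finsupp.single_apply, hij, Ne.symm hij] at h2

theorem finite_index (cs : CoxeterSystem M W) [Finite W] : Finite B := Finite.of_injective _ cs.simple_injective

/-- A `W`-invariant positive bilinear pairing on the geometric representation. -/
noncomputable def invForm [Fintype W] (u v : B →₀ ℝ) : ℝ :=
  ∑ w : W, ∑ᶠ i, cs.geomRep w u i * cs.geomRep w v i

theorem invForm_geomRep [Fintype W] (g : W) (u v : B →₀ ℝ) :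
    cs.invForm (cs.geomRep g u) (cs.geomRep g v) = cs.invForm u v := by
  unfold invForm
  refine Fintype.sum_equiv (Equiv.mulRight g) _ _ fun w => ?_
  simp [map_mul]

/-- The Gram matrix of a finite Coxeter group is positive definite. -/
theorem gram_posDef (cs : CoxeterSystem M W) [Fintype W] [Fintype B] (x : B → ℝ) (hx : x ≠ 0) :
    0 < ∑ i, ∑ j, x i * x j * M.gram i j := by
  let F : LinearMap.BilinForm ℝ (B →₀ ℝ) := LinearMap.mk₂ ℝ cs.invForm
    (by intro a b c; simp [invForm, finsum_eq_sum_of_fintype, add_mul, Finset.sum_add_distrib])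
    (by intro a b c; simp [invForm, finsum_eq_sum_of_fintype, mul_assoc, Finset.mul_sum])
    (by intro a b c; simp [invForm, finsum_eq_sum_of_fintype, mul_add, Finset.sum_add_distrib])
    (by intro a b c
        simp [invForm, finsum_eq_sum_of_fintype, mul_left_comm, Finset.mul_sum])
  have hF : ∀ u v, F u v = cs.invForm u v := fun u v => rfl
  have hsymm : ∀ u v, F u v = F v u := fun u v => by
    simp [hF, invForm, mul_comm]
  have hpos : ∀ u, u ≠ 0 → 0 < F u u := by
    intro u hu
    rw [hF]
    simp only [invForm, finsum_eq_sum_of_fintype]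
    refine Finset.sum_pos' (fun w _ => Finset.sum_nonneg fun i _ => mul_self_nonneg _)
      ⟨1, Finset.mem_univ _, ?_⟩
    obtain ⟨i, hi⟩ := Finsupp.ne_iff.1 hu
    refine Finset.sum_pos' (fun i _ => mul_self_nonneg _) ⟨i, Finset.mem_univ _, ?_⟩
    have : u i ≠ 0 := by simpa using hi
    simpa using mul_self_pos.2 this
  let e : B → (B →₀ ℝ) := fun i => Finsupp.single i 1
  have hee : ∀ i j, F (e i) (e j) = M.gram i j * F (e i) (e i) := by
    intro i j
    have h1 := cs.invForm_geomRep (cs.simple i) (e i) (e j)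
    rw [← hF, ← hF, geomRep_simple, CoxeterMatrix.geomReflection_apply,
      CoxeterMatrix.geomReflection_apply, M.coroot_self, M.coroot_single] at h1
    change F (e i - (2:ℝ) • e i) (e j - (1 * (2 * M.gram i j)) • e i) = _ at h1
    simp only [map_sub, map_smul, LinearMap.sub_apply, LinearMap.smul_apply, smul_eq_mul] at h1
    linarith
  have hd : ∀ i, 0 < F (e i) (e i) := fun i => hpos _ (by simp [e])
  have hdd : ∀ i j, M.gram i j * F (e i) (e i) = M.gram i j * F (e j) (e j) := by
    intro i j
    rw [← hee, hsymm, hee, M.gram_comm]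
  let D : B → ℝ := fun i => Real.sqrt (F (e i) (e i))
  have hD : ∀ i, 0 < D i := fun i => Real.sqrt_pos.2 (hd i)
  have hDD : ∀ i, D i * D i = F (e i) (e i) := fun i => Real.mul_self_sqrt (hd i).le
  have hD' : ∀ i j, M.gram i j * D i = M.gram i j * D j := by
    intro i j
    by_cases h : M.gram i j = 0
    · simp [h]
    · have := mul_left_cancel₀ h (hdd i j)
      simp only [D, this]
  let u : B →₀ ℝ := ∑ i, (x i / D i) • e i
  have hu : u ≠ 0 := by
    intro h
    apply hx
    ext i
    have h1 := DFunLike.congr_fun h i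
    simp [u, e, Finsupp.single_apply, (hD i).ne'] at h1
    exact h1
  have := hpos u hu
  simp only [u, map_sum, map_smul, LinearMap.sum_apply, LinearMap.smul_apply, smul_eq_mul] at this
  refine lt_of_lt_of_eq this ?_
  rw [Finset.sum_comm]
  refine Finset.sum_congr rfl fun j _ => ?_
  rw [Finset.mul_sum]
  refine Finset.sum_congr rfl fun i _ => ?_
  rw [hee, ← hDD]
  have := hD' i j
  have h1 := (hD i).ne'
  have h2 := (hD j).ne'
  field_simp
  linear_combination x i * x j * this

end CoxeterSystem

namespace CoxeterMatrix

variable (M)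

/-- Two vertices of the Coxeter graph are joined. -/
def Joined (i j : B) : Prop := M i j ≠ 1 ∧ M i j ≠ 2

/-- Two vertices of the Coxeter graph are joined by an edge of label different from `3`. -/
def Heavy (i j : B) : Prop := M.Joined i j ∧ M i j ≠ 3

variable {M}

theorem Joined.symm {i j : B} (h : M.Joined i j) : M.Joined j i := by
  unfold Joined at *; rwa [M.symmetric]

theorem Heavy.symm {i j : B} (h : M.Heavy i j) : M.Heavy j i :=
  ⟨h.1.symm, by rw [M.symmetric]; exact h.2⟩

theorem Joined.ne {i j : B} (h : M.Joined i j) : i ≠ j := by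
  rintro rfl; exact h.1 (M.diagonal i)

theorem not_joined_iff {i j : B} (hij : i ≠ j) : ¬ M.Joined i j ↔ M i j = 2 := by
  have := M.off_diagonal i j hij
  unfold Joined; tauto

theorem le_cos_pi_div {m k : ℕ} (hk : 0 < k) (h : m = 0 ∨ k ≤ m) :
    Real.cos (Real.pi / k) ≤ Real.cos (Real.pi / m) := by
  have hk' : (1 : ℝ) ≤ k := by exact_mod_cast hk
  apply Real.cos_le_cos_of_nonneg_of_le_pi
  · positivity
  · exact div_le_self Real.pi_pos.le hk'
  · rcases h with rfl | h
    · simp; positivity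
    · have : (k : ℝ) ≤ m := by exact_mod_cast h
      gcongr

theorem gram_nonpos {i j : B} (h : i ≠ j) : M.gram i j ≤ 0 := by
  have h1 := M.off_diagonal i j h
  have := le_cos_pi_div (m := M i j) (k := 2) (by norm_num) (by omega)
  unfold gram
  norm_num at this
  linarith

theorem Joined.gram_le {i j : B} (h : M.Joined i j) : M.gram i j ≤ -(1 / 2) := by
  have h1 := h.1
  have h2 := h.2
  have := le_cos_pi_div (m := M i j) (k := 3) (by norm_num) (by omega)
  unfold gram
  push_cast at this
  rw [Real.cos_pi_div_three] at this
  linarith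

theorem Heavy.gram_le {i j : B} (h : M.Heavy i j) : M.gram i j ≤ -(√2 / 2) := by
  have h1 := h.1.1
  have h2 := h.1.2
  have h3 := h.2
  have := le_cos_pi_div (m := M i j) (k := 4) (by norm_num) (by omega)
  unfold gram
  push_cast at this
  rw [Real.cos_pi_div_four] at this
  linarith

variable (M)

/-- The subgraph of the Coxeter graph with edges inside `K`. -/
def graph (K : Set B) : SimpleGraph B where
  Adj i j := i ∈ K ∧ j ∈ K ∧ M.Joined i j
  symm := ⟨fun _ _ h => ⟨h.2.1, h.1, h.2.2.symm⟩⟩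
  loopless := ⟨fun _ h => h.2.2.ne rfl⟩

theorem graph_adj {K : Set B} {i j : B} :
    (M.graph K).Adj i j ↔ i ∈ K ∧ j ∈ K ∧ M.Joined i j := Iff.rfl

/-- The Gram matrix of `M` is positive definite. -/
def IsPos [Fintype B] : Prop := ∀ x : B → ℝ, x ≠ 0 → 0 < ∑ i, ∑ j, x i * x j * M.gram i j

/-- The bilinear form attached to the Gram matrix. -/
noncomputable def form [Fintype B] : LinearMap.BilinForm ℝ (B → ℝ) :=
  Matrix.toBilin' (Matrix.of M.gram)

variable [Fintype B]

theorem form_apply (x y : B → ℝ) : M.form x y = ∑ i, ∑ j, x i * M.gram i j * y j :=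
  Matrix.toBilin'_apply _ _ _

theorem form_single (i : B) (y : B → ℝ) : M.form (Pi.single i 1) y = ∑ j, M.gram i j * y j := by
  rw [form_apply, Finset.sum_eq_single i]
  · simp
  · intro j _ hj; simp [hj]
  · simp

theorem form_comm (x y : B → ℝ) : M.form x y = M.form y x := by
  rw [form_apply, form_apply, Finset.sum_comm]
  refine Finset.sum_congr rfl fun i _ => Finset.sum_congr rfl fun j _ => ?_
  rw [M.gram_comm]; ring

variable {M}

theorem IsPos.pos_form (hM : M.IsPos) {x : B → ℝ} (hx : x ≠ 0) : 0 < M.form x x := by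
  rw [form_apply]
  refine lt_of_lt_of_eq (hM x hx) ?_
  refine Finset.sum_congr rfl fun i _ => Finset.sum_congr rfl fun j _ => ?_
  ring

variable (M)

/-- A nonnegative vector of norm at most `b`. -/
def Bounded (x : B → ℝ) (b : ℝ) : Prop := (∀ i, 0 ≤ x i) ∧ M.form x x ≤ b

variable {M}

theorem IsPos.pos_of_bounded (hM : M.IsPos) {x : B → ℝ} {b : ℝ} (h : M.Bounded x b) {i : B}
    (hi : x i ≠ 0) : 0 < b :=
  (hM.pos_form (fun h0 => hi (by rw [h0]; rfl))).trans_le h.2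

theorem bounded_single (i : B) {a : ℝ} (ha : 0 ≤ a) : M.Bounded (Pi.single i a) (a ^ 2) := by
  refine ⟨fun j => ?_, ?_⟩
  · rcases eq_or_ne j i with rfl | h <;> simp [*]
  · have : Pi.single i a = a • (Pi.single i (1 : ℝ) : B → ℝ) := by
      rw [← Pi.single_smul]; simp
    rw [this, map_smul, map_smul, LinearMap.smul_apply, form_single, Finset.sum_eq_single i]
    · simp [gram_self]; ring_nf; rfl
    · intro j _ hj; simp [hj]
    · simp

theorem form_single_le {x : B → ℝ} (hx : ∀ i, 0 ≤ x i) {v : B} (hv : x v = 0) (T : Finset B) :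
    M.form (Pi.single v 1) x ≤ ∑ u ∈ T, M.gram v u * x u := by
  rw [form_single, ← Finset.sum_add_sum_compl T]
  have : ∑ u ∈ Tᶜ, M.gram v u * x u ≤ 0 := by
    refine Finset.sum_nonpos fun u _ => ?_
    rcases eq_or_ne v u with rfl | h
    · simp [hv]
    · exact mul_nonpos_of_nonpos_of_nonneg (M.gram_nonpos h) (hx u)
  linarith

theorem Bounded.add_finset {x : B → ℝ} {b : ℝ} (h : M.Bounded x b) {v : B} (hv : x v = 0)
    (T : Finset B) {a s : ℝ} (ha : 0 ≤ a) (hs : ∑ u ∈ T, M.gram v u * x u ≤ -s) :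
    M.Bounded (Function.update x v a) (b + a ^ 2 - 2 * a * s) := by
  refine ⟨fun j => ?_, ?_⟩
  · rcases eq_or_ne j v with rfl | h' <;> simp [*, h.1 j]
  · have e : Function.update x v a = x + a • (Pi.single v (1 : ℝ) : B → ℝ) := by
      ext j
      rcases eq_or_ne j v with rfl | h' <;> simp [*]
    have h1 := M.form_single_le h.1 hv T
    have h2 : M.form (Pi.single v 1) (Pi.single v 1) = 1 := by
      rw [form_single, Finset.sum_eq_single v]
      · simp [gram_self]
      · intro j _ hj; simp [hj]
      · simp
    rw [e]
    simp only [map_add, map_smul, LinearMap.add_apply, LinearMap.smul_apply, smul_eq_mul, h2]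
    rw [M.form_comm x (Pi.single v 1)]
    have := h.2
    nlinarith

theorem Bounded.add_joined {x : B → ℝ} {b : ℝ} (h : M.Bounded x b) {u v : B} (hv : x v = 0)
    (hj : M.Joined v u) {a : ℝ} (ha : 0 ≤ a) :
    M.Bounded (Function.update x v a) (b + a ^ 2 - a * x u) := by
  have := h.add_finset hv {u} (s := x u / 2) ha (by
    have := mul_le_mul_of_nonneg_right hj.gram_le (h.1 u)
    simp only [Finset.sum_singleton]; linarith)
  convert this using 1; ring

theorem Bounded.add_heavy {x : B → ℝ} {b : ℝ} (h : M.Bounded x b) {u v : B} (hv : x v = 0)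
    (hj : M.Heavy v u) {a : ℝ} (ha : 0 ≤ a) :
    M.Bounded (Function.update x v a) (b + a ^ 2 - √2 * a * x u) := by
  have := h.add_finset hv {u} (s := √2 * x u / 2) ha (by
    have := mul_le_mul_of_nonneg_right hj.gram_le (h.1 u)
    simp only [Finset.sum_singleton]; linarith)
  convert this using 1; ring

end CoxeterMatrix

namespace CoxeterMatrix

theorem bounded_walk [Fintype B] {K : Set B} {u v : B} {p : (M.graph K).Walk u v}
    (hp : p.IsPath) {a : ℝ} (ha : 0 ≤ a) :
    M.Bounded (fun i => if i ∈ p.support then a else 0) (a ^ 2) := by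
  induction p with
  | nil =>
    rename_i u
    convert bounded_single (M := M) u ha using 1
    ext i
    simp [Pi.single_apply]
  | cons h p ih =>
    rename_i u v w
    rw [SimpleGraph.Walk.cons_isPath_iff] at hp
    have := (ih hp.1).add_joined (by simp [hp.2]) (M.graph_adj.1 h).2.2 ha
    convert this using 1
    · ext i
      by_cases hi : i = u <;> simp [hi]
    · simp; ring

theorem IsPos.isAcyclic [Fintype B] (hM : M.IsPos) (K : Set B) : (M.graph K).IsAcyclic := by
  intro u c hc
  cases c with
  | nil => exact hc.ne_nil rfl
  | cons h p =>
    rename_i v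
    rw [SimpleGraph.Walk.cons_isCycle_iff] at hc
    obtain ⟨hp, he⟩ := hc
    cases p with
    | nil => exact h.ne rfl
    | cons h' p =>
      rename_i w
      rw [SimpleGraph.Walk.cons_isPath_iff] at hp
      have hwu : w ≠ u := by rintro rfl; simp [Sym2.eq_swap] at he
      have := (bounded_walk hp.1 (zero_le_one' ℝ)).add_finset (v := v) (by simp [hp.2]) {w, u}
        (s := 1) (a := 1) zero_le_one (by
          rw [Finset.sum_pair hwu]
          have h1 := (M.graph_adj.1 h').2.2.gram_le
          have h2 := (M.graph_adj.1 h).2.2.symm.gram_le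
          simp; linarith)
      have := hM.pos_of_bounded this (i := v) (by simp)
      norm_num at this

variable (M) in
/-- `T` is a heavy neighbour of `v`, or a pair of neighbours of `v`. -/
def Fork (v : B) (T : Set B) : Prop :=
  (∃ a, T = {a} ∧ M.Heavy v a) ∨ (∃ a b, a ≠ b ∧ T = {a, b} ∧ M.Joined v a ∧ M.Joined v b)

theorem Fork.joined {v : B} {T : Set B} (h : M.Fork v T) {a : B} (ha : a ∈ T) : M.Joined v a := by
  rcases h with ⟨b, rfl, hb⟩ | ⟨b, c, _, rfl, hb, hc⟩
  · rw [Set.mem_singleton_iff.1 ha]; exact hb.1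
  · rcases ha with rfl | rfl
    exacts [hb, hc]

theorem Fork.bounded [Fintype B] {v : B} {T : Set B} (hT : M.Fork v T) {x : B → ℝ} {b : ℝ}
    (h : M.Bounded x b) (hv : x v = 2) (hx : ∀ i ∈ T, x i = 0) :
    ∃ y, M.Bounded y (b - 2) ∧ ∀ i ∉ T, y i = x i := by
  rcases hT with ⟨c, rfl, hc⟩ | ⟨c, d, hcd, rfl, hc, hd⟩
  · refine ⟨_, ?_, fun i hi => Function.update_of_ne (by simpa using hi) √2 x⟩
    have := h.add_heavy (hx c rfl) hc.symm (a := √2) (by positivity)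
    convert this using 1
    rw [hv, Real.sq_sqrt (by norm_num), Real.mul_self_sqrt (by norm_num)]; norm_num; ring
  · have h1 := h.add_joined (hx c (by simp)) hc.symm zero_le_one
    have h2 := h1.add_joined (v := d) (by rw [Function.update_of_ne hcd.symm]; exact hx d (by simp))
      hd.symm zero_le_one
    refine ⟨Function.update (Function.update x c 1) d 1, ?_, fun i hi => ?_⟩
    rotate_left
    · rw [Function.update_of_ne, Function.update_of_ne]
      · rintro rfl; simp at hi
      · rintro rfl; simp at hi
    · convert h2 using 1
      rw [Function.update_of_ne hc.ne, hv]; ring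

theorem IsPos.not_fork_fork [Fintype B] (hM : M.IsPos) {K : Set B} {u v : B}
    {p : (M.graph K).Walk u v} (hp : p.IsPath) {T T' : Set B} (hT : M.Fork u T) (hT' : M.Fork v T')
    (h : ∀ i ∈ T, i ∉ p.support) (h' : ∀ i ∈ T', i ∉ p.support) (hd : ∀ i ∈ T, i ∉ T') : False := by
  obtain ⟨y, hy, hy'⟩ := hT.bounded (bounded_walk hp zero_le_two) (by simp)
    (by intro i hi; simp [h i hi])
  have hu : ∀ i ∈ p.support, y i = 2 := by
    intro i hi
    rw [hy' i (fun h2 => h i h2 hi)]; simp [hi]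
  obtain ⟨z, hz, hz'⟩ := hT'.bounded hy (hu v (by simp))
    (by intro i hi; rw [hy' i (fun h2 => hd i h2 hi)]; simp [h' i hi])
  have := hM.pos_of_bounded hz (i := u) (by
    rw [hz' u (fun h2 => h' u h2 (by simp)), hu u (by simp)]; norm_num)
  norm_num at this

theorem IsPos.not_fork_fork_self [Fintype B] (hM : M.IsPos) {v : B} {T T' : Set B}
    (hT : M.Fork v T) (hT' : M.Fork v T') (hd : ∀ i ∈ T, i ∉ T') : False :=
  hM.not_fork_fork (K := ∅) (p := SimpleGraph.Walk.nil) (by simp) hT hT'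
    (by simpa using fun i hi => (hT.joined hi).ne.symm)
    (by simpa using fun i hi => (hT'.joined hi).ne.symm) hd

theorem IsPos.heavy_unique [Fintype B] (hM : M.IsPos) {v a b : B} (ha : M.Heavy v a)
    (hb : M.Heavy v b) : a = b := by
  by_contra h
  exact hM.not_fork_fork_self (Or.inl ⟨a, rfl, ha⟩) (Or.inl ⟨b, rfl, hb⟩) (by simpa using h)

theorem IsPos.eq_of_heavy [Fintype B] (hM : M.IsPos) {v a b c : B} (ha : M.Heavy v a)
    (hb : M.Joined v b) (hba : b ≠ a) (hc : M.Joined v c) (hca : c ≠ a) : b = c := by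
  by_contra h
  exact hM.not_fork_fork_self (Or.inl ⟨a, rfl, ha⟩) (Or.inr ⟨b, c, h, rfl, hb, hc⟩)
    (by simp [hba.symm, hca.symm])

theorem IsPos.mem_of_joined [Fintype B] (hM : M.IsPos) {v a b c d : B} (ha : M.Joined v a)
    (hb : M.Joined v b) (hc : M.Joined v c) (hab : a ≠ b) (hac : a ≠ c) (hbc : b ≠ c)
    (hd : M.Joined v d) : d = a ∨ d = b ∨ d = c := by
  by_contra! h
  exact hM.not_fork_fork_self (Or.inr ⟨a, b, hab, rfl, ha, hb⟩) (Or.inr ⟨c, d, h.2.2.symm, rfl, hc, hd⟩)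
    (by simp [hac, hbc, h.1.symm, h.2.1.symm])

variable (M) in
/-- `v` has a heavy neighbour or at least three neighbours in `K`. -/
def Defect (K : Set B) (v : B) : Prop :=
  (∃ a ∈ K, M.Heavy v a) ∨
    ∃ a ∈ K, ∃ b ∈ K, ∃ c ∈ K, a ≠ b ∧ a ≠ c ∧ b ≠ c ∧ M.Joined v a ∧ M.Joined v b ∧ M.Joined v c

theorem Defect.mono {K L : Set B} (h : K ⊆ L) {v : B} (hv : M.Defect K v) : M.Defect L v := by
  rcases hv with ⟨a, ha, h1⟩ | ⟨a, ha, b, hb, c, hc, h1⟩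
  · exact Or.inl ⟨a, h ha, h1⟩
  · exact Or.inr ⟨a, h ha, b, h hb, c, h hc, h1⟩

theorem graph_univ_adj {i j : B} : (M.graph Set.univ).Adj i j ↔ M.Joined i j := by
  simp [graph_adj]

/-- The start of a path can be moved along a heavy edge so as to carry a fork disjoint from
the path. -/
theorem IsPos.exists_fork [Fintype B] (hM : M.IsPos) {u v : B}
    {p : (M.graph Set.univ).Walk u v} (hp : p.IsPath) (hu : M.Defect Set.univ u) (huv : u ≠ v)
    (hh : ¬ M.Heavy u v) :
    ∃ (w : B) (q : (M.graph Set.univ).Walk w v) (T : Set B), q.IsPath ∧ w ≠ v ∧ M.Fork w T ∧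
      (∀ i ∈ q.support, i ∈ p.support) ∧ (∀ i ∈ T, i ∉ q.support) ∧
      (w = u ∨ M.Heavy u w) := by
  have hac := hM.isAcyclic Set.univ
  rcases hu with ⟨a, -, ha⟩ | ⟨a, -, b, -, c, -, hab, hac', hbc, ha, hb, hc⟩
  · by_cases hap : a ∈ p.support
    · cases p with
      | nil => exact absurd rfl huv
      | cons h p =>
        rename_i w
        have h1 := hac.eq_snd_of_adj_start hp (graph_univ_adj.2 ha.1) hap
        have h1 : a = w := by simpa using h1
        subst h1
        rw [SimpleGraph.Walk.cons_isPath_iff] at hp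
        refine ⟨a, p, {u}, hp.1, ?_, Or.inl ⟨u, rfl, ha.symm⟩, ?_, ?_, Or.inr ha⟩
        · rintro rfl; exact hh ha
        · intro i hi; simp [hi]
        · simpa using hp.2
    · exact ⟨u, p, {a}, hp, huv, Or.inl ⟨a, rfl, ha⟩, fun _ h => h, by simpa using hap, Or.inl rfl⟩
  · have key : ∀ d, M.Joined u d → d ∈ p.support → d = p.snd := fun d hd h =>
      hac.eq_snd_of_adj_start hp (graph_univ_adj.2 hd) h
    have : ∀ d e, d ≠ e → M.Joined u d → M.Joined u e → d ≠ p.snd → e ≠ p.snd →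
      ∃ (w : B) (q : (M.graph Set.univ).Walk w v) (T : Set B), q.IsPath ∧ w ≠ v ∧ M.Fork w T ∧
        (∀ i ∈ q.support, i ∈ p.support) ∧ (∀ i ∈ T, i ∉ q.support) ∧
        (w = u ∨ M.Heavy u w) := by
      intro d e hde hd he hd' he'
      refine ⟨u, p, {d, e}, hp, huv, Or.inr ⟨d, e, hde, rfl, hd, he⟩, fun _ h => h, ?_, Or.inl rfl⟩
      rintro i (rfl | rfl) h
      exacts [hd' (key _ hd h), he' (key _ he h)]
    by_cases h1 : a = p.snd
    · exact this b c hbc hb hc (h1 ▸ hab.symm) (h1 ▸ hac'.symm)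
    by_cases h2 : b = p.snd
    · exact this a c hac' ha hc h1 (h2 ▸ hbc.symm)
    exact this a b hab ha hb h1 h2

/-- A connected component has at most one defect, or two joined by a heavy edge. -/
theorem IsPos.defect_unique [Fintype B] (hM : M.IsPos) {u v : B}
    (h : (M.graph Set.univ).Reachable u v) (hu : M.Defect Set.univ u)
    (hv : M.Defect Set.univ v) : u = v ∨ M.Heavy u v := by
  by_contra! hcon
  have hac := hM.isAcyclic Set.univ
  obtain ⟨p, hp⟩ := h.exists_isPath
  obtain ⟨w, q, T, hq, hwv, hT, hqp, hTq, hw⟩ := hM.exists_fork hp hu hcon.1 hcon.2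
  obtain ⟨w', q', T', hq', hwv', hT', hqp', hTq', hw'⟩ := hM.exists_fork hq.reverse hv hwv.symm (by
    intro hvw
    rcases hw with rfl | hw
    · exact hcon.2 hvw.symm
    · exact hcon.1 (hM.heavy_unique hw.symm hvw.symm))
  have hTq'' : ∀ i ∈ T, i ∉ q'.support := fun i hi h => hTq i hi (by simpa using hqp' i h)
  refine hM.not_fork_fork hq' hT' hT hTq' hTq'' fun i hi hi' => ?_
  have h1 : (SimpleGraph.Walk.cons (graph_univ_adj.2 (hT.joined hi').symm) q'.reverse).IsPath := by
    rw [SimpleGraph.Walk.cons_isPath_iff]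
    exact ⟨hq'.reverse, by simpa using hTq'' i hi'⟩
  have h2 := hac.eq_penultimate_of_adj_end h1 (graph_univ_adj.2 (hT'.joined hi)) (by simp)
  have h3 : ¬ (q'.reverse).Nil := by
    rw [SimpleGraph.Walk.nil_reverse]
    exact fun h => hwv' h.eq
  rw [SimpleGraph.Walk.penultimate_cons_of_not_nil _ _ h3] at h2
  exact hTq'' i hi' (by rw [h2]; simpa using q'.reverse.penultimate_mem_support)

end CoxeterMatrix

namespace CoxeterMatrix

variable [Fintype B]

theorem IsPos.not_triangle (hM : M.IsPos) {a b c : B} (hab : M.Joined a b) (hbc : M.Joined b c)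
    (hca : M.Joined c a) : False := by
  have := (hM.isAcyclic Set.univ).eq_snd_of_adj_start
    (p := .cons (graph_univ_adj.2 hab) (.cons (graph_univ_adj.2 hbc) .nil))
    (by simp [SimpleGraph.Walk.cons_isPath_iff, hab.ne, hbc.ne, hca.ne.symm])
    (graph_univ_adj.2 hca.symm) (by simp)
  exact hbc.ne.symm (by simpa using this)

theorem IsPos.not_square (hM : M.IsPos) {a b c d : B} (hab : M.Joined a b) (hbc : M.Joined b c)
    (hcd : M.Joined c d) (hda : M.Joined d a) (hac : a ≠ c) (hbd : b ≠ d) : False := by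
  have := (hM.isAcyclic Set.univ).eq_snd_of_adj_start
    (p := .cons (graph_univ_adj.2 hab) (.cons (graph_univ_adj.2 hbc)
      (.cons (graph_univ_adj.2 hcd) .nil)))
    (by simp [SimpleGraph.Walk.cons_isPath_iff, hab.ne, hbc.ne, hcd.ne, hda.ne.symm, hac, hbd])
    (graph_univ_adj.2 hda.symm) (by simp)
  exact hbd.symm (by simpa using this)

theorem IsPos.not_pentagon (hM : M.IsPos) {a b c d e : B} (hab : M.Joined a b)
    (hbc : M.Joined b c) (hcd : M.Joined c d) (hde : M.Joined d e) (hea : M.Joined e a)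
    (hac : a ≠ c) (had : a ≠ d) (hbd : b ≠ d) (hbe : b ≠ e) (hce : c ≠ e) : False := by
  have := (hM.isAcyclic Set.univ).eq_snd_of_adj_start
    (p := .cons (graph_univ_adj.2 hab) (.cons (graph_univ_adj.2 hbc)
      (.cons (graph_univ_adj.2 hcd) (.cons (graph_univ_adj.2 hde) .nil))))
    (by simp [SimpleGraph.Walk.cons_isPath_iff, hab.ne, hbc.ne, hcd.ne, hde.ne, hea.ne.symm,
          hac, hbd, had, hbe, hce])
    (graph_univ_adj.2 hea.symm) (by simp)
  exact hbe.symm (by simpa using this)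

theorem IsPos.not_hexagon (hM : M.IsPos) {a b c d e f : B} (hab : M.Joined a b)
    (hbc : M.Joined b c) (hcd : M.Joined c d) (hde : M.Joined d e) (hef : M.Joined e f)
    (hfa : M.Joined f a) (hac : a ≠ c) (had : a ≠ d) (hae : a ≠ e) (hbd : b ≠ d) (hbe : b ≠ e)
    (hbf : b ≠ f) (hce : c ≠ e) (hcf : c ≠ f) (hdf : d ≠ f) : False := by
  have := (hM.isAcyclic Set.univ).eq_snd_of_adj_start
    (p := .cons (graph_univ_adj.2 hab) (.cons (graph_univ_adj.2 hbc)
      (.cons (graph_univ_adj.2 hcd) (.cons (graph_univ_adj.2 hde)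
        (.cons (graph_univ_adj.2 hef) .nil)))))
    (by simp [SimpleGraph.Walk.cons_isPath_iff, hab.ne, hbc.ne, hcd.ne, hde.ne, hef.ne,
          hfa.ne.symm, hac, hbd, had, hbe, hce, hae, hbf, hcf, hdf])
    (graph_univ_adj.2 hfa.symm) (by simp)
  exact hbf.symm (by simpa using this)

/-- The affine diagram `F̃₄` does not occur. -/
theorem IsPos.not_affineF (hM : M.IsPos) {s k i j l : B} (hsk : M.Joined s k)
    (hki : M.Joined k i) (hij : M.Heavy i j) (hjl : M.Joined j l) (hsi : s ≠ i) (hkj : k ≠ j)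
    (hil : i ≠ l) : False := by
  have hkl : k ≠ l := by rintro rfl; exact hM.not_triangle hki hij.1 hjl
  have hsj : s ≠ j := by rintro rfl; exact hM.not_triangle hki hij.1 hsk
  have hsl : s ≠ l := by rintro rfl; exact hM.not_square hki hij.1 hjl hsk hkj hil
  have h1 := bounded_single (M := M) i (a := 3) (by norm_num)
  have h2 := h1.add_joined (v := k) (by simp [hki.ne]) hki (a := 2) (by norm_num)
  have h3 := h2.add_joined (v := s) (by simp [hsk.ne, hsi]) hsk (a := 1) (by norm_num)
  have h4 := h3.add_heavy (v := j) (by simp [hkj.symm, hsj.symm, hij.1.ne.symm]) hij.symm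
    (a := 2 * √2) (by positivity)
  have h5 := h4.add_joined (v := l) (by simp [hjl.ne.symm, hil.symm, hkl.symm, hsl.symm]) hjl.symm
    (a := √2) (by positivity)
  have h6 := hM.pos_of_bounded h5 (i := l) (by simp)
  simp [hki.ne.symm, hsi.symm] at h6
  have := Real.mul_self_sqrt (show (0 : ℝ) ≤ 2 by norm_num)
  nlinarith

/-- The affine diagram `Ẽ₆` does not occur. -/
theorem IsPos.not_affineE6 (hM : M.IsPos) {c x y z x' y' z' : B} (hx : M.Joined c x)
    (hy : M.Joined c y) (hz : M.Joined c z) (hxy : x ≠ y) (hxz : x ≠ z) (hyz : y ≠ z)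
    (hx' : M.Joined x x') (hy' : M.Joined y y') (hz' : M.Joined z z') (hcx : c ≠ x')
    (hcy : c ≠ y') (hcz : c ≠ z') : False := by
  have tri : ∀ {u v w}, M.Joined c u → M.Joined c v → M.Joined u w → w ≠ v := by
    rintro u v w h1 h2 h3 rfl; exact hM.not_triangle h1 h3 h2.symm
  have sq : ∀ {u v u' v'}, M.Joined c u → M.Joined c v → M.Joined u u' → M.Joined v v' → u ≠ v →
      c ≠ u' → u' ≠ v' := by
    rintro u v u' v' h1 h2 h3 h4 h5 h6 rfl
    exact hM.not_square h1 h3 h4.symm h2.symm h6 h5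
  have h1 := bounded_single (M := M) c (a := 3) (by norm_num)
  have h2 := h1.add_joined (v := x) (by simp [hx.ne.symm]) hx.symm (a := 2) (by norm_num)
  have h3 := h2.add_joined (v := y) (by simp [hy.ne.symm, hxy.symm]) hy.symm (a := 2) (by norm_num)
  have h4 := h3.add_joined (v := z) (by simp [hz.ne.symm, hxz.symm, hyz.symm]) hz.symm
    (a := 2) (by norm_num)
  have h5 := h4.add_joined (v := x') (u := x)
    (by simp [hcx.symm, hx'.ne.symm, tri hx hy hx', tri hx hz hx']) hx'.symm
    (a := 1) (by norm_num)
  have h6 := h5.add_joined (v := y') (u := y)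
    (by simp [hcy.symm, hy'.ne.symm, tri hy hx hy', tri hy hz hy',
          (sq hx hy hx' hy' hxy hcx).symm]) hy'.symm (a := 1) (by norm_num)
  have h7 := h6.add_joined (v := z') (u := z)
    (by simp [hcz.symm, hz'.ne.symm, tri hz hx hz', tri hz hy hz',
          (sq hx hz hx' hz' hxz hcx).symm, (sq hy hz hy' hz' hyz hcy).symm]) hz'.symm
    (a := 1) (by norm_num)
  have h8 := hM.pos_of_bounded h7 (i := z') (by simp)
  norm_num [hx.ne, hy.ne, hz.ne, hxy, hxz, hyz, hx'.ne, hy'.ne, hz'.ne,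
    (tri hx hy hx').symm, (tri hx hz hx').symm, (tri hy hz hy').symm] at h8

/-- The affine diagram `Ẽ₇` does not occur. -/
theorem IsPos.not_affineE7 (hM : M.IsPos) {c x y z x' y' x'' y'' : B} (hx : M.Joined c x)
    (hy : M.Joined c y) (hz : M.Joined c z) (hxy : x ≠ y) (hxz : x ≠ z) (hyz : y ≠ z)
    (hx' : M.Joined x x') (hy' : M.Joined y y') (hx'' : M.Joined x' x'') (hy'' : M.Joined y' y'')
    (hcx : c ≠ x') (hcy : c ≠ y') (hxx : x ≠ x'') (hyy : y ≠ y'') : False := by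
  have tri : ∀ {u v w}, M.Joined c u → M.Joined c v → M.Joined u w → w ≠ v := by
    rintro u v w h1 h2 h3 rfl; exact hM.not_triangle h1 h3 h2.symm
  have sq : ∀ {u v u' v'}, M.Joined c u → M.Joined c v → M.Joined u u' → M.Joined v v' → u ≠ v →
      c ≠ u' → u' ≠ v' := by
    rintro u v u' v' h1 h2 h3 h4 h5 h6 rfl
    exact hM.not_square h1 h3 h4.symm h2.symm h6 h5
  have hcx'' : x'' ≠ c := by rintro rfl; exact hM.not_triangle hx hx' hx''
  have hcy'' : y'' ≠ c := by rintro rfl; exact hM.not_triangle hy hy' hy''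
  have sq' : ∀ {u v u' u''}, M.Joined c u → M.Joined c v → M.Joined u u' → M.Joined u' u'' →
      u ≠ v → c ≠ u' → u'' ≠ v := by
    rintro u v u' u'' h1 h2 h3 h4 h5 h6 rfl
    exact hM.not_square h1 h3 h4 h2.symm h6 h5
  have pent : ∀ {u v u' v' u''}, M.Joined c u → M.Joined c v → M.Joined u u' → M.Joined v v' →
      M.Joined u' u'' → u ≠ v → c ≠ u' → c ≠ v' → u'' ≠ v' := by
    rintro u v u' v' u'' h1 h2 h3 h4 h5 h6 h7 h8 rfl
    exact hM.not_pentagon h1 h3 h5 h4.symm h2.symm h7 h8 (tri h2 h1 h4).symm h6 (tri h1 h2 h3)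
  have hex : x'' ≠ y'' := by
    intro h
    exact hM.not_hexagon hx hx' hx'' (h ▸ hy''.symm) hy'.symm hy.symm hcx hcx''.symm hcy
      hxx (tri hy hx hy').symm hxy (sq hx hy hx' hy' hxy hcx) (tri hx hy hx')
      (h ▸ hyy.symm)
  have h1 := bounded_single (M := M) c (a := 4) (by norm_num)
  have h2 := h1.add_joined (v := z) (by simp [hz.ne.symm]) hz.symm (a := 2) (by norm_num)
  have h3 := h2.add_joined (v := x) (by simp [hx.ne.symm, hxz]) hx.symm (a := 3) (by norm_num)
  have h4 := h3.add_joined (v := y) (by simp [hy.ne.symm, hxy.symm, hyz]) hy.symm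
    (a := 3) (by norm_num)
  have h5 := h4.add_joined (v := x') (u := x)
    (by simp [hcx.symm, hx'.ne.symm, tri hx hy hx', tri hx hz hx']) hx'.symm
    (a := 2) (by norm_num)
  have h6 := h5.add_joined (v := y') (u := y)
    (by simp [hcy.symm, hy'.ne.symm, tri hy hx hy', tri hy hz hy',
          (sq hx hy hx' hy' hxy hcx).symm]) hy'.symm (a := 2) (by norm_num)
  have h7 := h6.add_joined (v := x'') (u := x')
    (by simp [hcx'', hx''.ne.symm, hxx.symm, sq' hx hy hx' hx'' hxy hcx,
          sq' hx hz hx' hx'' hxz hcx, pent hx hy hx' hy' hx'' hxy hcx hcy]) hx''.symm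
    (a := 1) (by norm_num)
  have h8 := h7.add_joined (v := y'') (u := y')
    (by simp [hcy'', hy''.ne.symm, hyy.symm, sq' hy hx hy' hy'' hxy.symm hcy, hex.symm,
          sq' hy hz hy' hy'' hyz hcy, pent hy hx hy' hx' hy'' hxy.symm hcy hcx]) hy''.symm
    (a := 1) (by norm_num)
  have h9 := hM.pos_of_bounded h8 (i := y'') (by simp)
  norm_num [hx.ne, hy.ne, hz.ne, hxy, hxz.symm, hyz.symm, hx'.ne, hy'.ne, hx''.ne, hy''.ne,
    (tri hx hy hx').symm, (tri hx hz hx').symm, (tri hy hz hy').symm, hxz, hyz, hex,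
    (sq hx hy hx' hy' hxy hcx), (pent hx hy hx' hy' hx'' hxy hcx hcy).symm, hxx, hyy] at h9

/-- A nonempty set of vertices contains a vertex with at most one neighbour in the set. -/
theorem IsPos.exists_endpoint (hM : M.IsPos) {C : Set B} (hC : C.Nonempty) :
    ∃ x ∈ C, ∀ a ∈ C, ∀ b ∈ C, M.Joined x a → M.Joined x b → a = b := by
  by_contra! hcon
  obtain ⟨i₀, hi₀⟩ := hC
  let x : B → ℝ := fun i => if i ∈ C then 1 else 0
  have hx : ∀ i, 0 ≤ x i := fun i => by simp only [x]; split_ifs <;> norm_num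
  have hpos := hM.pos_form (x := x) (fun h => by simpa [x, hi₀] using congrFun h i₀)
  refine absurd hpos (not_lt.2 ?_)
  rw [form_apply]
  refine Finset.sum_nonpos fun i _ => ?_
  by_cases hi : i ∈ C
  · obtain ⟨a, ha, b, hb, hia, hib, hab⟩ := hcon i hi
    rw [← Finset.sum_add_sum_compl ({i, a, b} : Finset B)]
    have h1 : ∑ j ∈ ({i, a, b} : Finset B)ᶜ, x i * M.gram i j * x j ≤ 0 := by
      refine Finset.sum_nonpos fun j hj => ?_
      have : i ≠ j := by rintro rfl; simp at hj
      exact mul_nonpos_of_nonpos_of_nonneg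
        (mul_nonpos_of_nonneg_of_nonpos (hx i) (M.gram_nonpos this)) (hx j)
    have h2 : ∑ j ∈ ({i, a, b} : Finset B), x i * M.gram i j * x j ≤ 0 := by
      rw [Finset.sum_insert (by simp [hia.ne, hib.ne]), Finset.sum_pair hab]
      have := hia.gram_le
      have := hib.gram_le
      simp only [x, hi, ha, hb, gram_self, if_true]
      linarith
    linarith
  · simp [x, hi]

end CoxeterMatrix

namespace CoxeterSystem

variable (cs : CoxeterSystem M W)

theorem commute_simple {i j : B} (h : M i j = 2) : Commute (cs.simple i) (cs.simple j) := by
  have h1 := cs.simple_mul_simple_pow i j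
  rw [h, pow_two, mul_eq_one_iff_eq_inv, mul_inv_rev, inv_simple, inv_simple] at h1
  exact h1

theorem commute_simple_of_not_joined {i j : B} (h : ¬ M.Joined i j) :
    Commute (cs.simple i) (cs.simple j) := by
  rcases eq_or_ne i j with rfl | hij
  · exact Commute.refl _
  · exact cs.commute_simple ((CoxeterMatrix.not_joined_iff hij).1 h)

theorem braid_simple {i j : B} (h : M i j = 3) :
    cs.simple i * cs.simple j * cs.simple i = cs.simple j * cs.simple i * cs.simple j := by
  have h1 := cs.simple_mul_simple_pow i j
  rw [h, pow_succ, pow_two] at h1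
  have h2 : (cs.simple i * cs.simple j * cs.simple i) *
      (cs.simple j * cs.simple i * cs.simple j) = 1 := by
    rw [← h1]; group
  rw [mul_eq_one_iff_eq_inv] at h2
  rw [h2]; simp [mul_assoc]

theorem gram_eq_zero_of_commute {i j : B} (hij : i ≠ j)
    (h : Commute (cs.simple i) (cs.simple j)) : M.gram i j = 0 := by
  have h1 := congrArg (fun w => cs.geomRep w (Finsupp.single j 1) j) h.eq
  have hc : M.coroot i (Finsupp.single j 1) = 2 * M.gram i j := by
    rw [M.coroot_single, one_mul]
  have hc' : M.coroot j (Finsupp.single i 1) = 2 * M.gram i j := by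
    rw [M.coroot_single, one_mul, M.gram_comm]
  simp only [map_mul, LinearEquiv.mul_apply, geomRep_simple, CoxeterMatrix.geomReflection_apply,
    M.coroot_self, hc, hc', map_sub, map_smul, smul_eq_mul, Finsupp.sub_apply,
    Finsupp.smul_apply, Finsupp.single_apply, hij, if_true, if_false] at h1
  nlinarith

theorem gram_sq_of_braid {i j : B} (hij : i ≠ j)
    (h : cs.simple i * cs.simple j * cs.simple i = cs.simple j * cs.simple i * cs.simple j) :
    M.gram i j ^ 2 = 1 / 4 := by
  have h1 := congrArg (fun w => cs.geomRep w (Finsupp.single i 1) i) h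
  have hc : M.coroot i (Finsupp.single j 1) = 2 * M.gram i j := by
    rw [M.coroot_single, one_mul]
  have hc' : M.coroot j (Finsupp.single i 1) = 2 * M.gram i j := by
    rw [M.coroot_single, one_mul, M.gram_comm]
  simp only [map_mul, LinearEquiv.mul_apply, geomRep_simple, CoxeterMatrix.geomReflection_apply,
    M.coroot_self, hc, hc', map_sub, map_smul, smul_eq_mul, Finsupp.sub_apply,
    Finsupp.smul_apply, Finsupp.single_apply, hij.symm, if_true, if_false] at h1
  linarith

theorem joined_iff_not_commute {i j : B} :
    M.Joined i j ↔ ¬ Commute (cs.simple i) (cs.simple j) := by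
  refine ⟨fun h h' => ?_, fun h => by_contra fun h' => h (cs.commute_simple_of_not_joined h')⟩
  have := h.gram_le
  rw [cs.gram_eq_zero_of_commute h.ne h'] at this
  norm_num at this

theorem heavy_iff {i j : B} : M.Heavy i j ↔ M.Joined i j ∧
    cs.simple i * cs.simple j * cs.simple i ≠ cs.simple j * cs.simple i * cs.simple j := by
  refine ⟨fun h => ⟨h.1, fun h' => ?_⟩, fun h => ⟨h.1, fun h' => h.2 (cs.braid_simple h')⟩⟩
  have h1 := h.gram_le
  have h2 := cs.gram_sq_of_braid h.1.ne h'
  have h3 : √2 ^ 2 = (2 : ℝ) := Real.sq_sqrt (by norm_num)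
  nlinarith [Real.sqrt_nonneg (2 : ℝ)]

theorem joined_conj {n : W} {i j i' j' : B}
    (hi : n * cs.simple i * n⁻¹ = cs.simple i') (hj : n * cs.simple j * n⁻¹ = cs.simple j') :
    M.Joined i' j' ↔ M.Joined i j := by
  rw [cs.joined_iff_not_commute, cs.joined_iff_not_commute, ← hi, ← hj, Commute.conj_iff]

theorem heavy_conj {n : W} {i j i' j' : B}
    (hi : n * cs.simple i * n⁻¹ = cs.simple i') (hj : n * cs.simple j * n⁻¹ = cs.simple j') :
    M.Heavy i' j' ↔ M.Heavy i j := by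
  rw [cs.heavy_iff, cs.heavy_iff, cs.joined_conj hi hj, ← hi, ← hj, conj_mul, conj_mul,
    conj_mul, conj_mul, Ne, Ne, mul_left_inj, mul_right_inj]

end CoxeterSystem

namespace CoxeterSystem

variable (cs : CoxeterSystem M W)

theorem commute_of_mem_parabolic {A C : Set B} (h : ∀ a ∈ A, ∀ c ∈ C, ¬ M.Joined a c) {x y : W}
    (hx : x ∈ parabolic cs A) (hy : y ∈ parabolic cs C) : Commute x y := by
  have h1 : parabolic cs A ≤ Subgroup.centralizer (parabolic cs C : Set W) := by
    rw [parabolic, parabolic, Subgroup.centralizer_closure, Subgroup.closure_le]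
    rintro _ ⟨a, ha, rfl⟩
    rw [SetLike.mem_coe, Subgroup.mem_centralizer_iff]
    rintro _ ⟨c, hc, rfl⟩
    exact (cs.commute_simple_of_not_joined (h a ha c hc)).eq.symm
  exact (Subgroup.mem_centralizer_iff.1 (h1 hx) y hy).symm

theorem exists_eq_simple {I : Set B} {x : W} (hx : x ∈ parabolic cs I) (h : cs.length x = 1) :
    ∃ i ∈ I, x = cs.simple i := by
  obtain ⟨ω, h1, h2, rfl⟩ := cs.exists_isReduced_of_mem_parabolic hx
  rw [h2.eq, List.length_eq_one_iff] at h
  obtain ⟨i, rfl⟩ := h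
  exact ⟨i, h1 i (by simp), by simp⟩

theorem mem_of_simple_mem_parabolic {I : Set B} {i : B} (h : cs.simple i ∈ parabolic cs I) :
    i ∈ I := by
  obtain ⟨j, hj, h1⟩ := cs.exists_eq_simple h (cs.length_simple i)
  rwa [cs.simple_injective h1]

theorem reachable_of_conj {K : Set B} {d : W} (hd : d ∈ parabolic cs K) {i j : B} (hi : i ∈ K)
    (h : d * cs.simple i * d⁻¹ = cs.simple j) : (M.graph K).Reachable i j := by
  let C : Set B := {k | (M.graph K).Reachable i k}
  have hC : ∀ c ∈ C, c ∈ K := by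
    rintro c ⟨p⟩
    cases p.reverse with
    | nil => exact hi
    | cons h _ => exact h.1
  have key : ∀ ω : List B, (∀ k ∈ ω, k ∈ K) → ∀ x ∈ parabolic cs C,
      cs.wordProd ω * x * (cs.wordProd ω)⁻¹ ∈ parabolic cs C := by
    intro ω
    induction ω with
    | nil => simp
    | cons k ω ih =>
      intro hω x hx
      have ih := ih (fun l hl => hω l (List.mem_cons_of_mem _ hl)) x hx
      rw [wordProd_cons, mul_inv_rev, inv_simple, ← mul_assoc, mul_assoc (cs.simple k),
        mul_assoc (cs.simple k)]
      generalize cs.wordProd ω * x * (cs.wordProd ω)⁻¹ = y at ih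
      by_cases hkC : k ∈ C
      · have := cs.simple_mem_parabolic hkC
        exact mul_mem (mul_mem this ih) this
      · have : Commute y (cs.simple k) :=
          cs.commute_of_mem_parabolic (C := {k}) (by
            rintro a ha _ rfl hj
            exact hkC (SimpleGraph.Reachable.trans ha
              (SimpleGraph.Adj.reachable ⟨hC a ha, hω _ List.mem_cons_self, hj⟩))) ih
            (cs.simple_mem_parabolic rfl)
        rwa [← this.eq, simple_mul_simple_cancel_right]
  obtain ⟨ω, hω, rfl⟩ := cs.exists_word_of_mem_parabolic hd
  have h1 := key ω hω _ (cs.simple_mem_parabolic (show i ∈ C from SimpleGraph.Reachable.refl _))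
  rw [h] at h1
  exact cs.mem_of_simple_mem_parabolic h1

/-- Conjugation by `n` permutes the simple reflections indexed by `K`, through `π`. -/
def IsConjPerm (n : W) (K : Set B) (π : B → B) : Prop :=
  ∀ i ∈ K, π i ∈ K ∧ n * cs.simple i * n⁻¹ = cs.simple (π i)

variable {cs}

namespace IsConjPerm

variable {n : W} {K : Set B} {π : B → B}

theorem injOn (h : cs.IsConjPerm n K π) : Set.InjOn π K := by
  intro i hi j hj hij
  have h1 := (h i hi).2
  rw [hij, ← (h j hj).2] at h1
  exact cs.simple_injective (by simpa using h1)

theorem bijOn [Finite B] (h : cs.IsConjPerm n K π) : Set.BijOn π K K := by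
  have hm : Set.MapsTo π K K := fun i hi => (h i hi).1
  exact ((Set.toFinite K).injOn_iff_bijOn_of_mapsTo hm).1 h.injOn

theorem joined_iff (h : cs.IsConjPerm n K π) {i j : B} (hi : i ∈ K) (hj : j ∈ K) :
    M.Joined (π i) (π j) ↔ M.Joined i j :=
  cs.joined_conj (h i hi).2 (h j hj).2

theorem heavy_iff (h : cs.IsConjPerm n K π) {i j : B} (hi : i ∈ K) (hj : j ∈ K) :
    M.Heavy (π i) (π j) ↔ M.Heavy i j :=
  cs.heavy_conj (h i hi).2 (h j hj).2

theorem conj_mem (h : cs.IsConjPerm n K π) {A C : Set B} (hA : A ⊆ K) (hC : Set.MapsTo π A C)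
    {x : W} (hx : x ∈ parabolic cs A) : n * x * n⁻¹ ∈ parabolic cs C := by
  induction hx using Subgroup.closure_induction with
  | mem y hy =>
    obtain ⟨k, hk, rfl⟩ := hy
    rw [(h k (hA hk)).2]
    exact cs.simple_mem_parabolic (hC hk)
  | one => simp
  | mul a b _ _ iha ihb => simpa [mul_assoc] using mul_mem iha ihb
  | inv a _ ih => simpa [mul_assoc] using inv_mem ih

theorem eq_of_eqOn_id (h : cs.IsConjPerm n K π) {A : Set B} (hA : A ⊆ K)
    (hid : ∀ i ∈ A, π i = i) {x : W} (hx : x ∈ parabolic cs A) : n * x * n⁻¹ = x := by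
  induction hx using Subgroup.closure_induction with
  | mem y hy =>
    obtain ⟨k, hk, rfl⟩ := hy
    rw [(h k (hA hk)).2, hid k hk]
  | one => simp
  | mul a b _ _ iha ihb => rw [← conj_mul, iha, ihb]
  | inv a _ ih => rw [← conj_inv, ih]

theorem mono (h : cs.IsConjPerm n K π) {A : Set B} (hA : A ⊆ K) (hm : Set.MapsTo π A A) :
    cs.IsConjPerm n A π := fun i hi => ⟨hm hi, (h i (hA hi)).2⟩

theorem mul {m : W} {ρ : B → B} (h : cs.IsConjPerm n K π) (h' : cs.IsConjPerm m K ρ) :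
    cs.IsConjPerm (n * m) K (π ∘ ρ) := by
  intro i hi
  refine ⟨(h _ (h' i hi).1).1, ?_⟩
  rw [Function.comp, ← (h _ (h' i hi).1).2, ← (h' i hi).2]
  simp [mul_assoc]

theorem exists_inv [Finite B] (h : cs.IsConjPerm n K π) : ∃ ρ, cs.IsConjPerm n⁻¹ K ρ := by
  have h1 : ∀ i ∈ K, ∃ j ∈ K, π j = i := fun i hi => h.bijOn.surjOn hi
  choose! ρ hρ hρ' using h1
  refine ⟨ρ, fun i hi => ⟨hρ i hi, ?_⟩⟩
  have h2 := (h _ (hρ i hi)).2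
  rw [hρ' i hi] at h2
  rw [← h2]; simp [mul_assoc]

theorem reachable (h : cs.IsConjPerm n K π) {i j : B} (hi : i ∈ K)
    (hij : (M.graph K).Reachable i j) : (M.graph K).Reachable (π i) (π j) := by
  obtain ⟨p⟩ := hij
  induction p with
  | nil => exact SimpleGraph.Reachable.refl _
  | cons hadj _ ih =>
    refine SimpleGraph.Reachable.trans (SimpleGraph.Adj.reachable ?_) (ih hadj.2.1)
    exact ⟨(h _ hadj.1).1, (h _ hadj.2.1).1, (h.joined_iff hadj.1 hadj.2.1).2 hadj.2.2⟩

end IsConjPerm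

theorem exists_isConjPerm {n : W} {K : Set B}
    (h : ∀ i ∈ K, ∃ j ∈ K, n * cs.simple i * n⁻¹ = cs.simple j) :
    ∃ π, cs.IsConjPerm n K π := by
  choose! π hπ using h
  exact ⟨π, hπ⟩

theorem length_conj_eq {y : W} {K : Set B}
    (hd : ∀ i ∈ K, cs.length (y * cs.simple i) < cs.length y) {u : W} (hu : u ∈ parabolic cs K) :
    cs.length (y * u⁻¹) + cs.length u = cs.length y := by
  obtain ⟨ω, h1, h2, rfl⟩ := cs.exists_isReduced_of_mem_parabolic hu
  clear hu
  induction ω using List.reverseRecOn with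
  | nil => simp
  | append_singleton ω i ih =>
    have hω : cs.IsReduced ω := by simpa using h2.take ω.length
    have ih := ih (fun j hj => h1 j (by simp [hj])) hω
    obtain ⟨ξ, hξ, hx⟩ := cs.exists_isReduced (y * (cs.wordProd ω)⁻¹)
    have hy : y = cs.wordProd (ξ ++ ω) := by rw [wordProd_append, ← hx]; simp
    have hi := hd i (h1 i (by simp))
    obtain ⟨j, hj, he⟩ := cs.exchange (by rw [← hy]; exact hi : cs.length
      (cs.wordProd (ξ ++ ω) * cs.simple i) < _)
    have hlen : cs.length (cs.wordProd (ω ++ [i])) = ω.length + 1 := by rw [h2.eq]; simp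
    have hω' := hω.eq
    have hξ' := hξ.eq
    rw [← hx] at hξ'
    by_cases hlt : j < ξ.length
    · rw [List.eraseIdx_append_of_lt_length hlt, ← hy, wordProd_append] at he
      have h3 : y * (cs.wordProd (ω ++ [i]))⁻¹ = cs.wordProd (ξ.eraseIdx j) := by
        rw [wordProd_append, wordProd_singleton, mul_inv_rev, inv_simple, ← mul_assoc, he,
          mul_inv_cancel_right]
      have h4 := cs.length_wordProd_le (ξ.eraseIdx j)
      rw [← h3, List.length_eraseIdx_of_lt hlt] at h4
      have h5 := cs.length_mul_le (y * (cs.wordProd (ω ++ [i]))⁻¹) (cs.wordProd (ω ++ [i]))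
      rw [inv_mul_cancel_right] at h5
      omega
    · rw [List.eraseIdx_append_of_length_le (not_lt.1 hlt), wordProd_append, wordProd_append,
        mul_assoc, mul_right_inj] at he
      have h4 := cs.length_wordProd_le (ω.eraseIdx (j - ξ.length))
      rw [wordProd_append, wordProd_singleton, he] at hlen
      have := List.length_eraseIdx_le ω (j - ξ.length)
      omega

theorem exists_isConjPerm_of_descents {y : W} {K : Set B} (hy : y ∈ parabolic cs K)
    (hd : ∀ i ∈ K, cs.length (y * cs.simple i) < cs.length y) : ∃ π, cs.IsConjPerm y K π := by
  refine exists_isConjPerm fun i hi => ?_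
  have hs := cs.simple_mem_parabolic hi
  have h1 := length_conj_eq hd (mul_mem hy hs)
  have h2 := cs.length_mul_simple y i
  have h3 := hd i hi
  refine cs.exists_eq_simple (mul_mem (mul_mem hy hs) (inv_mem hy)) ?_
  have h4 : y * (y * cs.simple i)⁻¹ = y * cs.simple i * y⁻¹ := by simp [mul_assoc]
  rw [h4] at h1
  omega

theorem exists_descents (cs : CoxeterSystem M W) [Fintype W] (I : Set B) : ∃ y ∈ parabolic cs I,
    ∀ i ∈ I, cs.length (y * cs.simple i) < cs.length y := by
  obtain ⟨y, hy, h⟩ := Set.exists_max_image (parabolic cs I : Set W) cs.length (Set.toFinite _)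
    ⟨1, one_mem _⟩
  refine ⟨y, hy, fun i hi => lt_of_le_of_ne (h _ (mul_mem hy (cs.simple_mem_parabolic hi)))
    (cs.length_mul_simple_ne y i)⟩

end CoxeterSystem

section BraidChain

variable {G : Type*} [Group G]

/-- The list consists of involutions satisfying the braid relations of a linear Coxeter graph,
the last entry generating together with `t` a quotient of the braid group of type `B₂`. -/
def BraidChain (t : G) : List G → Prop
  | [] => True
  | [a] => a * a = 1 ∧ a * t * a * t = t * a * t * a
  | a :: b :: l => a * a = 1 ∧ a * b * a = b * a * b ∧ (∀ c ∈ l, Commute a c) ∧ Commute a t ∧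
      BraidChain t (b :: l)

/-- The subgroup generated by `t` and the entries of the list. -/
def chainSubgroup (t : G) (l : List G) : Subgroup G := Subgroup.closure (insert t {x | x ∈ l})

/-- The conjugate of `t` by the product of the list. -/
def chainConj (t : G) (l : List G) : G := l.foldr (fun a x => a * x * a) t

variable {t : G}

theorem mem_chainSubgroup_self (t : G) (l : List G) : t ∈ chainSubgroup t l :=
  Subgroup.subset_closure (Set.mem_insert _ _)

theorem mem_chainSubgroup {l : List G} {a : G} (h : a ∈ l) : a ∈ chainSubgroup t l :=
  Subgroup.subset_closure (Set.mem_insert_of_mem _ h)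

theorem chainSubgroup_mono {l l' : List G} (h : l ⊆ l') :
    chainSubgroup t l ≤ chainSubgroup t l' :=
  Subgroup.closure_mono (Set.insert_subset_insert h)

theorem commute_chainSubgroup {x : G} {l : List G} (hl : ∀ c ∈ l, Commute x c) (ht : Commute x t)
    {y : G} (hy : y ∈ chainSubgroup t l) : Commute x y := by
  have : chainSubgroup t l ≤ Subgroup.centralizer {x} := by
    rw [chainSubgroup, Subgroup.closure_le]
    rintro z (rfl | hz) <;> rw [SetLike.mem_coe, Subgroup.mem_centralizer_singleton_iff]
    · exact ht.symm.eq
    · exact (hl z hz).symm.eq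
  exact (Subgroup.mem_centralizer_singleton_iff.1 (this hy)).symm

theorem chainConj_cons (a : G) (l : List G) :
    chainConj t (a :: l) = a * chainConj t l * a := rfl

theorem chainConj_mem (l : List G) : chainConj t l ∈ chainSubgroup t l := by
  induction l with
  | nil => exact mem_chainSubgroup_self t _
  | cons a l ih =>
    have h1 : a ∈ chainSubgroup t (a :: l) := mem_chainSubgroup List.mem_cons_self
    exact mul_mem (mul_mem h1 (chainSubgroup_mono (List.subset_cons_self a l) ih)) h1

theorem BraidChain.tail {a : G} {l : List G} (h : BraidChain t (a :: l)) : BraidChain t l := by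
  cases l with
  | nil => trivial
  | cons b l => exact h.2.2.2.2

theorem BraidChain.sq {a : G} {l : List G} (h : BraidChain t (a :: l)) : a * a = 1 := by
  cases l with
  | nil => exact h.1
  | cons b l => exact h.1

theorem BraidChain.commute_of_append {pre r : List G} {a : G} (h : BraidChain t (pre ++ a :: r))
    {x : G} (hx : x ∈ pre) {y : G} (hy : y ∈ chainSubgroup t r) : Commute x y := by
  induction pre with
  | nil => simp at hx
  | cons b pre ih =>
    rcases List.mem_cons.1 hx with rfl | hx
    · cases pre with
      | nil => exact commute_chainSubgroup h.2.2.1 h.2.2.2.1 hy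
      | cons c pre =>
        exact commute_chainSubgroup (fun z hz => h.2.2.1 z (by simp [hz])) h.2.2.2.1 hy
    · exact ih h.tail hx

theorem BraidChain.commute_chainConj {a : G} {l : List G} (h : BraidChain t (a :: l)) {x : G}
    (hx : x ∈ chainSubgroup t l) : Commute (chainConj t (a :: l)) x := by
  induction l generalizing a x with
  | nil =>
    refine commute_chainSubgroup (by simp) ?_ hx
    have := h.2
    simp only [chainConj, List.foldr, Commute, SemiconjBy]
    rw [this]; group
  | cons b r ih =>
    have hb := h.tail
    have ih' := fun {x} => ih hb (x := x)
    have ha : ∀ y ∈ chainSubgroup t r, Commute a y := fun y hy =>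
      commute_chainSubgroup h.2.2.1 h.2.2.2.1 hy
    refine commute_chainSubgroup ?_ ?_ hx
    · intro c hc
      rcases List.mem_cons.1 hc with rfl | hc
      · have h1 := ha _ (chainConj_mem r)
        have h2 := h.2.1
        rw [chainConj_cons, chainConj_cons, Commute, SemiconjBy]
        generalize chainConj t r = T at h1
        calc a * (c * T * c) * a * c = a * c * T * (c * a * c) := by group
          _ = a * c * (T * a) * c * a := by rw [← h2]; group
          _ = (a * c * a) * T * c * a := by rw [← h1.eq]; group
          _ = _ := by rw [h2]; group
      · have h1 := ha c (mem_chainSubgroup hc)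
        rw [chainConj_cons]
        exact (h1.mul_left (ih' (mem_chainSubgroup hc))).mul_left h1
    · have h1 := ha t (mem_chainSubgroup_self t _)
      rw [chainConj_cons]
      exact (h1.mul_left (ih' (mem_chainSubgroup_self t _))).mul_left h1

/-- Membership in the union of the double cosets of `1`, `a` and `chainConj t (a :: l)`. -/
def InChainCosets (t a : G) (l : List G) (w : G) : Prop :=
  w ∈ chainSubgroup t l ∨ (∃ p ∈ chainSubgroup t l, ∃ q ∈ chainSubgroup t l, w = p * a * q) ∨
    ∃ p ∈ chainSubgroup t l, w = p * chainConj t (a :: l)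

theorem InChainCosets.mul_left {a : G} {l : List G} {w x : G} (h : InChainCosets t a l w)
    (hx : x ∈ chainSubgroup t l) : InChainCosets t a l (x * w) := by
  rcases h with h | ⟨p, hp, q, hq, rfl⟩ | ⟨p, hp, rfl⟩
  · exact Or.inl (mul_mem hx h)
  · exact Or.inr (Or.inl ⟨x * p, mul_mem hx hp, q, hq, by group⟩)
  · exact Or.inr (Or.inr ⟨x * p, mul_mem hx hp, by group⟩)

theorem BraidChain.inChainCosets_mul_right {a : G} {l : List G} (h : BraidChain t (a :: l))
    {w x : G} (hw : InChainCosets t a l w) (hx : x ∈ chainSubgroup t l) :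
    InChainCosets t a l (w * x) := by
  rcases hw with hw | ⟨p, hp, q, hq, rfl⟩ | ⟨p, hp, rfl⟩
  · exact Or.inl (mul_mem hw hx)
  · exact Or.inr (Or.inl ⟨p, hp, q * x, mul_mem hq hx, by group⟩)
  · refine Or.inr (Or.inr ⟨p * x, mul_mem hp hx, ?_⟩)
    rw [mul_assoc, (h.commute_chainConj hx).eq]; group

theorem BraidChain.inChainCosets_of_conj {a : G} {l : List G} (h : BraidChain t (a :: l))
    (hc : ∀ q ∈ chainSubgroup t l, InChainCosets t a l (a * q * a)) {w : G}
    (hw : w ∈ chainSubgroup t (a :: l)) : InChainCosets t a l w := by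
  have ha : ∀ w, InChainCosets t a l w → InChainCosets t a l (w * a) := by
    rintro w (hw | ⟨p, hp, q, hq, rfl⟩ | ⟨p, hp, rfl⟩)
    · exact Or.inr (Or.inl ⟨w, hw, 1, one_mem _, by group⟩)
    · have := (hc q hq).mul_left hp
      rwa [show p * a * q * a = p * (a * q * a) by group]
    · refine Or.inr (Or.inl ⟨p, hp, chainConj t l, chainConj_mem l, ?_⟩)
      rw [chainConj_cons, mul_assoc, mul_assoc _ a a, h.sq]; group
  have hinv : a⁻¹ = a := inv_eq_of_mul_eq_one_left h.sq
  have hl : ∀ x ∈ insert t {x | x ∈ l}, x ∈ chainSubgroup t l := fun x hx =>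
    Subgroup.subset_closure hx
  induction hw using Subgroup.closure_induction_right with
  | one => exact Or.inl (one_mem _)
  | mul_right x hx y hy ih =>
    rcases hy with rfl | hy
    · exact h.inChainCosets_mul_right ih (hl _ (Set.mem_insert _ _))
    · rcases List.mem_cons.1 hy with rfl | hy
      · exact ha _ ih
      · exact h.inChainCosets_mul_right ih (hl _ (Set.mem_insert_of_mem _ hy))
  | mul_inv_cancel x hx y hy ih =>
    rcases hy with rfl | hy
    · exact h.inChainCosets_mul_right ih (inv_mem (hl _ (Set.mem_insert _ _)))
    · rcases List.mem_cons.1 hy with rfl | hy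
      · rw [hinv]; exact ha _ ih
      · exact h.inChainCosets_mul_right ih (inv_mem (hl _ (Set.mem_insert_of_mem _ hy)))

theorem BraidChain.inChainCosets {a : G} {l : List G} (h : BraidChain t (a :: l))
    (ht : ∀ x ∈ a :: l, Commute x (t * t)) {w : G} (hw : w ∈ chainSubgroup t (a :: l)) :
    InChainCosets t a l w := by
  induction l generalizing a w with
  | nil =>
    refine h.inChainCosets_of_conj (fun q hq => ?_) hw
    have ha : Commute a (t * t) := ht a (by simp)
    have haa := h.sq
    have htm : ∀ k : ℤ, t ^ k ∈ chainSubgroup t [] := fun k =>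
      zpow_mem (mem_chainSubgroup_self t _) k
    obtain ⟨k, rfl⟩ : ∃ k : ℤ, t ^ k = q := by
      simpa [chainSubgroup, Subgroup.mem_closure_singleton] using hq
    obtain ⟨m, rfl | rfl⟩ := Int.even_or_odd' k
    · left
      have h1 : a * t ^ (2 * m) = t ^ (2 * m) * a := by
        rw [zpow_mul, zpow_two]; exact (ha.zpow_right m).eq
      rw [h1, mul_assoc, haa, mul_one]
      exact htm _
    · refine Or.inr (Or.inr ⟨t ^ (2 * m), htm _, ?_⟩)
      have h1 : a * t ^ (2 * m) = t ^ (2 * m) * a := by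
        rw [zpow_mul, zpow_two]; exact (ha.zpow_right m).eq
      rw [zpow_add, zpow_one, ← mul_assoc, h1]
      simp only [chainConj, List.foldr]
      group
  | cons b r ih =>
    refine h.inChainCosets_of_conj (fun q hq => ?_) hw
    have ha : ∀ y ∈ chainSubgroup t r, a * y = y * a := fun y hy =>
      (commute_chainSubgroup h.2.2.1 h.2.2.2.1 hy).eq
    have hs := chainSubgroup_mono (t := t) (List.subset_cons_self b r)
    have hb : b ∈ chainSubgroup t (b :: r) := mem_chainSubgroup List.mem_cons_self
    rcases ih h.tail (fun x hx => ht x (List.mem_cons_of_mem _ hx)) hq with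
      hq | ⟨p, hp, r', hr, rfl⟩ | ⟨p, hp, rfl⟩
    · left
      rw [ha q hq, mul_assoc, h.sq, mul_one]
      exact hs hq
    · refine Or.inr (Or.inl ⟨p * b, mul_mem (hs hp) hb, b * r', mul_mem hb (hs hr), ?_⟩)
      calc a * (p * b * r') * a = (a * p) * b * (r' * a) := by group
        _ = p * (a * b * a) * r' := by rw [ha p hp, ← ha r' hr]; group
        _ = _ := by rw [h.2.1]; group
    · refine Or.inr (Or.inr ⟨p, hs hp, ?_⟩)
      rw [chainConj_cons (a := a)]
      calc a * (p * chainConj t (b :: r)) * a = (a * p) * chainConj t (b :: r) * a := by group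
        _ = _ := by rw [ha p hp]; group

/-- Up to conjugacy in `chainSubgroup t l`, every element is the product of the whole list up to a
power of `t`, or lies in the subgroup obtained by omitting an entry, or commutes with some
element conjugate to `t` modulo the list. -/
theorem BraidChain.exists_conj {A : Type*} [CommGroup A] (deg : G →* A) {pre rest : List G}
    (h : BraidChain t (pre ++ rest)) (ht : ∀ x ∈ pre ++ rest, Commute x (t * t))
    (hdeg : ∀ x ∈ pre ++ rest, deg x = 1) {w : G} (hw : w ∈ chainSubgroup t rest) :
    ∃ u ∈ chainSubgroup t (pre ++ rest), ∃ g, u * (pre.prod * w) * u⁻¹ = g ∧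
      ((∃ k : ℤ, g = (pre ++ rest).prod * t ^ k) ∨
       (∃ l₁ a l₂, pre ++ rest = l₁ ++ a :: l₂ ∧ g ∈ chainSubgroup t (l₁ ++ l₂)) ∨
       (t ≠ 1 ∧ ∃ z ∈ chainSubgroup t (pre ++ rest), Commute z g ∧ deg z = deg t)) := by
  induction rest generalizing pre w with
  | nil =>
    obtain ⟨k, rfl⟩ : ∃ k : ℤ, t ^ k = w := by
      simpa [chainSubgroup, Subgroup.mem_closure_singleton] using hw
    exact ⟨1, one_mem _, _, rfl, Or.inl ⟨k, by simp⟩⟩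
  | cons a r ih =>
    have hpre : ∀ y ∈ chainSubgroup t r, Commute pre.prod y := fun y hy =>
      Commute.list_prod_left _ _ fun x hx => h.commute_of_append hx hy
    have hlist : pre ++ a :: r = (pre ++ [a]) ++ r := by simp
    have hr : chainSubgroup t r ≤ chainSubgroup t (pre ++ a :: r) :=
      chainSubgroup_mono fun x hx => by simp [hx]
    have hprod : pre.prod ∈ chainSubgroup t pre := list_prod_mem fun x hx => mem_chainSubgroup hx
    have hch : BraidChain t (a :: r) := by
      clear ht hdeg hw ih hpre hlist hr hprod
      induction pre with
      | nil => exact h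
      | cons b pre ih => exact ih h.tail
    rcases hch.inChainCosets (fun x hx => ht x (List.mem_append_right _ hx)) hw with
      hw | ⟨p, hp, q, hq, rfl⟩ | ⟨p, hp, rfl⟩
    · refine ⟨1, one_mem _, _, rfl, Or.inr (Or.inl ⟨pre, a, r, rfl, ?_⟩)⟩
      rw [inv_one, mul_one, one_mul]
      exact mul_mem (chainSubgroup_mono (fun x hx => by simp [hx]) hprod)
        (chainSubgroup_mono (fun x hx => by simp [hx]) hw)
    · rw [hlist] at h ht hdeg ⊢
      obtain ⟨u, hu, g, hg, hg'⟩ := ih h ht hdeg (mul_mem hq hp)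
      refine ⟨u * p⁻¹, mul_mem hu (inv_mem (hlist ▸ hr hp)), g, ?_, hg'⟩
      rw [← hg, List.prod_append, List.prod_singleton]
      have := (hpre p hp).eq
      calc u * p⁻¹ * (pre.prod * (p * a * q)) * (u * p⁻¹)⁻¹
          = u * (p⁻¹ * (pre.prod * p) * a * (q * p)) * u⁻¹ := by group
        _ = _ := by rw [this]; group
    · by_cases ht1 : t = 1
      · refine ⟨1, one_mem _, _, rfl, Or.inr (Or.inl ⟨pre, a, r, rfl, ?_⟩)⟩
        have : chainConj t (a :: r) = 1 := by
          have h2 : ∀ l : List G, BraidChain t l → chainConj t l = 1 := by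
            intro l hl
            induction l with
            | nil => exact ht1
            | cons b l ih => rw [chainConj_cons, ih hl.tail, mul_one, hl.sq]
          exact h2 _ hch
        rw [inv_one, mul_one, one_mul, this, mul_one]
        exact mul_mem (chainSubgroup_mono (fun x hx => by simp [hx]) hprod)
          (chainSubgroup_mono (fun x hx => by simp [hx]) hp)
      · refine ⟨1, one_mem _, _, rfl, Or.inr (Or.inr ⟨ht1, pre.prod * chainConj t (a :: r),
          mul_mem (chainSubgroup_mono (fun x hx => by simp [hx]) hprod)
          (chainSubgroup_mono (List.subset_append_right _ _) (chainConj_mem _)), ?_, ?_⟩)⟩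
        · have h1 := hpre p hp
          have h2 := hch.commute_chainConj hp
          rw [inv_one, mul_one, one_mul]
          have h3 : pre.prod * (p * chainConj t (a :: r)) =
              p * (pre.prod * chainConj t (a :: r)) := by
            rw [← mul_assoc, h1.eq, mul_assoc]
          rw [h3]
          exact (h1.mul_left h2).mul_right (Commute.refl _)
        · have h2 : ∀ l : List G, BraidChain t l → (∀ x ∈ l, deg x = 1) →
              deg (chainConj t l) = deg t := by
            intro l hl hd
            induction l with
            | nil => rfl
            | cons b l ih =>
              rw [chainConj_cons, map_mul, map_mul, hd b List.mem_cons_self,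
                ih hl.tail fun x hx => hd x (List.mem_cons_of_mem _ hx)]
              simp
          rw [map_mul, h2 _ hch fun x hx => hdeg x (List.mem_append_right _ hx), map_list_prod,
            List.prod_eq_one, one_mul]
          intro x hx
          obtain ⟨y, hy, rfl⟩ := List.mem_map.1 hx
          exact hdeg y (List.mem_append_left _ hy)

theorem BraidChain.snoc {l : List G} {b a : G} (h : BraidChain 1 (l ++ [b])) (ha : a * a = 1)
    (hab : a * b * a = b * a * b) (hc : ∀ c ∈ l, Commute c a) : BraidChain 1 (l ++ [b, a]) := by
  induction l with
  | nil => exact ⟨h.sq, hab.symm, by simp, Commute.one_right _, ha, by simp⟩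
  | cons d l ih =>
    have ih := ih h.tail fun c hc' => hc c (List.mem_cons_of_mem _ hc')
    cases l with
    | nil =>
      refine ⟨h.sq, h.2.1, ?_, Commute.one_right _, ih⟩
      intro c hc'
      obtain rfl : c = a := List.mem_singleton.1 hc'
      exact hc d List.mem_cons_self
    | cons e l =>
      refine ⟨h.sq, h.2.1, ?_, Commute.one_right _, ih⟩
      intro c hc'
      have hc'' : c ∈ l ++ [b] ∨ c = a := by
        have : c ∈ l ++ [b, a] := hc'
        simpa [or_assoc] using this
      rcases hc'' with hc' | rfl
      · exact h.2.2.1 c hc'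
      · exact hc d List.mem_cons_self

theorem BraidChain.reverse {l : List G} (h : BraidChain 1 l) : BraidChain 1 l.reverse := by
  induction l with
  | nil => exact h
  | cons a l ih =>
    cases l with
    | nil => exact h
    | cons b l =>
      have ih := ih h.tail
      rw [List.reverse_cons] at ih
      rw [List.reverse_cons, List.reverse_cons, List.append_assoc]
      exact ih.snoc h.sq h.2.1 fun c hc => (h.2.2.1 c (List.mem_reverse.1 hc)).symm

theorem BraidChain.of_one {l : List G} {b : G} (h : BraidChain 1 (l ++ [b]))
    (hb : b * t * b * t = t * b * t * b) (hl : ∀ c ∈ l, Commute c t) : BraidChain t (l ++ [b]) := by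
  induction l with
  | nil => exact ⟨h.sq, hb⟩
  | cons d l ih =>
    have ih := ih h.tail fun c hc => hl c (List.mem_cons_of_mem _ hc)
    have hd := hl d List.mem_cons_self
    cases l with
    | nil => exact ⟨h.sq, h.2.1, h.2.2.1, hd, ih⟩
    | cons e l => exact ⟨h.sq, h.2.1, h.2.2.1, hd, ih⟩

end BraidChain

namespace CoxeterMatrix

/-- The set `C` spans a connected part of the Coxeter graph. -/
def ConnectedOn (M : CoxeterMatrix B) (C : Set B) : Prop :=
  ∀ x ∈ C, ∀ v ∈ C, (M.graph C).Reachable x v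

end CoxeterMatrix

namespace CoxeterSystem

variable (cs : CoxeterSystem M W)

theorem exists_braidChain {n : ℕ} {C : Set B} (hn : C.ncard = n) (hfin : C.Finite) {x : B}
    (hx : x ∈ C) (hreach : ∀ v ∈ C, (M.graph C).Reachable x v)
    (hend : ∀ a ∈ C, ∀ b ∈ C, M.Joined x a → M.Joined x b → a = b)
    (hdef : ∀ v ∈ C, ¬ M.Defect C v) :
    ∃ l : List B, (x :: l).Nodup ∧ (∀ i, i ∈ x :: l ↔ i ∈ C) ∧
      BraidChain 1 ((x :: l).map cs.simple) := by
  induction n generalizing C x with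
  | zero => rw [Set.ncard_eq_zero hfin] at hn; simp [hn] at hx
  | succ n ih =>
    by_cases hb : ∃ b ∈ C, M.Joined x b
    · obtain ⟨b, hb, hxb⟩ := hb
      have hC' : C \ {x} ⊆ C := Set.sdiff_subset
      have hbC : b ∈ C \ {x} := ⟨hb, hxb.ne.symm⟩
      have hcard : (C \ {x}).ncard = n := by rw [Set.ncard_sdiff_singleton_of_mem hx, hn]; rfl
      have hl := ih hcard (hfin.subset hC') hbC ?_ ?_ ?_
      · obtain ⟨l, h1, h2, h3⟩ := hl
        refine ⟨b :: l, List.nodup_cons.2 ⟨fun h => ((h2 x).1 h).2 rfl, h1⟩, fun i => ?_, ?_⟩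
        · rw [List.mem_cons, h2]
          constructor
          · rintro (rfl | h)
            exacts [hx, h.1]
          · intro h
            by_cases hi : i = x
            exacts [Or.inl hi, Or.inr ⟨h, hi⟩]
        · refine ⟨cs.simple_mul_simple_self x, cs.braid_simple ?_, ?_, Commute.one_right _, h3⟩
          · by_contra h4
            exact hdef x hx (Or.inl ⟨b, hb, hxb, h4⟩)
          · intro c hc
            obtain ⟨i, hi, rfl⟩ := List.mem_map.1 hc
            refine cs.commute_simple_of_not_joined fun hj => ?_
            have hiC := hC' ((h2 i).1 (List.mem_cons_of_mem _ hi))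
            rw [hend i hiC b hb hj hxb] at hi
            exact (List.nodup_cons.1 h1).1 hi
      · rintro v ⟨hv, hvx⟩
        have key : ∀ v, (M.graph C).Walk v x → v = x ∨ (M.graph (C \ {x})).Reachable b v := by
          intro v p
          clear hvx hv ih
          induction p with
          | nil => exact Or.inl rfl
          | @cons u w y hadj p ih =>
            by_cases hu : u = y
            · exact Or.inl hu
            right
            rcases ih hx hreach hend hxb hC' hbC hcard with rfl | h
            · rw [hend u hadj.1 b hb hadj.2.2.symm hxb]
            · by_cases hw : w = y
              · subst hw
                rw [hend u hadj.1 b hb hadj.2.2.symm hxb]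
              · exact h.trans (SimpleGraph.Adj.reachable
                  ⟨⟨hadj.2.1, hw⟩, ⟨hadj.1, hu⟩, hadj.2.2.symm⟩)
        obtain ⟨p⟩ := hreach v hv
        exact (key v p.reverse).resolve_left hvx
      · rintro a ⟨ha, hax⟩ c ⟨hc, hcx⟩ hja hjc
        by_contra hac
        exact hdef b hb (Or.inr ⟨a, ha, c, hc, x, hx, hac, hax, hcx, hja, hjc, hxb.symm⟩)
      · exact fun v hv hd => hdef v hv.1 (hd.mono hC')
    · refine ⟨[], by simp, fun i => ?_, cs.simple_mul_simple_self x, by simp⟩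
      rw [List.mem_singleton]
      refine ⟨fun h => h ▸ hx, fun h => ?_⟩
      by_contra hi
      obtain ⟨p⟩ := hreach i h
      cases p with
      | nil => exact hi rfl
      | cons hadj _ => exact hb ⟨_, hadj.2.1, hadj.2.2⟩

/-- The element `v` of `W_I` has no `W_I`-conjugate in a proper parabolic subgroup of `W_I`. -/
def IsCuspidal (I : Set B) (v : W) : Prop :=
  v ∈ parabolic cs I ∧ ∀ K ⊂ I, ∀ u ∈ parabolic cs I, u * v * u⁻¹ ∉ parabolic cs K

theorem chainSubgroup_one_map (l : List B) :
    chainSubgroup 1 (l.map cs.simple) = parabolic cs {i | i ∈ l} := by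
  rw [chainSubgroup, Subgroup.closure_insert_one, parabolic]
  congr 1
  ext w
  simp

variable {cs}

theorem IsCuspidal.exists_conj_of_connectedOn [Fintype B] (hM : M.IsPos) {C : Set B}
    (hC : M.ConnectedOn C) (hdef : ∀ v ∈ C, ¬ M.Defect C v) {v w : W} (hv : cs.IsCuspidal C v)
    (hw : cs.IsCuspidal C w) : ∃ u ∈ parabolic cs C, u * v * u⁻¹ = w := by
  rcases C.eq_empty_or_nonempty with rfl | hne
  · have h1 := hv.1
    have h2 := hw.1
    rw [parabolic_empty, Subgroup.mem_bot] at h1 h2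
    exact ⟨1, one_mem _, by simp [h1, h2]⟩
  obtain ⟨x, hx, hend⟩ := hM.exists_endpoint hne
  obtain ⟨l, h1, h2, h3⟩ := cs.exists_braidChain rfl (Set.toFinite C) hx (hC x hx) hend hdef
  have hl : {i | i ∈ x :: l} = C := Set.ext h2
  clear h2
  generalize x :: l = l at h1 h3 hl
  have key : ∀ v, cs.IsCuspidal C v →
      ∃ u ∈ parabolic cs C, u * v * u⁻¹ = (l.map cs.simple).prod := by
    intro v hv
    obtain ⟨u, hu, g, hg, hg'⟩ := h3.exists_conj (pre := []) (deg := (1 : W →* Multiplicative ℤ))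
      (fun x _ => by simp) (fun x _ => by simp) (w := v)
      (by rw [chainSubgroup_one_map, hl]; exact hv.1)
    rw [List.nil_append, chainSubgroup_one_map, hl] at hu
    rw [List.prod_nil, one_mul] at hg
    refine ⟨u, hu, ?_⟩
    rcases hg' with ⟨k, hk⟩ | ⟨l₁, a, l₂, hl', hm⟩ | ⟨h, _⟩
    · rw [hg, hk]; simp
    · exfalso
      rw [List.nil_append, List.map_eq_append_iff] at hl'
      obtain ⟨m₁, m₂, hm', rfl, hm₂⟩ := hl'
      obtain ⟨i, m₃, rfl, rfl, rfl⟩ := List.map_eq_cons_iff.1 hm₂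
      rw [← List.map_append, chainSubgroup_one_map, ← hg] at hm
      refine hv.2 _ ?_ u hu hm
      have hi : i ∉ m₁ ++ m₃ := by
        rw [hm'] at h1
        exact (List.nodup_middle.1 h1).notMem
      rw [← hl, hm']
      refine ⟨fun j hj => ?_, fun h => hi (h (show i ∈ m₁ ++ i :: m₃ by simp))⟩
      have : j ∈ m₁ ++ m₃ := hj
      simp only [List.mem_append] at this
      change j ∈ m₁ ++ i :: m₃
      simp only [List.mem_append, List.mem_cons]
      tauto
    · exact absurd rfl h
  obtain ⟨a, ha, ha'⟩ := key v hv
  obtain ⟨b, hb, hb'⟩ := key w hw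
  refine ⟨b⁻¹ * a, mul_mem (inv_mem hb) ha, ?_⟩
  rw [← ha'] at hb'
  have : w = b⁻¹ * (b * w * b⁻¹) * b := by group
  rw [this, hb']; group

end CoxeterSystem

namespace CoxeterMatrix

/-- The connected component of `x` in the part of the Coxeter graph spanned by `I`. -/
def component (M : CoxeterMatrix B) (I : Set B) (x : B) : Set B :=
  {v | v ∈ I ∧ (M.graph I).Reachable x v}

variable {I : Set B} {x : B}

theorem component_subset : M.component I x ⊆ I := fun _ h => h.1

theorem mem_component_self (hx : x ∈ I) : x ∈ M.component I x :=
  ⟨hx, SimpleGraph.Reachable.refl _⟩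

theorem mem_component_of_joined {a b : B} (ha : a ∈ M.component I x) (hb : b ∈ I)
    (h : M.Joined a b) : b ∈ M.component I x :=
  ⟨hb, ha.2.trans (SimpleGraph.Adj.reachable ⟨ha.1, hb, h⟩)⟩

theorem connectedOn_component : M.ConnectedOn (M.component I x) := by
  have key : ∀ u v, (M.graph I).Walk u v → u ∈ M.component I x →
      (M.graph (M.component I x)).Reachable u v := by
    intro u v p
    induction p with
    | nil => exact fun _ => SimpleGraph.Reachable.refl _
    | cons hadj p ih =>
      intro hu
      have h1 := mem_component_of_joined hu hadj.2.1 hadj.2.2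
      exact SimpleGraph.Reachable.trans (SimpleGraph.Adj.reachable ⟨hu, h1, hadj.2.2⟩) (ih h1)
  intro u hu v hv
  obtain ⟨p⟩ := hu.2.symm.trans hv.2
  exact key u v p hu

theorem not_joined_component {a d : B} (ha : a ∈ M.component I x)
    (hd : d ∈ I \ M.component I x) : ¬ M.Joined a d :=
  fun h => hd.2 (mem_component_of_joined ha hd.1 h)

theorem Defect.component {v : B} (h : M.Defect I v) (hv : v ∈ M.component I x) :
    M.Defect (M.component I x) v := by
  rcases h with ⟨a, ha, h1⟩ | ⟨a, ha, b, hb, c, hc, hab, hac, hbc, ja, jb, jc⟩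
  · exact Or.inl ⟨a, mem_component_of_joined hv ha h1.1, h1⟩
  · exact Or.inr ⟨a, mem_component_of_joined hv ha ja, b, mem_component_of_joined hv hb jb, c,
      mem_component_of_joined hv hc jc, hab, hac, hbc, ja, jb, jc⟩

end CoxeterMatrix

namespace CoxeterSystem

variable {cs : CoxeterSystem M W}

theorem exists_mul_of_mem_parabolic_union {A D : Set B}
    (hsep : ∀ a ∈ A, ∀ d ∈ D, ¬ M.Joined a d) {v : W} (hv : v ∈ parabolic cs (A ∪ D)) :
    ∃ a ∈ parabolic cs A, ∃ d ∈ parabolic cs D, v = a * d := by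
  induction hv using Subgroup.closure_induction with
  | mem y hy =>
    obtain ⟨k, hk | hk, rfl⟩ := hy
    · exact ⟨_, cs.simple_mem_parabolic hk, 1, one_mem _, by simp⟩
    · exact ⟨1, one_mem _, _, cs.simple_mem_parabolic hk, by simp⟩
  | one => exact ⟨1, one_mem _, 1, one_mem _, by simp⟩
  | mul x y _ _ ihx ihy =>
    obtain ⟨a, ha, d, hd, rfl⟩ := ihx
    obtain ⟨a', ha', d', hd', rfl⟩ := ihy
    have := (cs.commute_of_mem_parabolic hsep ha' hd).eq
    refine ⟨a * a', mul_mem ha ha', d * d', mul_mem hd hd', ?_⟩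
    rw [mul_assoc, ← mul_assoc d, ← this]; group
  | inv x _ ih =>
    obtain ⟨a, ha, d, hd, rfl⟩ := ih
    have := (cs.commute_of_mem_parabolic hsep ha hd).eq
    exact ⟨a⁻¹, inv_mem ha, d⁻¹, inv_mem hd, by rw [this, mul_inv_rev]⟩

theorem IsCuspidal.left {A D : Set B} (hsep : ∀ a ∈ A, ∀ d ∈ D, ¬ M.Joined a d)
    (hdisj : Disjoint A D) {a d : W} (ha : a ∈ parabolic cs A) (hd : d ∈ parabolic cs D)
    (h : cs.IsCuspidal (A ∪ D) (a * d)) : cs.IsCuspidal A a := by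
  refine ⟨ha, fun K hK u hu hmem => ?_⟩
  have hlt : K ∪ D ⊂ A ∪ D := by
    refine ⟨Set.union_subset_union_left _ hK.1, fun hle => hK.2 fun x hx => ?_⟩
    exact (hle (Or.inl hx)).resolve_right (Set.disjoint_left.1 hdisj hx)
  refine h.2 _ hlt u (parabolic_mono _ Set.subset_union_left hu) ?_
  have := (cs.commute_of_mem_parabolic hsep hu hd).eq
  have h1 : u * (a * d) * u⁻¹ = u * a * u⁻¹ * d := by
    have h2 : d * u⁻¹ = u⁻¹ * d := by
      rw [← (cs.commute_of_mem_parabolic hsep (inv_mem hu) hd).eq]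
    rw [mul_assoc, mul_assoc, h2]; group
  rw [h1]
  exact mul_mem (parabolic_mono _ Set.subset_union_left hmem)
    (parabolic_mono _ Set.subset_union_right hd)

theorem IsCuspidal.split {A D : Set B} (hsep : ∀ a ∈ A, ∀ d ∈ D, ¬ M.Joined a d)
    (hdisj : Disjoint A D) {v : W} (h : cs.IsCuspidal (A ∪ D) v) :
    ∃ a d, cs.IsCuspidal A a ∧ cs.IsCuspidal D d ∧ v = a * d := by
  obtain ⟨a, ha, d, hd, rfl⟩ := exists_mul_of_mem_parabolic_union hsep h.1
  refine ⟨a, d, h.left hsep hdisj ha hd, ?_, rfl⟩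
  rw [(cs.commute_of_mem_parabolic hsep ha hd).eq, Set.union_comm] at h
  exact h.left (fun d hd a ha hj => hsep a ha d hd hj.symm) hdisj.symm hd ha

theorem conj_mul_of_commute {A D : Set B} (hsep : ∀ a ∈ A, ∀ d ∈ D, ¬ M.Joined a d) {a d u w : W}
    (ha : a ∈ parabolic cs A) (hd : d ∈ parabolic cs D) (hu : u ∈ parabolic cs A)
    (hw : w ∈ parabolic cs D) :
    u * w * (a * d) * (u * w)⁻¹ = (u * a * u⁻¹) * (w * d * w⁻¹) := by
  have h1 := (cs.commute_of_mem_parabolic hsep ha hw).eq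
  have h2 := (cs.commute_of_mem_parabolic hsep (inv_mem hu) (mul_mem (mul_mem hw hd)
    (inv_mem hw))).eq
  calc u * w * (a * d) * (u * w)⁻¹ = u * (w * a) * d * w⁻¹ * u⁻¹ := by group
    _ = u * a * ((w * d * w⁻¹) * u⁻¹) := by rw [← h1]; group
    _ = _ := by rw [← h2]; group

theorem IsConjPerm.isCuspidal [Finite B] {n : W} {I : Set B} {π : B → B}
    (h : cs.IsConjPerm n I π) {v : W} (hv : cs.IsCuspidal I v) :
    cs.IsCuspidal I (n * v * n⁻¹) := by
  obtain ⟨ρ, hρ⟩ := h.exists_inv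
  have hm : Set.MapsTo ρ I I := fun i hi => (hρ i hi).1
  refine ⟨h.conj_mem subset_rfl (fun i hi => (h i hi).1) hv.1, fun K hK u hu hmem => ?_⟩
  refine hv.2 (ρ '' K) ⟨?_, fun hle => hK.2 ?_⟩ (n⁻¹ * u * n) ?_ ?_
  · exact (Set.image_mono hK.1).trans hm.image_subset
  · intro i hi
    obtain ⟨k, hk, hk'⟩ := hle (hm hi)
    rwa [← hρ.injOn (hK.1 hk) hi hk']
  · simpa using hρ.conj_mem subset_rfl hm hu
  · have := hρ.conj_mem hK.1 (Set.mapsTo_image ρ K) hmem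
    simpa [mul_assoc] using this

theorem IsCuspidal.exists_conj_of_no_defect [Fintype B] (hM : M.IsPos) {I : Set B}
    (hdef : ∀ v ∈ I, ¬ M.Defect I v) {v w : W} (hv : cs.IsCuspidal I v)
    (hw : cs.IsCuspidal I w) : ∃ u ∈ parabolic cs I, u * v * u⁻¹ = w := by
  induction hn : I.ncard using Nat.strong_induction_on generalizing I v w with
  | _ n ih =>
    rcases I.eq_empty_or_nonempty with rfl | ⟨x, hx⟩
    · have h1 := hv.1
      have h2 := hw.1
      rw [parabolic_empty, Subgroup.mem_bot] at h1 h2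
      exact ⟨1, one_mem _, by simp [h1, h2]⟩
    set C := M.component I x with hC
    have hsep : ∀ a ∈ C, ∀ d ∈ I \ C, ¬ M.Joined a d :=
      fun a ha d hd => CoxeterMatrix.not_joined_component ha hd
    have hCI : C ⊆ I := CoxeterMatrix.component_subset
    have hU : C ∪ I \ C = I := Set.union_sdiff_cancel hCI
    have hxC : x ∈ C := CoxeterMatrix.mem_component_self hx
    rw [← hU] at hv hw
    obtain ⟨a, d, ha, hd, rfl⟩ := hv.split hsep disjoint_sdiff_self_right
    obtain ⟨a', d', ha', hd', rfl⟩ := hw.split hsep disjoint_sdiff_self_right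
    obtain ⟨u, hu, rfl⟩ := ha.exists_conj_of_connectedOn hM CoxeterMatrix.connectedOn_component
      (fun v hv hd => hdef v (hCI hv) (hd.mono hCI)) ha'
    obtain ⟨z, hz, rfl⟩ := ih _ (by
      rw [← hn]; exact Set.ncard_lt_ncard ⟨Set.sdiff_subset, fun h => (h hx).2 hxC⟩ (Set.toFinite I))
      (fun v hv hd => hdef v hv.1 (hd.mono Set.sdiff_subset)) hd hd' rfl
    refine ⟨u * z, mul_mem (parabolic_mono _ hCI hu) (parabolic_mono _ Set.sdiff_subset hz), ?_⟩
    exact conj_mul_of_commute hsep ha.1 hd.1 hu hz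

variable (cs)

/-- Conjugation by `n` fixes every cuspidal class of `W_I`. -/
def NoFusion (n : W) (I : Set B) : Prop :=
  ∀ v, cs.IsCuspidal I v → ∃ u ∈ parabolic cs I, u * v * u⁻¹ = n * v * n⁻¹

variable {cs}

theorem NoFusion.union {n : W} {A D : Set B} (hsep : ∀ a ∈ A, ∀ d ∈ D, ¬ M.Joined a d)
    (hdisj : Disjoint A D) (hA : cs.NoFusion n A) (hD : cs.NoFusion n D) :
    cs.NoFusion n (A ∪ D) := by
  intro v hv
  obtain ⟨a, d, ha, hd, rfl⟩ := hv.split hsep hdisj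
  obtain ⟨u, hu, hu'⟩ := hA a ha
  obtain ⟨w, hw, hw'⟩ := hD d hd
  refine ⟨u * w, mul_mem (parabolic_mono _ Set.subset_union_left hu)
    (parabolic_mono _ Set.subset_union_right hw), ?_⟩
  rw [conj_mul_of_commute hsep ha.1 hd.1 hu hw, hu', hw']; group

theorem NoFusion.mul [Finite B] {n m : W} {I : Set B} {π : B → B} (hn : cs.NoFusion n I)
    (hm : cs.NoFusion m I) (h : cs.IsConjPerm m I π) : cs.NoFusion (n * m) I := by
  intro v hv
  obtain ⟨u, hu, hu'⟩ := hm v hv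
  obtain ⟨w, hw, hw'⟩ := hn _ (h.isCuspidal hv)
  refine ⟨w * u, mul_mem hw hu, ?_⟩
  have h1 : w * u * v * (w * u)⁻¹ = w * (u * v * u⁻¹) * w⁻¹ := by group
  rw [h1, hu', hw']; group

theorem noFusion_of_mem {n : W} {I : Set B} (h : n ∈ parabolic cs I) : cs.NoFusion n I :=
  fun _ _ => ⟨n, h, rfl⟩

end CoxeterSystem

namespace CoxeterMatrix

/-- `v` and all its neighbours in `K` are fixed by `π`. -/
def FixesStar (M : CoxeterMatrix B) (K : Set B) (π : B → B) (v : B) : Prop :=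
  π v = v ∧ ∀ a ∈ K, M.Joined v a → π a = a

theorem reachable_univ {K : Set B} {u v : B} (h : (M.graph K).Reachable u v) :
    (M.graph Set.univ).Reachable u v :=
  h.mono (show M.graph K ≤ M.graph Set.univ from fun _ _ h => graph_univ_adj.2 h.2.2)

theorem IsPos.eq_of_joined_of_ne [Fintype B] (hM : M.IsPos) {c v : B}
    (hc : M.Defect Set.univ c) (hr : (M.graph Set.univ).Reachable c v) (hv : v ≠ c) {a b d : B}
    (ha : M.Joined v a) (hb : M.Joined v b) (hd : M.Joined v d) (hab : a ≠ b) (had : a ≠ d) :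
    b = d := by
  by_contra hbd
  have hdv : M.Defect Set.univ v :=
    Or.inr ⟨a, trivial, b, trivial, d, trivial, hab, had, hbd, ha, hb, hd⟩
  rcases hM.defect_unique hr hc hdv with h | h
  · exact hv h.symm
  by_cases hac : a = c
  · subst hac
    exact hbd (hM.eq_of_heavy h.symm hb hab.symm hd had.symm)
  · by_cases hbc : b = c
    · subst hbc
      exact had (hM.eq_of_heavy h.symm ha hac hd (Ne.symm hbd))
    · exact hab (hM.eq_of_heavy h.symm ha hac hb hbc)

theorem FixesStar.eq_of_reachable [Fintype B] (hM : M.IsPos) {K : Set B} {π : B → B} {c : B}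
    (h : M.FixesStar K π c) (hc : M.Defect Set.univ c) (hinj : Set.InjOn π K)
    (hπ : ∀ a ∈ K, ∀ b ∈ K, M.Joined a b → M.Joined (π a) (π b)) {v : B}
    (hr : (M.graph K).Reachable c v) : π v = v := by
  have key : ∀ u v, (M.graph K).Walk u v → (M.graph K).Reachable c u → M.FixesStar K π u →
      π v = v := by
    intro u v p
    induction p with
    | nil => exact fun _ h => h.1
    | @cons u w v hadj p ih =>
      intro hcu hu
      have hcw := hcu.trans hadj.reachable
      refine ih hcw ?_
      by_cases hwc : w = c
      · rwa [hwc]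
      have hw := hu.2 w hadj.2.1 hadj.2.2
      refine ⟨hw, fun a ha hwa => ?_⟩
      by_cases hau : a = u
      · rw [hau, hu.1]
      have h1 := hπ w hadj.2.1 a ha hwa
      rw [hw] at h1
      refine (hM.eq_of_joined_of_ne hc (reachable_univ hcw) hwc hadj.2.2.symm hwa h1
        (Ne.symm hau) fun h2 => hau ?_).symm
      exact hinj ha hadj.1 (h2.symm.trans hu.1.symm)
  obtain ⟨p⟩ := hr
  exact key c v p (SimpleGraph.Reachable.refl _) h

theorem mem_of_reachable {K A : Set B} {c v : B} (hc : c ∈ A)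
    (hA : ∀ a ∈ A, ∀ d ∈ K, M.Joined a d → d ∈ A) (h : (M.graph K).Reachable c v) : v ∈ A := by
  obtain ⟨p⟩ := h
  induction p with
  | nil => exact hc
  | cons hadj p ih => exact ih (hA _ hc _ hadj.2.1 hadj.2.2)

end CoxeterMatrix

namespace CoxeterSystem

variable {cs : CoxeterSystem M W}

theorem semiconj_simple_mul (cs : CoxeterSystem M W) (i j : B) (k : ℤ) :
    cs.simple i * (cs.simple i * cs.simple j) ^ k =
      (cs.simple i * cs.simple j) ^ (-k) * cs.simple i := by
  have : SemiconjBy (cs.simple i) (cs.simple i * cs.simple j) (cs.simple i * cs.simple j)⁻¹ := by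
    simp [SemiconjBy, mul_assoc]
  rw [zpow_neg, ← inv_zpow]
  exact (this.zpow_right k).eq

theorem exists_zpow_of_mem_pair {i j : B} {v : W} (hv : v ∈ parabolic cs {i, j}) :
    ∃ k : ℤ, v = (cs.simple i * cs.simple j) ^ k ∨
      v = (cs.simple i * cs.simple j) ^ k * cs.simple i := by
  have e := cs.semiconj_simple_mul i j
  have e' : ∀ k m : ℤ, (cs.simple i * cs.simple j) ^ k * cs.simple i *
      (cs.simple i * cs.simple j) ^ m = (cs.simple i * cs.simple j) ^ (k - m) * cs.simple i := by
    intro k m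
    rw [mul_assoc, e, ← mul_assoc, ← zpow_add, sub_eq_add_neg]
  induction hv using Subgroup.closure_induction with
  | mem y hy =>
    obtain ⟨k, rfl | rfl, rfl⟩ := hy
    · exact ⟨0, Or.inr (by simp)⟩
    · exact ⟨-1, Or.inr (by simp)⟩
  | one => exact ⟨0, Or.inl (by simp)⟩
  | mul x y _ _ ihx ihy =>
    obtain ⟨k, rfl | rfl⟩ := ihx <;> obtain ⟨m, rfl | rfl⟩ := ihy
    · exact ⟨k + m, Or.inl (zpow_add _ _ _).symm⟩
    · exact ⟨k + m, Or.inr (by rw [← mul_assoc, zpow_add])⟩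
    · exact ⟨k - m, Or.inr (e' k m)⟩
    · exact ⟨k - m, Or.inl (by rw [← mul_assoc, e']; simp)⟩
  | inv x _ ih =>
    obtain ⟨k, rfl | rfl⟩ := ih
    · exact ⟨-k, Or.inl (zpow_neg _ _).symm⟩
    · exact ⟨k, Or.inr (by rw [mul_inv_rev, inv_simple, ← zpow_neg, e, neg_neg])⟩

theorem IsCuspidal.exists_zpow {i j : B} (hij : i ≠ j) {v : W} (hv : cs.IsCuspidal {i, j} v) :
    ∃ k : ℤ, v = (cs.simple i * cs.simple j) ^ k := by
  obtain ⟨k, h | h⟩ := exists_zpow_of_mem_pair hv.1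
  · exact ⟨k, h⟩
  exfalso
  have e := cs.semiconj_simple_mul i j
  have hi : cs.simple i ∈ parabolic cs {i, j} := cs.simple_mem_parabolic (by simp)
  have hj : cs.simple j ∈ parabolic cs {i, j} := cs.simple_mem_parabolic (by simp)
  obtain ⟨m, hm | hm⟩ := Int.even_or_odd' k
  · refine hv.2 {i} ⟨by simp, fun h => hij (h (by simp : j ∈ ({i, j} : Set B))).symm⟩
      ((cs.simple i * cs.simple j) ^ (-m)) (zpow_mem (mul_mem hi hj) _) ?_
    have : (cs.simple i * cs.simple j) ^ (-m) * v * ((cs.simple i * cs.simple j) ^ (-m))⁻¹ =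
        cs.simple i := by
      rw [h, ← zpow_neg, neg_neg, mul_assoc, mul_assoc, e, ← mul_assoc, ← mul_assoc, ← zpow_add,
        ← zpow_add, hm]
      ring_nf; simp
    rw [this]
    exact cs.simple_mem_parabolic rfl
  · refine hv.2 {j} ⟨by simp, fun h => hij (h (by simp : i ∈ ({i, j} : Set B)))⟩
      (cs.simple i * (cs.simple i * cs.simple j) ^ (-m))
      (mul_mem hi (zpow_mem (mul_mem hi hj) _)) ?_
    have : (cs.simple i * cs.simple j) ^ (-m) * v * ((cs.simple i * cs.simple j) ^ (-m))⁻¹ =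
        cs.simple i * cs.simple j * cs.simple i := by
      rw [h, ← zpow_neg, neg_neg, mul_assoc, mul_assoc, e, ← mul_assoc, ← mul_assoc, ← zpow_add,
        ← zpow_add, hm]
      ring_nf; simp
    have h2 : cs.simple i * (cs.simple i * cs.simple j) ^ (-m) * v *
        (cs.simple i * (cs.simple i * cs.simple j) ^ (-m))⁻¹ = cs.simple j := by
      rw [mul_inv_rev, mul_assoc, mul_assoc, ← mul_assoc v, ← mul_assoc _ (v * _), ← mul_assoc _ v,
        this]
      simp [mul_assoc]
    rw [h2]
    exact cs.simple_mem_parabolic rfl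

theorem noFusion_of_eqOn_id {n : W} {I : Set B} {π : B → B} (h : cs.IsConjPerm n I π)
    (hid : ∀ i ∈ I, π i = i) : cs.NoFusion n I :=
  fun v hv => ⟨1, one_mem _, by rw [h.eq_of_eqOn_id subset_rfl hid hv.1]; simp⟩

theorem noFusion_pair {n : W} {i j : B} {π : B → B} (hij : i ≠ j)
    (h : cs.IsConjPerm n {i, j} π) : cs.NoFusion n {i, j} := by
  have hi := h i (by simp)
  have hj := h j (by simp)
  by_cases hπ : π i = i
  · refine noFusion_of_eqOn_id h ?_
    rintro k (rfl | rfl)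
    · exact hπ
    · refine hj.1.resolve_left fun hji => hij ?_
      exact (h.injOn (by simp) (by simp) (hji.trans hπ.symm)).symm
  · have hij' : π i = j := hi.1.resolve_left hπ
    have hji : π j = i := by
      refine hj.1.resolve_right fun hjj => hij ?_
      exact h.injOn (by simp) (by simp) (hij'.trans (Eq.symm hjj))
    intro v hv
    obtain ⟨k, rfl⟩ := hv.exists_zpow hij
    refine ⟨cs.simple i, cs.simple_mem_parabolic (by simp), ?_⟩
    rw [cs.semiconj_simple_mul, mul_inv_cancel_right, ← conj_zpow, ← conj_mul, hi.2, hj.2, hij',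
      hji, zpow_neg, ← inv_zpow, mul_inv_rev, inv_simple, inv_simple]

theorem noFusion_of_mem_union {A D : Set B} (hsep : ∀ a ∈ A, ∀ d ∈ D, ¬ M.Joined a d) {n : W}
    (hn : n ∈ parabolic cs (A ∪ D)) : cs.NoFusion n A := by
  obtain ⟨a, ha, d, hd, rfl⟩ := exists_mul_of_mem_parabolic_union hsep hn
  intro v hv
  refine ⟨a, ha, ?_⟩
  have := (cs.commute_of_mem_parabolic hsep hv.1 hd).eq
  have h1 : a * d * v * (a * d)⁻¹ = a * (d * v) * d⁻¹ * a⁻¹ := by group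
  rw [h1, ← this]; group

theorem noFusion_of_closed {I : Set B} (hI : ∀ a ∈ I, ∀ d, M.Joined a d → d ∈ I) (n : W) :
    cs.NoFusion n I :=
  noFusion_of_mem_union (D := Iᶜ) (fun a ha d hd h => hd (hI a ha d h))
    (by rw [Set.union_compl_self, parabolic_univ]; trivial)

theorem IsConjPerm.eq_or_eq_of_heavy [Fintype B] (hM : M.IsPos) {n : W} {I : Set B} {π : B → B}
    (h : cs.IsConjPerm n I π) {i j : B} (hi : i ∈ I) (hj : j ∈ I) (hij : M.Heavy i j) :
    π i = i ∨ π i = j := by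
  have hr : (M.graph Set.univ).Reachable i (π i) :=
    cs.reachable_of_conj (d := n) (by rw [parabolic_univ]; trivial) trivial (h i hi).2
  rcases hM.defect_unique hr (Or.inl ⟨j, trivial, hij⟩)
    (Or.inl ⟨π j, trivial, (h.heavy_iff hi hj).2 hij⟩) with h1 | h1
  · exact Or.inl h1.symm
  · exact Or.inr (hM.heavy_unique h1 hij)

theorem noFusion_of_heavy_end [Fintype B] (hM : M.IsPos) {n : W} {I : Set B} {π : B → B}
    (h : cs.IsConjPerm n I π) (hI : M.ConnectedOn I) {i j l : B} (hi : i ∈ I) (hj : j ∈ I)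
    (hl : l ∈ I) (hij : M.Heavy i j) (hjl : M.Joined j l) (hli : l ≠ i)
    (hend : ∀ a ∈ I, M.Joined i a → a = j) : cs.NoFusion n I := by
  have hii : π i = i := by
    refine (h.eq_or_eq_of_heavy hM hi hj hij).resolve_right fun h1 => ?_
    have h2 := (h.heavy_iff hi hj).2 hij
    rw [h1] at h2
    have h3 := hM.heavy_unique h2 hij.symm
    have h4 := (h.joined_iff hj hl).2 hjl
    rw [h3] at h4
    have h5 := hend _ (h l hl).1 h4
    exact hli (h.injOn hl hi (h5.trans h1.symm))
  have hjj : π j = j := by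
    have h2 := (h.heavy_iff hi hj).2 hij
    rw [hii] at h2
    exact hM.heavy_unique h2 hij
  refine noFusion_of_eqOn_id h fun v hv => ?_
  refine CoxeterMatrix.FixesStar.eq_of_reachable hM (c := j) ⟨hjj, fun a ha hja => ?_⟩
    (Or.inl ⟨i, trivial, hij.symm⟩) h.injOn
    (fun a ha b hb => (h.joined_iff ha hb).2) (hI j hj v hv)
  by_cases hai : a = i
  · rw [hai, hii]
  · have h1 := (h.joined_iff hj ha).2 hja
    rw [hjj] at h1
    exact hM.eq_of_heavy hij.symm h1 (fun h2 => hai (h.injOn ha hi (h2.trans hii.symm))) hja hai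

theorem noFusion_of_heavy [Fintype B] (hM : M.IsPos) {n : W} {I : Set B} {π : B → B}
    (h : cs.IsConjPerm n I π) (hI : M.ConnectedOn I) {i j : B} (hi : i ∈ I) (hj : j ∈ I)
    (hij : M.Heavy i j) : cs.NoFusion n I := by
  by_cases hk : ∃ k ∈ I, M.Joined i k ∧ k ≠ j
  · obtain ⟨k, hk, hik, hkj⟩ := hk
    by_cases hl : ∃ l ∈ I, M.Joined j l ∧ l ≠ i
    · obtain ⟨l, hl, hjl, hli⟩ := hl
      have hclosed : ∀ a ∈ ({k, i, j, l} : Set B), ∀ d, M.Joined a d →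
          d ∈ ({k, i, j, l} : Set B) := by
        rintro a (rfl | rfl | rfl | rfl) d had
        · by_cases hd : d = i
          · simp [hd]
          · exact (hM.not_affineF had.symm hik.symm hij hjl hd hkj hli.symm).elim
        · by_cases hd : d = j
          · simp [hd]
          · simp [hM.eq_of_heavy hij had hd hik hkj]
        · by_cases hd : d = i
          · simp [hd]
          · simp [hM.eq_of_heavy hij.symm had hd hjl hli]
        · by_cases hd : d = j
          · simp [hd]
          · exact (hM.not_affineF had.symm hjl.symm hij.symm hik hd hli hkj.symm).elim
      have hsub : ({k, i, j, l} : Set B) ⊆ I := by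
        rintro a (rfl | rfl | rfl | rfl) <;> assumption
      refine noFusion_of_closed (fun a ha d had => hsub (hclosed a ?_ d had)) n
      exact CoxeterMatrix.mem_of_reachable (by simp) (fun a ha d _ => hclosed a ha d)
        (hI i hi a ha)
    · push Not at hl
      exact noFusion_of_heavy_end hM h hI hj hi hk hij.symm hik hkj hl
  · push Not at hk
    by_cases hl : ∃ l ∈ I, M.Joined j l ∧ l ≠ i
    · obtain ⟨l, hl, hjl, hli⟩ := hl
      exact noFusion_of_heavy_end hM h hI hi hj hl hij hjl hli hk
    · push Not at hl
      have hI' : I = {i, j} := by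
        refine Set.Subset.antisymm (fun v hv => ?_) ?_
        · refine CoxeterMatrix.mem_of_reachable (by simp) ?_ (hI i hi v hv)
          rintro a (rfl | rfl) d hd had
          · simp [hk d hd had]
          · simp [hl d hd had]
        · rintro a (rfl | rfl) <;> assumption
      subst hI'
      exact noFusion_pair hij.1.ne h

end CoxeterSystem

theorem BraidChain.map {G H : Type*} [Group G] [Group H] (f : G →* H) {t : G} {l : List G}
    (h : BraidChain t l) : BraidChain (f t) (l.map f) := by
  induction l with
  | nil => trivial
  | cons a l ih =>
    cases l with
    | nil => exact ⟨by rw [← map_mul, h.1, map_one], by simp only [← map_mul, h.2]⟩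
    | cons b l =>
      refine ⟨by rw [← map_mul, h.1, map_one], by simp only [← map_mul, h.2.1], ?_,
        h.2.2.2.1.map f, ih h.2.2.2.2⟩
      intro c hc
      obtain ⟨d, hd, rfl⟩ := List.mem_map.1 hc
      exact (h.2.2.1 d hd).map f

theorem mul_zpow_mem_of_mem_chainSubgroup {G : Type*} [Group G] {n : G} {H : Subgroup G}
    (hn : n ∈ Subgroup.normalizer (H : Set G)) {l : List G} (hl : ∀ a ∈ l, a ∈ H) {p : G × Multiplicative ℤ}
    (hp : p ∈ chainSubgroup (n, Multiplicative.ofAdd 1)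
      (l.map (MonoidHom.inl G (Multiplicative ℤ)))) :
    p.1 * (n ^ p.2.toAdd)⁻¹ ∈ H := by
  induction hp using Subgroup.closure_induction with
  | mem y hy =>
    rcases hy with rfl | hy
    · simp
    · obtain ⟨a, ha, rfl⟩ := List.mem_map.1 hy
      simpa using hl a ha
  | one => simp
  | mul p q _ _ hp hq =>
    have h1 := mul_mem hp ((Subgroup.mem_normalizer_iff.1 (zpow_mem hn p.2.toAdd) _).1 hq)
    simpa [zpow_add, mul_assoc] using h1
  | inv p _ hp =>
    have h1 := (Subgroup.mem_normalizer_iff.1 (inv_mem (zpow_mem hn p.2.toAdd)) _).1 (inv_mem hp)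
    simpa [mul_assoc] using h1

namespace CoxeterSystem

variable {cs : CoxeterSystem M W}

theorem IsConjPerm.mem_normalizer [Finite B] {n : W} {K : Set B} {π : B → B}
    (h : cs.IsConjPerm n K π) : n ∈ Subgroup.normalizer (parabolic cs K : Set W) := by
  obtain ⟨ρ, hρ⟩ := h.exists_inv
  refine Subgroup.mem_normalizer_iff.2 fun x =>
    ⟨h.conj_mem subset_rfl fun i hi => (h i hi).1, fun hx => ?_⟩
  simpa [mul_assoc] using hρ.conj_mem subset_rfl (fun i hi => (hρ i hi).1) hx

theorem IsConjPerm.isCuspidal_zpow [Finite B] {n : W} {K : Set B} {π : B → B}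
    (h : cs.IsConjPerm n K π) {v : W} (hv : cs.IsCuspidal K v) (k : ℤ) :
    cs.IsCuspidal K (n ^ k * v * (n ^ k)⁻¹) := by
  obtain ⟨ρ, hρ⟩ := h.exists_inv
  induction k using Int.induction_on with
  | zero => simpa using hv
  | succ k ih => simpa [zpow_add_one, ← zpow_one_add, add_comm _ (1 : ℤ), zpow_add, mul_assoc] using h.isCuspidal ih
  | pred k ih =>
    have h1 := hρ.isCuspidal ih
    have h2 : n ^ (-(k : ℤ) - 1) = n⁻¹ * n ^ (-(k : ℤ)) := by group
    rw [h2]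
    simpa [mul_assoc] using h1

theorem exists_conj_eq_of_conj {n q v u h : W} {H : Subgroup W} (hn : n ∈ Subgroup.normalizer (H : Set W))
    {k : ℤ} (hh : h ∈ H) (hq : q = h * n ^ k) (hu : u ∈ H)
    (huv : u * (q * v * q⁻¹) * u⁻¹ = n * (q * v * q⁻¹) * n⁻¹) :
    ∃ w ∈ H, w * v * w⁻¹ = n * v * n⁻¹ := by
  have hqn : q ∈ Subgroup.normalizer (H : Set W) := by
    rw [hq]; exact mul_mem (Subgroup.le_normalizer hh) (zpow_mem hn k)
  have hk := zpow_mem hn k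
  have he : q⁻¹ * n * q * n⁻¹ ∈ H := by
    have h1 : q⁻¹ * n * q * n⁻¹ = (n ^ k)⁻¹ * (h⁻¹ * (n * h * n⁻¹)) * ((n ^ k)⁻¹)⁻¹ := by
      have h2 : n * n ^ k * n⁻¹ = n ^ k := by group
      rw [hq, mul_inv_rev, inv_inv]
      nth_rewrite 4 [← h2]
      group
    rw [h1]
    exact (Subgroup.mem_normalizer_iff.1 (inv_mem hk) _).1
      (mul_mem (inv_mem hh) ((Subgroup.mem_normalizer_iff.1 hn _).1 hh))
  have hc : q⁻¹ * u * q ∈ H := by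
    simpa using (Subgroup.mem_normalizer_iff.1 (inv_mem hqn) _).1 hu
  refine ⟨(q⁻¹ * n * q * n⁻¹)⁻¹ * (q⁻¹ * u * q), mul_mem (inv_mem he) hc, ?_⟩
  calc _ = n * q⁻¹ * n⁻¹ * (u * (q * v * q⁻¹) * u⁻¹) * (n * q⁻¹ * n⁻¹)⁻¹ := by group
    _ = _ := by rw [huv]; group

/-- Conjugation by `n` acts on a type `A` chain by swapping its last node `y` with a further
node outside the chain. -/
theorem noFusion_of_swap [Finite B] {n : W} {I : Set B} {π : B → B} (h : cs.IsConjPerm n I π)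
    {l : List B} {y : B} (hnd : (l ++ [y]).Nodup) (hI : ∀ i ∈ I, i ∈ l ++ [y] ∨ i = π y)
    (hlI : ∀ i ∈ l ++ [y], i ∈ I) (hy : π y ∉ l ++ [y]) (hπ : ∀ i ∈ l, π i = i)
    (hyy : π (π y) = y) (hcomm : Commute (cs.simple y) (cs.simple (π y)))
    (hl : BraidChain 1 ((l ++ [y]).map cs.simple)) : cs.NoFusion n I := by
  have hyI : y ∈ I := hlI y (by simp)
  have hπ2 : ∀ i ∈ I, π (π i) = i := by
    intro i hi
    rcases hI i hi with h1 | rfl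
    · rcases List.mem_append.1 h1 with h1 | h1
      · rw [hπ i h1, hπ i h1]
      · rw [List.mem_singleton.1 h1, hyy]
    · rw [hyy]
  have hn : ∀ i ∈ I, n * cs.simple i = cs.simple (π i) * n := fun i hi => by
    rw [← (h i hi).2]; group
  let f := MonoidHom.inl W (Multiplicative ℤ)
  set t : W × Multiplicative ℤ := (n, Multiplicative.ofAdd 1) with ht
  have hchain : BraidChain t (((l ++ [y]).map cs.simple).map f) := by
    have h1 := hl.map f
    rw [map_one] at h1
    rw [List.map_append, List.map_append, List.map_singleton, List.map_singleton] at h1 ⊢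
    refine h1.of_one ?_ ?_
    · refine Prod.ext ?_ (by simp [f, ht])
      change cs.simple y * n * cs.simple y * n = n * cs.simple y * n * cs.simple y
      calc cs.simple y * n * cs.simple y * n
          = cs.simple y * (n * cs.simple y) * n := by group
        _ = cs.simple y * cs.simple (π y) * n * n := by rw [hn y hyI]; group
        _ = cs.simple (π y) * (cs.simple (π (π y)) * n) * n := by rw [hcomm.eq, hyy]; group
        _ = cs.simple (π y) * n * (cs.simple (π y) * n) := by rw [← hn _ (h y hyI).1]; group
        _ = _ := by rw [← hn y hyI]; group
    · intro c hc
      simp only [List.map_map, List.mem_map] at hc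
      obtain ⟨i, hi, rfl⟩ := hc
      refine Prod.ext ?_ (by simp [f, ht])
      change cs.simple i * n = n * cs.simple i
      rw [hn i (hlI i (by simp [hi])), hπ i hi]
  have htt : ∀ x ∈ ((l ++ [y]).map cs.simple).map f, Commute x (t * t) := by
    intro c hc
    simp only [List.map_map, List.mem_map] at hc
    obtain ⟨i, hi, rfl⟩ := hc
    have hi' := hlI i hi
    refine Prod.ext ?_ (by simp [f, ht])
    change cs.simple i * (n * n) = n * n * cs.simple i
    rw [mul_assoc n, hn i hi', ← mul_assoc n, hn _ (h i hi').1, hπ2 i hi', mul_assoc]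
  have hdeg : ∀ x ∈ ((l ++ [y]).map cs.simple).map f, MonoidHom.snd W (Multiplicative ℤ) x = 1 := by
    intro c hc
    obtain ⟨a, _, rfl⟩ := List.mem_map.1 hc
    rfl
  intro v hv
  have hvt : f v ∈ chainSubgroup t (((l ++ [y]).map cs.simple).map f) := by
    have h1 : parabolic cs I ≤ (chainSubgroup t (((l ++ [y]).map cs.simple).map f)).comap f := by
      rw [parabolic, Subgroup.closure_le]
      have h2 : ∀ i ∈ l ++ [y], f (cs.simple i) ∈
          chainSubgroup t (((l ++ [y]).map cs.simple).map f) := fun i hi =>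
        mem_chainSubgroup (List.mem_map_of_mem (List.mem_map_of_mem hi))
      rintro _ ⟨i, hi, rfl⟩
      rcases hI i hi with hi | rfl
      · exact h2 i hi
      · have h3 : f (cs.simple (π y)) = t * f (cs.simple y) * t⁻¹ := by
          refine Prod.ext ?_ (by simp [f, ht])
          change cs.simple (π y) = n * cs.simple y * n⁻¹
          rw [(h y hyI).2]
        rw [SetLike.mem_coe, Subgroup.mem_comap]
        rw [h3]
        have h4 := mem_chainSubgroup_self t (((l ++ [y]).map cs.simple).map f)
        exact mul_mem (mul_mem h4 (h2 y (by simp))) (inv_mem h4)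
    exact h1 hv.1
  obtain ⟨u, hu, g, hg, hg'⟩ := hchain.exists_conj (pre := []) (MonoidHom.snd W (Multiplicative ℤ))
    htt hdeg hvt
  rw [List.nil_append] at hu hg'
  rw [List.prod_nil, one_mul] at hg
  have hnI := h.mem_normalizer
  have hsI : ∀ a ∈ (l ++ [y]).map cs.simple, a ∈ parabolic cs I := by
    intro a ha
    obtain ⟨i, hi, rfl⟩ := List.mem_map.1 ha
    exact cs.simple_mem_parabolic (hlI i hi)
  have hu1 := mul_zpow_mem_of_mem_chainSubgroup hnI hsI hu
  set k := u.2.toAdd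
  set q := u.1 with hq
  have hqe : q = q * (n ^ k)⁻¹ * n ^ k := by group
  have hg1 : q * v * q⁻¹ = g.1 := by rw [← hg]; rfl
  have hg2 : g.2 = 1 := by rw [← hg]; simp [f]
  have hcon : ∀ K ⊂ I, q * v * q⁻¹ ∉ parabolic cs K := by
    intro K hK hmem
    have hcusp : cs.IsCuspidal I (n ^ k * v * (n ^ k)⁻¹) := h.isCuspidal_zpow hv k
    refine hcusp.2 K hK _ hu1 ?_
    rw [hqe] at hmem
    simpa [mul_assoc] using hmem
  rcases hg' with ⟨m, hm⟩ | ⟨l₁, a, l₂, hl', hm⟩ | ⟨_, z, hz, hzg, hzd⟩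
  · exfalso
    have hm0 : m = 0 := by
      have h1 := congrArg (MonoidHom.snd W (Multiplicative ℤ)) hm
      rw [map_mul, map_list_prod, List.prod_eq_one (l := List.map _ _), map_zpow] at h1
      · have h2 : (1 : Multiplicative ℤ) = (Multiplicative.ofAdd 1) ^ m := by
          simpa [hg2, ht] using h1
        have h3 := congrArg Multiplicative.toAdd h2
        simpa using h3.symm
      · intro x hx
        obtain ⟨y, hy, rfl⟩ := List.mem_map.1 hx
        exact hdeg y hy
    refine hcon (I \ {π y}) ⟨Set.sdiff_subset, fun hle => (hle (h y hyI).1).2 rfl⟩ ?_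
    rw [hg1, hm, hm0, zpow_zero, mul_one, List.prod_hom]
    refine list_prod_mem ?_
    intro a ha
    obtain ⟨i, hi, rfl⟩ := List.mem_map.1 ha
    exact cs.simple_mem_parabolic ⟨hlI i hi, fun h => hy (h ▸ hi)⟩
  · exfalso
    rw [List.map_eq_append_iff] at hl'
    obtain ⟨m₁, m₂, hm', rfl, hm₂⟩ := hl'
    obtain ⟨b, m₃, rfl, rfl, rfl⟩ := List.map_eq_cons_iff.1 hm₂
    rw [List.map_eq_append_iff] at hm'
    obtain ⟨k₁, k₂, hk', rfl, hk₂⟩ := hm'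
    obtain ⟨i, k₃, rfl, rfl, rfl⟩ := List.map_eq_cons_iff.1 hk₂
    rw [← List.map_append, ← List.map_append] at hm
    have hi : i ∈ l ++ [y] := by rw [hk']; simp
    have hiI := hlI i hi
    have hsub : I \ {i, π i} ⊂ I :=
      ⟨Set.sdiff_subset, fun hle => (hle hiI).2 (Or.inl rfl)⟩
    have hK : cs.IsConjPerm n (I \ {i, π i}) π := by
      refine h.mono Set.sdiff_subset ?_
      rintro j ⟨hj, hj'⟩
      refine ⟨(h j hj).1, ?_⟩
      rintro (h1 | h1)
      · exact hj' (Or.inr (by rw [← h1]; exact (hπ2 j hj).symm))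
      · exact hj' (Or.inl (h.injOn hj hiI h1))
    have h1 := mul_zpow_mem_of_mem_chainSubgroup hK.mem_normalizer (l := (k₁ ++ k₃).map cs.simple)
      ?_ hm
    · rw [hg2, ← hg1] at h1
      exact hcon _ hsub (by simpa using h1)
    · intro a ha
      obtain ⟨j, hj, rfl⟩ := List.mem_map.1 ha
      have hj1 : j ∈ l ++ [y] := by
        rw [hk']
        simp only [List.mem_append, List.mem_cons] at hj ⊢
        tauto
      refine cs.simple_mem_parabolic ⟨hlI j hj1, ?_⟩
      rw [hk'] at hnd
      have hne : j ≠ i := fun h => (List.nodup_middle.1 hnd).notMem (h ▸ hj)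
      rintro (h2 | h2)
      · exact hne h2
      · rcases List.mem_append.1 hi with h3 | h3
        · exact hne (h2.trans (hπ i h3))
        · rw [List.mem_singleton.1 h3] at h2
          exact hy (h2 ▸ hj1)
  · have hz1 := mul_zpow_mem_of_mem_chainSubgroup hnI hsI hz
    have hz2 : z.2 = Multiplicative.ofAdd 1 := hzd
    rw [hz2] at hz1
    simp only [toAdd_ofAdd, zpow_one] at hz1
    refine exists_conj_eq_of_conj hnI hu1 hqe (inv_mem hz1) ?_
    have h1 : z.1 * g.1 = g.1 * z.1 := congrArg Prod.fst hzg.eq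
    rw [hg1]
    calc (z.1 * n⁻¹)⁻¹ * g.1 * (z.1 * n⁻¹)⁻¹⁻¹ = n * z.1⁻¹ * (g.1 * z.1) * n⁻¹ := by group
      _ = _ := by rw [← h1]; group

end CoxeterSystem

namespace CoxeterMatrix

/-- The node `c` is joined to the three distinct nodes `x`, `y` and `z`. -/
structure Branch (M : CoxeterMatrix B) (c x y z : B) : Prop where
  hx : M.Joined c x
  hy : M.Joined c y
  hz : M.Joined c z
  hxy : x ≠ y
  hxz : x ≠ z
  hyz : y ≠ z

namespace Branch

variable {c x y z : B}

theorem rotate (h : M.Branch c x y z) : M.Branch c y z x :=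
  ⟨h.hy, h.hz, h.hx, h.hyz, h.hxy.symm, h.hxz.symm⟩

theorem defect (h : M.Branch c x y z) : M.Defect Set.univ c :=
  Or.inr ⟨x, trivial, y, trivial, z, trivial, h.hxy, h.hxz, h.hyz, h.hx, h.hy, h.hz⟩

variable [Fintype B]

theorem eq_or (h : M.Branch c x y z) (hM : M.IsPos) {d : B} (hd : M.Joined c d) :
    d = x ∨ d = y ∨ d = z :=
  hM.mem_of_joined h.hx h.hy h.hz h.hxy h.hxz h.hyz hd

theorem not_heavy (h : M.Branch c x y z) (hM : M.IsPos) (d : B) : ¬ M.Heavy c d := by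
  intro hd
  by_cases hx : x = d
  · exact h.hyz (hM.eq_of_heavy hd h.hy (fun e => h.hxy (hx.trans e.symm)) h.hz
      fun e => h.hxz (hx.trans e.symm))
  · by_cases hy : y = d
    · exact h.hxz (hM.eq_of_heavy hd h.hx hx h.hz fun e => h.hyz (hy.trans e.symm))
    · exact h.hxy (hM.eq_of_heavy hd h.hx hx h.hy hy)

theorem eq_of_defect (h : M.Branch c x y z) (hM : M.IsPos) {v : B}
    (hr : (M.graph Set.univ).Reachable c v) (hv : M.Defect Set.univ v) : v = c :=
  ((hM.defect_unique hr h.defect hv).resolve_right (h.not_heavy hM v)).symm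

theorem not_joined (h : M.Branch c x y z) (hM : M.IsPos) : ¬ M.Joined x y :=
  fun e => hM.not_triangle h.hx e h.hy.symm

end Branch

end CoxeterMatrix

namespace CoxeterSystem

variable {cs : CoxeterSystem M W} [Fintype B] {n : W} {K : Set B} {π : B → B} {c x y z : B}

theorem IsConjPerm.branch_eq (h : cs.IsConjPerm n K π) (hM : M.IsPos) (hb : M.Branch c x y z)
    (hc : c ∈ K) (hx : x ∈ K) (hy : y ∈ K) (hz : z ∈ K) : π c = c := by
  refine hb.eq_of_defect hM
    (cs.reachable_of_conj (d := n) (by rw [parabolic_univ]; trivial) trivial (h c hc).2) ?_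
  exact Or.inr ⟨π x, trivial, π y, trivial, π z, trivial, fun e => hb.hxy (h.injOn hx hy e),
    fun e => hb.hxz (h.injOn hx hz e), fun e => hb.hyz (h.injOn hy hz e),
    (h.joined_iff hc hx).2 hb.hx, (h.joined_iff hc hy).2 hb.hy, (h.joined_iff hc hz).2 hb.hz⟩

theorem IsConjPerm.eq_of_branch (h : cs.IsConjPerm n K π) (hM : M.IsPos) (hK : M.ConnectedOn K)
    (hb : M.Branch c x y z) (hc : c ∈ K) (hx : x ∈ K) (hy : y ∈ K) (hz : z ∈ K) (hπx : π x = x)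
    (hπy : π y = y) : ∀ i ∈ K, π i = i := by
  have hcc := h.branch_eq hM hb hc hx hy hz
  have hπz : π z = z := by
    have h1 := (h.joined_iff hc hz).2 hb.hz
    rw [hcc] at h1
    rcases hb.eq_or hM h1 with e | e | e
    · exact absurd (h.injOn hx hz (hπx.trans e.symm)) hb.hxz
    · exact absurd (h.injOn hy hz (hπy.trans e.symm)) hb.hyz
    · exact e
  intro i hi
  refine CoxeterMatrix.FixesStar.eq_of_reachable hM (c := c) ⟨hcc, fun a ha hca => ?_⟩ hb.defect
    h.injOn (fun a ha b hb => (h.joined_iff ha hb).2) (hK c hc i hi)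
  rcases hb.eq_or hM hca with rfl | rfl | rfl <;> assumption

theorem noFusion_of_fixed_arm (h : cs.IsConjPerm n K π) (hM : M.IsPos) (hK : M.ConnectedOn K)
    (hb : M.Branch c x y z) (hc : c ∈ K) (hx : x ∈ K) (hy : y ∈ K) (hz : z ∈ K) (hπx : π x = x)
    (hya : ∀ a ∈ K, M.Joined y a → a = c) (hza : ∀ a ∈ K, M.Joined z a → a = c) :
    cs.NoFusion n K := by
  have hcc := h.branch_eq hM hb hc hx hy hz
  have hyn : π y ≠ x := fun e => hb.hxy (h.injOn hx hy (hπx.trans e.symm))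
  have hzn : π z ≠ x := fun e => hb.hxz (h.injOn hx hz (hπx.trans e.symm))
  have hjy := (h.joined_iff hc hy).2 hb.hy
  have hjz := (h.joined_iff hc hz).2 hb.hz
  rw [hcc] at hjy hjz
  by_cases hπy : π y = y
  · exact noFusion_of_eqOn_id h (h.eq_of_branch hM hK hb hc hx hy hz hπx hπy)
  have hyz : π y = z := ((hb.eq_or hM hjy).resolve_left hyn).resolve_left hπy
  have hzy : π z = y := by
    refine ((hb.eq_or hM hjz).resolve_left hzn).resolve_right fun e => hb.hyz ?_
    exact h.injOn hy hz (hyz.trans e.symm)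
  have hfix : ∀ i ∈ K, i ≠ y → i ≠ z → π i = i := by
    have hs : ∀ i ∈ K, Equiv.swap y z (π i) = i := by
      intro i hi
      refine CoxeterMatrix.FixesStar.eq_of_reachable hM (K := K)
        (π := fun i => Equiv.swap y z (π i)) (c := c) ⟨?_, fun a ha hca => ?_⟩
        hb.defect ?_ ?_ (hK c hc i hi)
      · beta_reduce
        rw [hcc, Equiv.swap_apply_of_ne_of_ne hb.hy.ne hb.hz.ne]
      · beta_reduce
        rcases hb.eq_or hM hca with rfl | rfl | rfl
        · rw [hπx, Equiv.swap_apply_of_ne_of_ne hb.hxy hb.hxz]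
        · rw [hyz, Equiv.swap_apply_right]
        · rw [hzy, Equiv.swap_apply_left]
      · exact fun a ha b hb e => h.injOn ha hb ((Equiv.swap y z).injective e)
      · have key : ∀ a ∈ K, ∀ b ∈ K, M.Joined a b →
            M.Joined (Equiv.swap y z a) (Equiv.swap y z b) := by
          have hcs : Equiv.swap y z c = c := Equiv.swap_apply_of_ne_of_ne hb.hy.ne hb.hz.ne
          have k1 : ∀ a, a = y ∨ a = z → ∀ b ∈ K, M.Joined a b →
              M.Joined (Equiv.swap y z a) (Equiv.swap y z b) := by
            rintro a (rfl | rfl) b hbK hab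
            · rw [hya b hbK hab, hcs, Equiv.swap_apply_left]; exact hb.hz.symm
            · rw [hza b hbK hab, hcs, Equiv.swap_apply_right]; exact hb.hy.symm
          intro a ha b hb hab
          by_cases h1 : a = y ∨ a = z
          · exact k1 a h1 b hb hab
          by_cases h2 : b = y ∨ b = z
          · exact (k1 b h2 a ha hab.symm).symm
          push Not at h1 h2
          rwa [Equiv.swap_apply_of_ne_of_ne h1.1 h1.2, Equiv.swap_apply_of_ne_of_ne h2.1 h2.2]
        exact fun a ha b hb hab => key _ (h a ha).1 _ (h b hb).1 ((h.joined_iff ha hb).2 hab)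
    intro i hi hiy hiz
    have h1 := congrArg (Equiv.swap y z) (hs i hi)
    rwa [Equiv.swap_apply_self, Equiv.swap_apply_of_ne_of_ne hiy hiz] at h1
  have hyC : y ∈ K \ {z} := ⟨hy, hb.hyz⟩
  have hcC : c ∈ K \ {z} := ⟨hc, hb.hz.ne⟩
  have hreach : ∀ v ∈ K \ {z}, (M.graph (K \ {z})).Reachable y v := by
    have hcr : (M.graph (K \ {z})).Reachable y c :=
      SimpleGraph.Adj.reachable ⟨hyC, hcC, hb.hy.symm⟩
    rintro v ⟨hv, hvz⟩
    have h1 := CoxeterMatrix.mem_of_reachable (c := c) (K := K)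
      (A := {v | v = z ∨ v ∈ K \ {z} ∧ (M.graph (K \ {z})).Reachable y v})
      (Or.inr ⟨hcC, hcr⟩) ?_ (hK c hc v hv)
    · exact (h1.resolve_left hvz).2
    · rintro a ha d hd had
      by_cases hdz : d = z
      · exact Or.inl hdz
      rcases ha with rfl | ⟨ha, ha'⟩
      · rw [hza d hd had]
        exact Or.inr ⟨hcC, hcr⟩
      · exact Or.inr ⟨⟨hd, hdz⟩, ha'.trans (SimpleGraph.Adj.reachable ⟨ha, ⟨hd, hdz⟩, had⟩)⟩
  obtain ⟨l, h1, h2, h3⟩ := cs.exists_braidChain rfl (Set.toFinite _) hyC hreach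
    (fun a ha b hb' hja hjb => (hya a ha.1 hja).trans (hya b hb'.1 hjb).symm) (by
      rintro v hv hd
      have hvc : v = c := hb.eq_of_defect hM ((CoxeterMatrix.reachable_univ
        (hreach c hcC)).symm.trans (CoxeterMatrix.reachable_univ (hreach v hv)))
        (hd.mono (Set.subset_univ _))
      subst hvc
      rcases hd with ⟨a, _, ha⟩ | ⟨a, ha, b, hb', d, hd, hab, had, hbd, ja, jb, jd⟩
      · exact hb.not_heavy hM a ha
      · have e : ∀ a ∈ K \ {z}, M.Joined v a → a = x ∨ a = y := fun a ha ja => by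
          rcases hb.eq_or hM ja with e | e | e
          exacts [Or.inl e, Or.inr e, absurd e ha.2]
        rcases e a ha ja with rfl | rfl <;> rcases e b hb' jb with rfl | rfl <;>
          rcases e d hd jd with rfl | rfl <;> contradiction)
  have hmem : ∀ i, i ∈ l.reverse ++ [y] ↔ i ∈ K \ {z} := by
    intro i
    rw [← h2 i]; simp [or_comm]
  have hrev : l.reverse ++ [y] = (y :: l).reverse := by simp
  refine noFusion_of_swap h (l := l.reverse) (y := y) ?_ (fun i hi => ?_)
    (fun i hi => ((hmem i).1 hi).1) (fun hm => ?_) (fun i hi => ?_) ?_ ?_ ?_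
  · rw [hrev]; exact List.nodup_reverse.2 h1
  · by_cases hiz : i = z
    · exact Or.inr (hiz.trans hyz.symm)
    · exact Or.inl ((hmem i).2 ⟨hi, hiz⟩)
  · exact ((hmem _).1 hm).2 hyz
  · have h4 := (hmem i).1 (List.mem_append_left _ hi)
    refine hfix i h4.1 ?_ h4.2
    rintro rfl
    exact (List.nodup_cons.1 h1).1 (List.mem_reverse.1 hi)
  · rw [hyz, hzy]
  · rw [hyz]
    exact cs.commute_simple_of_not_joined (hb.rotate.not_joined hM)
  · rw [hrev, List.map_reverse]
    exact h3.reverse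

end CoxeterSystem

namespace CoxeterSystem

variable {cs : CoxeterSystem M W}

theorem IsConjPerm.exists_mul_descents [Fintype W] [Finite B] {d : W} {I : Set B} {π : B → B}
    (h : cs.IsConjPerm d I π) (hd : d ∈ minReps cs I) (hd1 : d ≠ 1) :
    ∃ s ∉ I, ∃ y ∈ parabolic cs (insert s I), ∃ u ∈ parabolic cs I, ∃ d' ∈ minReps cs I,
      ∃ ρ τ : B → B, cs.IsConjPerm y (insert s I) ρ ∧ cs.IsConjPerm u I τ ∧
        cs.length d' < cs.length d ∧ d = d' * (y * u) := by
  obtain ⟨s, -, hs⟩ := cs.exists_rightDescent_mem (I := Set.univ)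
    (by rw [cs.parabolic_univ]; trivial) hd1
  have hsI : s ∉ I := fun hsI => by have := hd s hsI; omega
  obtain ⟨u, hu, hd'⟩ := cs.exists_mem_minReps (insert s I) d
  obtain ⟨v, rfl⟩ : ∃ v, u = v⁻¹ := ⟨u⁻¹, by simp⟩
  have hv : v ∈ parabolic cs (insert s I) := by simpa using hu
  obtain ⟨d', rfl⟩ : ∃ d', d = d' * v := ⟨d * v⁻¹, by simp⟩
  rw [mul_inv_cancel_right] at hd'
  have hl : ∀ x ∈ parabolic cs (insert s I), cs.length (d' * x) = cs.length d' + cs.length x :=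
    fun x hx => cs.length_mul_of_mem_minReps hd' hx
  have hsimp : ∀ i ∈ insert s I, cs.simple i ∈ parabolic cs (insert s I) :=
    fun i hi => cs.simple_mem_parabolic hi
  have hv1 : v ≠ 1 := by
    rintro rfl
    rw [mul_one] at hs
    have := hd' s (Set.mem_insert _ _)
    omega
  have hvI : v ∈ minReps cs I := by
    intro i hi
    have h1 := hd i hi
    rw [mul_assoc, hl _ hv, hl _ (mul_mem hv (hsimp i (Set.mem_insert_of_mem _ hi)))] at h1
    omega
  have hσ : ∀ i, ∃ j, i ∈ I → j ∈ insert s I ∧ v * cs.simple i * v⁻¹ = cs.simple j := by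
    intro i
    by_cases hi : i ∈ I
    swap
    · exact ⟨i, fun h => absurd h hi⟩
    have hx : v * cs.simple i * v⁻¹ ∈ parabolic cs (insert s I) :=
      mul_mem (mul_mem hv (hsimp i (Set.mem_insert_of_mem _ hi))) (inv_mem hv)
    have h1 : d' * (v * cs.simple i * v⁻¹) = cs.simple (π i) * d' := by
      have h2 := (h i hi).2
      rw [← h2]; group
    have h2 := hl _ hx
    rw [h1] at h2
    have h3 := cs.length_mul_le (cs.simple (π i)) d'
    rw [cs.length_simple] at h3
    have h4 : cs.length (v * cs.simple i * v⁻¹) ≠ 0 := by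
      intro h0
      rw [cs.length_eq_zero_iff, mul_inv_eq_one, mul_eq_left] at h0
      have := cs.length_simple i
      rw [h0, cs.length_one] at this
      omega
    obtain ⟨j, hj, hj'⟩ := cs.exists_eq_simple hx (by omega)
    exact ⟨j, fun _ => ⟨hj, hj'⟩⟩
  choose σ hσ using hσ
  have hσ' : ∀ i ∈ I, cs.simple (σ i) * v = v * cs.simple i := by
    intro i hi
    rw [← (hσ i hi).2]; group
  obtain ⟨k, hkK, hk⟩ := cs.exists_leftDescent_mem hv hv1
  obtain ⟨t, ht, htd⟩ := cs.exists_descents I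
  obtain ⟨τ, hτ⟩ := cs.exists_isConjPerm_of_descents ht htd
  obtain ⟨τ', hτ'⟩ := hτ.exists_inv
  have hlv : ∀ x ∈ parabolic cs I, cs.length (v * x) = cs.length v + cs.length x :=
    fun x hx => cs.length_mul_of_mem_minReps hvI hx
  have hkσ : k ∉ σ '' I := by
    rintro ⟨i, hi, rfl⟩
    rw [hσ' i hi] at hk
    have := hvI i hi
    omega
  have hinj : Set.InjOn σ I := by
    intro i hi j hj hij
    refine cs.simple_injective (mul_left_cancel (a := v) ?_)
    rw [← hσ' i hi, ← hσ' j hj, hij]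
  have hK : insert k (σ '' I) = insert s I := by
    refine Set.eq_of_subset_of_ncard_le ?_ ?_ (Set.toFinite _)
    · rintro j (rfl | ⟨i, hi, rfl⟩)
      · exact hkK
      · exact (hσ i hi).1
    · rw [Set.ncard_insert_of_notMem hkσ (Set.toFinite _),
        Set.ncard_insert_of_notMem hsI (Set.toFinite _), hinj.ncard_image]
  have hy : v * t ∈ parabolic cs (insert s I) :=
    mul_mem hv (cs.parabolic_mono (Set.subset_insert _ _) ht)
  have hyd : ∀ j ∈ insert s I, cs.length ((v * t)⁻¹ * cs.simple j) < cs.length (v * t)⁻¹ := by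
    intro j hj
    have e : (v * t)⁻¹ * cs.simple j = (cs.simple j * (v * t))⁻¹ := by simp
    rw [e, cs.length_inv, cs.length_inv, hlv t ht]
    rw [← hK] at hj
    rcases hj with rfl | ⟨i, hi, rfl⟩
    · have h1 := cs.length_mul_le (cs.simple j * v) t
      rw [mul_assoc] at h1
      omega
    · have h1 : cs.simple i * t = t * cs.simple (τ' i) := by
        have := (hτ' i hi).2
        rw [← this]; group
      rw [← mul_assoc, hσ' i hi, mul_assoc, hlv _ (mul_mem (cs.simple_mem_parabolic hi) ht), h1]
      have := htd _ (hτ' i hi).1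
      omega
  obtain ⟨ρ', hρ'⟩ := cs.exists_isConjPerm_of_descents (inv_mem hy) hyd
  obtain ⟨ρ, hρ⟩ := hρ'.exists_inv
  rw [inv_inv] at hρ
  refine ⟨s, hsI, v * t, hy, t⁻¹, inv_mem ht, d',
    fun i hi => hd' i (Set.mem_insert_of_mem _ hi), ρ, τ', hρ, hτ', ?_, by group⟩
  have h1 : cs.length v ≠ 0 := by rwa [ne_eq, cs.length_eq_zero_iff]
  rw [hl v hv]
  omega

theorem IsConjPerm.of_insert {y : W} {I : Set B} {s : B} {ρ : B → B}
    (h : cs.IsConjPerm y (insert s I) ρ) (hs : s ∉ I) (hρs : ρ s = s) : cs.IsConjPerm y I ρ := by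
  refine h.mono (Set.subset_insert _ _) fun i hi => ?_
  rcases (h i (Set.mem_insert_of_mem _ hi)).1 with h1 | h1
  · have := h.injOn (Set.mem_insert_of_mem _ hi) (Set.mem_insert _ _) (h1.trans hρs.symm)
    exact absurd (this ▸ hi) hs
  · exact h1

/-- If the longest elements of all the parabolic subgroups of rank one more induce no fusion on
`W_I`, then no element normalising the simple reflections in `I` does. -/
theorem noFusion_of_forall_insert [Fintype W] [Finite B] {I : Set B}
    (hstep : ∀ s ∉ I, ∀ y ∈ parabolic cs (insert s I), ∀ ρ,
      cs.IsConjPerm y (insert s I) ρ → ρ s = s ∧ cs.NoFusion y I)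
    {n : W} {π : B → B} (h : cs.IsConjPerm n I π) : cs.NoFusion n I := by
  have key : ∀ k, ∀ d ∈ minReps cs I, ∀ π, cs.IsConjPerm d I π → cs.length d = k →
      cs.NoFusion d I := by
    intro k
    induction k using Nat.strong_induction_on with
    | _ k ih =>
      rintro d hd π h rfl
      by_cases hd1 : d = 1
      · rw [hd1]; exact noFusion_of_mem (one_mem _)
      obtain ⟨s, hs, y, hy, u, hu, d', hd', ρ, τ, hρ, hτ, hlt, e⟩ := h.exists_mul_descents hd hd1
      obtain ⟨hρs, hf⟩ := hstep s hs y hy ρ hρ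
      have hyI := (hρ.of_insert hs hρs).mul hτ
      obtain ⟨ρ', hρ'⟩ := hyI.exists_inv
      have hd'I : cs.IsConjPerm d' I (π ∘ ρ') := by
        have := h.mul hρ'
        rwa [e, mul_inv_cancel_right] at this
      rw [e]
      exact (ih _ hlt d' hd' _ hd'I rfl).mul (hf.mul (noFusion_of_mem hu) hτ) hyI
  obtain ⟨u, hu, hd⟩ := cs.exists_mem_minReps I n
  have hnorm := h.mem_normalizer
  rw [Subgroup.mem_normalizer_iff] at hnorm
  have hl : ∀ x ∈ parabolic cs I, cs.length (n * u * x) = cs.length (n * u) + cs.length x :=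
    fun x hx => cs.length_mul_of_mem_minReps hd hx
  have hperm : ∀ i ∈ I, ∃ j ∈ I, (n * u) * cs.simple i * (n * u)⁻¹ = cs.simple j := by
    have hconj : ∀ x, x ∈ parabolic cs I → n * u * x * (n * u)⁻¹ ∈ parabolic cs I := by
      intro x hx
      have := (hnorm (u * x * u⁻¹)).1 (mul_mem (mul_mem hu hx) (inv_mem hu))
      convert this using 1; group
    intro i hi
    have hx := hconj _ (cs.simple_mem_parabolic hi)
    refine cs.exists_eq_simple hx ?_
    have hinv : (n * u)⁻¹ ∈ minReps cs I := by
      intro j hj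
      have hj' : (n * u)⁻¹ * cs.simple j * (n * u) ∈ parabolic cs I := by
        have := mul_mem (mul_mem (inv_mem hu)
          ((hnorm (n⁻¹ * cs.simple j * n)).2 (by
            convert cs.simple_mem_parabolic hj using 1; group))) hu
        convert this using 1; group
      have h1 := hl _ hj'
      have e : n * u * ((n * u)⁻¹ * cs.simple j * (n * u)) = ((n * u)⁻¹ * cs.simple j)⁻¹ := by
        rw [mul_inv_rev (n * u)⁻¹, inv_inv, inv_simple]; group
      rw [e, cs.length_inv] at h1
      rw [h1, cs.length_inv]
      have h2 : cs.length ((n * u)⁻¹ * cs.simple j * (n * u)) ≠ 0 := by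
        rw [ne_eq, cs.length_eq_zero_iff]
        intro h0
        have h3 : cs.simple j = 1 := by
          have := congrArg (fun x => n * u * x * (n * u)⁻¹) h0
          simpa [mul_assoc] using this
        have := cs.length_simple j
        rw [h3, cs.length_one] at this
        omega
      omega
    have h1 := cs.length_mul_of_mem_minReps hinv (inv_mem hx)
    have e : (n * u)⁻¹ * (n * u * cs.simple i * (n * u)⁻¹)⁻¹ = (n * u * cs.simple i)⁻¹ := by
      group
    rw [e, cs.length_inv, cs.length_inv, cs.length_inv, hl _ (cs.simple_mem_parabolic hi),
      cs.length_simple] at h1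
    omega
  obtain ⟨π', h'⟩ := exists_isConjPerm hperm
  obtain ⟨ρ, hρ⟩ := h.exists_inv
  have hu' := hρ.mul h'
  rw [inv_mul_cancel_left] at hu'
  obtain ⟨ρ', hρ'⟩ := hu'.exists_inv
  have := (key _ _ hd _ h' rfl).mul (noFusion_of_mem (inv_mem hu)) hρ'
  rwa [mul_inv_cancel_right] at this

end CoxeterSystem

namespace CoxeterMatrix

theorem ConnectedOn.insert_of_joined {I : Set B} (hI : M.ConnectedOn I) {s t : B} (ht : t ∈ I)
    (hs : M.Joined s t) :
    M.ConnectedOn (insert s I) := by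
  have hmono : ∀ {a b}, (M.graph I).Reachable a b → (M.graph (insert s I)).Reachable a b :=
    fun h => h.mono (show M.graph I ≤ M.graph (insert s I) from
      fun _ _ h => ⟨Set.mem_insert_of_mem _ h.1, Set.mem_insert_of_mem _ h.2.1, h.2.2⟩)
  have h1 : ∀ v ∈ insert s I, (M.graph (insert s I)).Reachable t v := by
    rintro v (rfl | hv)
    · exact SimpleGraph.Adj.reachable ⟨Set.mem_insert_of_mem _ ht, Set.mem_insert _ _, hs.symm⟩
    · exact hmono (hI t ht v hv)
  exact fun a ha b hb => (h1 a ha).symm.trans (h1 b hb)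

end CoxeterMatrix

namespace CoxeterSystem

variable {cs : CoxeterSystem M W} [Fintype B] {n : W} {K I : Set B} {π ρ : B → B}
  {c x y z x' y' s : B}

theorem IsConjPerm.eq_of_not_joined (h : cs.IsConjPerm n (insert s I) ρ) (hM : M.IsPos)
    (hI : M.ConnectedOn I) (hb : M.Branch c x y z) (hc : c ∈ I) (hx : x ∈ I) (hy : y ∈ I)
    (hz : z ∈ I) (hs : s ∉ I) (hsI : ∀ a ∈ I, ¬ M.Joined a s) : ρ s = s := by
  have hsub := Set.subset_insert s I
  have hρc := h.branch_eq hM hb (hsub hc) (hsub hx) (hsub hy) (hsub hz)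
  have hmaps : Set.MapsTo ρ I I := by
    intro i hi
    have h1 := h.reachable (hsub hc) ((hI c hc i hi).mono
      (show M.graph I ≤ M.graph (insert s I) from fun _ _ h => ⟨hsub h.1, hsub h.2.1, h.2.2⟩))
    rw [hρc] at h1
    refine CoxeterMatrix.mem_of_reachable hc ?_ h1
    rintro a ha d (rfl | hd) had
    · exact absurd had (hsI a ha)
    · exact hd
  refine (h s (Set.mem_insert _ _)).1.resolve_right fun h1 => ?_
  obtain ⟨i, hi, hi'⟩ := (h.mono hsub hmaps).bijOn.surjOn h1
  exact hs (h.injOn (hsub hi) (Set.mem_insert _ _) hi' ▸ hi)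

theorem noFusion_of_not_joined (hn : n ∈ parabolic cs (insert s I))
    (hsI : ∀ a ∈ I, ¬ M.Joined a s) : cs.NoFusion n I := by
  refine noFusion_of_mem_union (D := {s}) ?_ (by rwa [Set.union_singleton])
  rintro a ha d rfl
  exact hsI a ha

theorem IsConjPerm.joined_arm (h : cs.IsConjPerm n K π) (hc : c ∈ K) (hπc : π c = c)
    (hx : x ∈ K) (hx' : x' ∈ K) (hcx : M.Joined c x) (hxx' : M.Joined x x') (hcx' : c ≠ x') :
    M.Joined c (π x) ∧ π x' ∈ K ∧ M.Joined (π x) (π x') ∧ c ≠ π x' := by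
  refine ⟨?_, (h x' hx').1, (h.joined_iff hx hx').2 hxx', fun e => hcx' ?_⟩
  · have := (h.joined_iff hc hx).2 hcx
    rwa [hπc] at this
  · exact h.injOn hc hx' (hπc.trans e)

variable [Fintype W]

theorem noFusion_of_two_arms (h : cs.IsConjPerm n I π) (hM : M.IsPos) (hI : M.ConnectedOn I)
    (hb : M.Branch c x y z) (hc : c ∈ I) (hx : x ∈ I) (hy : y ∈ I) (hz : z ∈ I)
    (hx' : x' ∈ I) (hxx' : M.Joined x x') (hcx' : c ≠ x')
    (hy' : y' ∈ I) (hyy' : M.Joined y y') (hcy' : c ≠ y') : cs.NoFusion n I := by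
  refine noFusion_of_forall_insert (fun s hs w hw ρ hρ => ?_) h
  have hsub := Set.subset_insert s I
  by_cases hsI : ∀ a ∈ I, ¬ M.Joined a s
  · exact ⟨hρ.eq_of_not_joined hM hI hb hc hx hy hz hs hsI, noFusion_of_not_joined hw hsI⟩
  push Not at hsI
  obtain ⟨t, ht, hts⟩ := hsI
  have hK := hI.insert_of_joined ht hts.symm
  have hρc := hρ.branch_eq hM hb (hsub hc) (hsub hx) (hsub hy) (hsub hz)
  have hz1 : ∀ d, M.Joined z d → d = c := by
    intro d hd
    by_contra hne
    exact hM.not_affineE6 hb.hx hb.hy hb.hz hb.hxy hb.hxz hb.hyz hxx' hyy' hd hcx' hcy'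
      (Ne.symm hne)
  obtain ⟨hax1, hax2, hax3, hax4⟩ := hρ.joined_arm (hsub hc) hρc (hsub hx) (hsub hx') hb.hx hxx' hcx'
  obtain ⟨hay1, hay2, hay3, hay4⟩ := hρ.joined_arm (hsub hc) hρc (hsub hy) (hsub hy') hb.hy hyy' hcy'
  have hρx : ρ x = x ∨ ρ x = y := by
    rcases hb.eq_or hM hax1 with e | e | e
    · exact Or.inl e
    · exact Or.inr e
    · rw [e] at hax3
      exact absurd (hz1 _ hax3).symm hax4
  have hρy : ρ y = x ∨ ρ y = y := by
    rcases hb.eq_or hM hay1 with e | e | e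
    · exact Or.inl e
    · exact Or.inr e
    · rw [e] at hay3
      exact absurd (hz1 _ hay3).symm hay4
  have hne : ρ x ≠ ρ y := fun e => hb.hxy (hρ.injOn (hsub hx) (hsub hy) e)
  rcases hρx with hρx | hρx
  · have hρy : ρ y = y := hρy.resolve_left fun e => hne (hρx.trans e.symm)
    have hid := hρ.eq_of_branch hM hK hb (hsub hc) (hsub hx) (hsub hy) (hsub hz) hρx hρy
    have hs' := hid s (Set.mem_insert _ _)
    exact ⟨hs', noFusion_of_eqOn_id (hρ.of_insert hs hs') fun i hi => hid i (hsub hi)⟩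
  · exfalso
    have hρy : ρ y = x := hρy.resolve_right fun e => hne (hρx.trans e.symm)
    have hx1 : ∀ d ∈ insert s I, M.Joined x' d → d = x := by
      intro d hd hxd
      by_contra hne
      have h1 := (hρ.joined_iff (hsub hx') hd).2 hxd
      rw [hρx] at hax3
      refine hM.not_affineE7 hb.hx hb.hy hb.hz hb.hxy hb.hxz hb.hyz hxx' hax3 hxd h1 hcx' hax4
        (Ne.symm hne) fun e => hne ?_
      exact (hρ.injOn (hsub hx) hd (hρx.trans e)).symm
    have hy1 : ∀ d ∈ insert s I, M.Joined y' d → d = y := by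
      intro d hd hyd
      by_contra hne
      have h1 := (hρ.joined_iff (hsub hy') hd).2 hyd
      rw [hρy] at hay3
      refine hM.not_affineE7 hb.hx hb.hy hb.hz hb.hxy hb.hxz hb.hyz hay3 hyy' h1 hyd hay4 hcy'
        (fun e => hne ?_) (Ne.symm hne)
      exact (hρ.injOn (hsub hy) hd (hρy.trans e)).symm
    have hend : ∀ {u u' d : B}, M.Joined c u → M.Joined u u' → c ≠ u' → M.Joined u d →
        d = c ∨ d = u' := by
      intro u u' d h1 h2 h3 h4
      by_cases e : d = c
      · exact Or.inl e
      · exact Or.inr (hM.eq_of_joined_of_ne hb.defect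
          (SimpleGraph.Adj.reachable (CoxeterMatrix.graph_univ_adj.2 h1)) h1.ne.symm h1.symm h4 h2
          (Ne.symm e) h3)
    have hmem := CoxeterMatrix.mem_of_reachable (A := {c, x, y, z, x', y'}) (by simp) ?_
      (hK c (hsub hc) s (Set.mem_insert _ _))
    · simp only [Set.mem_insert_iff, Set.mem_singleton_iff] at hmem
      rcases hmem with e | e | e | e | e | e <;> subst e <;> exact hs (by assumption)
    · intro a ha d hd had
      simp only [Set.mem_insert_iff, Set.mem_singleton_iff] at ha ⊢
      rcases ha with e | e | e | e | e | e <;> rw [e] at had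
      · have := hb.eq_or hM had; tauto
      · have := hend hb.hx hxx' hcx' had; tauto
      · have := hend hb.hy hyy' hcy' had; tauto
      · have := hz1 _ had; tauto
      · have := hx1 _ hd had; tauto
      · have := hy1 _ hd had; tauto

theorem noFusion_of_no_arms (h : cs.IsConjPerm n I π) (hM : M.IsPos) (hI : M.ConnectedOn I)
    (hb : M.Branch c x y z) (hc : c ∈ I) (hx : x ∈ I) (hy : y ∈ I) (hz : z ∈ I)
    (hx1 : ∀ a ∈ I, M.Joined x a → a = c) (hy1 : ∀ a ∈ I, M.Joined y a → a = c)
    (hz1 : ∀ a ∈ I, M.Joined z a → a = c) : cs.NoFusion n I := by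
  refine noFusion_of_forall_insert (fun s hs w hw ρ hρ => ?_) h
  have hsub := Set.subset_insert s I
  by_cases hsI : ∀ a ∈ I, ¬ M.Joined a s
  · exact ⟨hρ.eq_of_not_joined hM hI hb hc hx hy hz hs hsI, noFusion_of_not_joined hw hsI⟩
  push Not at hsI
  obtain ⟨t, ht, hts⟩ := hsI
  have hρc := hρ.branch_eq hM hb (hsub hc) (hsub hx) (hsub hy) (hsub hz)
  have hsc : c ≠ s := fun e => hs (e ▸ hc)
  have key : ∀ {x y z : B}, M.Branch c x y z → x ∈ I → y ∈ I → z ∈ I →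
      (∀ a ∈ I, M.Joined y a → a = c) → (∀ a ∈ I, M.Joined z a → a = c) → M.Joined x s →
      ρ s = s ∧ cs.NoFusion w I := by
    intro x y z hb hx hy hz hy1 hz1 hxs
    have hne : ∀ {u : B}, M.Joined c u → x ≠ u → (∀ a ∈ I, M.Joined u a → a = c) →
        ∀ a ∈ insert s I, M.Joined u a → a = c := by
      rintro u hu hxu h1 a (rfl | ha) hua
      · exact (hM.not_square hb.hx hxs hua.symm hu.symm hsc hxu).elim
      · exact h1 a ha hua
    obtain ⟨h1, h2, h3, h4⟩ := hρ.joined_arm (hsub hc) hρc (hsub hx) (Set.mem_insert _ _) hb.hx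
      hxs hsc
    have hρx : ρ x = x := by
      rcases hb.eq_or hM h1 with e | e | e
      · exact e
      · rw [e] at h3
        exact absurd (hne hb.hy hb.hxy hy1 _ h2 h3).symm h4
      · rw [e] at h3
        exact absurd (hne hb.hz hb.hxz hz1 _ h2 h3).symm h4
    rw [hρx] at h3
    have hρs : ρ s = s := hM.eq_of_joined_of_ne hb.defect
      (SimpleGraph.Adj.reachable (CoxeterMatrix.graph_univ_adj.2 hb.hx)) hb.hx.ne.symm hb.hx.symm
      h3 hxs h4 hsc
    exact ⟨hρs, noFusion_of_fixed_arm (hρ.of_insert hs hρs) hM hI hb hc hx hy hz hρx hy1 hz1⟩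
  have hmem : t = c ∨ t = x ∨ t = y ∨ t = z := by
    refine CoxeterMatrix.mem_of_reachable (A := {t | t = c ∨ t = x ∨ t = y ∨ t = z}) (Or.inl rfl) ?_
      (hI c hc t ht)
    rintro a (rfl | rfl | rfl | rfl) d hd had
    · exact Or.inr (hb.eq_or hM had)
    · exact Or.inl (hx1 d hd had)
    · exact Or.inl (hy1 d hd had)
    · exact Or.inl (hz1 d hd had)
  rcases hmem with rfl | rfl | rfl | rfl
  · rcases hb.eq_or hM hts with rfl | rfl | rfl <;> contradiction
  · exact key hb hx hy hz hy1 hz1 hts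
  · exact key hb.rotate hy hz hx hz1 hx1 hts
  · exact key hb.rotate.rotate hz hx hy hx1 hy1 hts

theorem noFusion_of_one_arm (h : cs.IsConjPerm n I π) (hM : M.IsPos) (hI : M.ConnectedOn I)
    (hb : M.Branch c x y z) (hc : c ∈ I) (hx : x ∈ I) (hy : y ∈ I) (hz : z ∈ I)
    (hx' : x' ∈ I) (hxx' : M.Joined x x') (hcx' : c ≠ x') (hy1 : ∀ a ∈ I, M.Joined y a → a = c)
    (hz1 : ∀ a ∈ I, M.Joined z a → a = c) : cs.NoFusion n I := by
  have hπc := h.branch_eq hM hb hc hx hy hz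
  obtain ⟨h1, h2, h3, h4⟩ := h.joined_arm hc hπc hx hx' hb.hx hxx' hcx'
  refine noFusion_of_fixed_arm h hM hI hb hc hx hy hz ?_ hy1 hz1
  rcases hb.eq_or hM h1 with e | e | e
  · exact e
  · rw [e] at h3
    exact absurd (hy1 _ h2 h3).symm h4
  · rw [e] at h3
    exact absurd (hz1 _ h2 h3).symm h4

theorem noFusion_of_branch (h : cs.IsConjPerm n I π) (hM : M.IsPos) (hI : M.ConnectedOn I)
    (hb : M.Branch c x y z) (hc : c ∈ I) (hx : x ∈ I) (hy : y ∈ I) (hz : z ∈ I) :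
    cs.NoFusion n I := by
  have harm : ∀ u, (∀ a ∈ I, M.Joined u a → a = c) ∨ ∃ a ∈ I, M.Joined u a ∧ c ≠ a := by
    intro u
    by_cases hu : ∀ a ∈ I, M.Joined u a → a = c
    · exact Or.inl hu
    · push Not at hu
      obtain ⟨a, h1, h2, h3⟩ := hu
      exact Or.inr ⟨a, h1, h2, h3.symm⟩
  rcases harm x with ax | ⟨x', hx', ax, ax'⟩ <;> rcases harm y with ay | ⟨y', hy', ay, ay'⟩ <;>
    rcases harm z with az | ⟨z', hz', az, az'⟩
  · exact noFusion_of_no_arms h hM hI hb hc hx hy hz ax ay az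
  · exact noFusion_of_one_arm h hM hI hb.rotate.rotate hc hz hx hy hz' az az' ax ay
  · exact noFusion_of_one_arm h hM hI hb.rotate hc hy hz hx hy' ay ay' az ax
  · exact noFusion_of_two_arms h hM hI hb.rotate hc hy hz hx hy' ay ay' hz' az az'
  · exact noFusion_of_one_arm h hM hI hb hc hx hy hz hx' ax ax' ay az
  · exact noFusion_of_two_arms h hM hI hb.rotate.rotate hc hz hx hy hz' az az' hx' ax ax'
  · exact noFusion_of_two_arms h hM hI hb hc hx hy hz hx' ax ax' hy' ay ay'
  · exact noFusion_of_two_arms h hM hI hb hc hx hy hz hx' ax ax' hy' ay ay'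

theorem noFusion_of_defect (h : cs.IsConjPerm n I π) (hM : M.IsPos) (hI : M.ConnectedOn I)
    (hc : c ∈ I) (hd : M.Defect I c) : cs.NoFusion n I := by
  rcases hd with ⟨a, ha, h1⟩ | ⟨a, ha, b, hb, d, hd, hab, had, hbd, ja, jb, jd⟩
  · exact noFusion_of_heavy hM h hI hc ha h1
  · exact noFusion_of_branch h hM hI ⟨ja, jb, jd, hab, had, hbd⟩ hc ha hb hd

theorem IsConjPerm.noFusion (h : cs.IsConjPerm n I π) (hM : M.IsPos) : cs.NoFusion n I := by
  induction hk : I.ncard using Nat.strong_induction_on generalizing I with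
  | _ k ih =>
    by_cases hdef : ∀ v ∈ I, ¬ M.Defect I v
    · exact fun v hv => hv.exists_conj_of_no_defect hM hdef (h.isCuspidal hv)
    push Not at hdef
    obtain ⟨c, hc, hd⟩ := hdef
    have hcC := CoxeterMatrix.mem_component_self (M := M) hc
    have hCI := CoxeterMatrix.component_subset (M := M) (I := I) (x := c)
    have hπc : π c ∈ M.component I c := by
      have hd' : M.Defect I (π c) := by
        rcases hd with ⟨a, ha, h1⟩ | ⟨a, ha, b, hb, d, hd, hab, had, hbd, ja, jb, jd⟩
        · exact Or.inl ⟨π a, (h a ha).1, (h.heavy_iff hc ha).2 h1⟩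
        · exact Or.inr ⟨π a, (h a ha).1, π b, (h b hb).1, π d, (h d hd).1,
            fun e => hab (h.injOn ha hb e), fun e => had (h.injOn ha hd e),
            fun e => hbd (h.injOn hb hd e), (h.joined_iff hc ha).2 ja, (h.joined_iff hc hb).2 jb,
            (h.joined_iff hc hd).2 jd⟩
      rcases hM.defect_unique (cs.reachable_of_conj (d := n) (by rw [parabolic_univ]; trivial)
        trivial (h c hc).2) (hd.mono (Set.subset_univ _)) (hd'.mono (Set.subset_univ _)) with e | e
      · rwa [← e]
      · exact CoxeterMatrix.mem_component_of_joined hcC (h c hc).1 e.1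
    have hmaps : Set.MapsTo π (M.component I c) (M.component I c) := fun i hi =>
      ⟨(h i hi.1).1, hπc.2.trans (h.reachable hc hi.2)⟩
    have hC := h.mono hCI hmaps
    have hmaps' : Set.MapsTo π (I \ M.component I c) (I \ M.component I c) := by
      rintro i ⟨hi, hi'⟩
      refine ⟨(h i hi).1, fun h1 => hi' ?_⟩
      obtain ⟨j, hj, hj'⟩ := hC.bijOn.surjOn h1
      rwa [← h.injOn (hCI hj) hi hj']
    have hlt : (I \ M.component I c).ncard < k := by
      rw [← hk]
      exact Set.ncard_lt_ncard ⟨Set.sdiff_subset, fun hle => (hle hc).2 hcC⟩ (Set.toFinite _)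
    have := NoFusion.union (fun a ha d hd => CoxeterMatrix.not_joined_component ha hd)
      Set.disjoint_sdiff_right
      (noFusion_of_defect hC hM CoxeterMatrix.connectedOn_component hcC
        (CoxeterMatrix.Defect.component hd hcC))
      (ih _ hlt (h.mono Set.sdiff_subset hmaps') rfl)
    rwa [Set.union_sdiff_cancel hCI] at this

end CoxeterSystem

namespace CoxeterSystem

variable {cs : CoxeterSystem M W} {I J K L : Set B}

/-- Some element of `W` conjugates the simple reflections in `I` to simple reflections in `J`. -/
def ConjInto (cs : CoxeterSystem M W) (I J : Set B) : Prop :=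
  ∃ g : W, ∀ i ∈ I, ∃ j ∈ J, g * cs.simple i * g⁻¹ = cs.simple j

theorem ConjInto.trans (h : cs.ConjInto I J) (h' : cs.ConjInto J K) : cs.ConjInto I K := by
  obtain ⟨g, hg⟩ := h
  obtain ⟨k, hk⟩ := h'
  refine ⟨k * g, fun i hi => ?_⟩
  obtain ⟨j, hj, e⟩ := hg i hi
  obtain ⟨l, hl, e'⟩ := hk j hj
  exact ⟨l, hl, by rw [← e', ← e]; group⟩

theorem conjInto_refl (cs : CoxeterSystem M W) (I : Set B) : cs.ConjInto I I :=
  ⟨1, fun i hi => ⟨i, hi, by simp⟩⟩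

theorem image_conj_injective (g : W) : Function.Injective fun x : W => g * x * g⁻¹ := by
  intro x y h
  simpa using h

theorem ConjInto.ncard_le [Finite B] (h : cs.ConjInto I J) : I.ncard ≤ J.ncard := by
  obtain ⟨g, hg⟩ := h
  rw [← Set.ncard_image_of_injective I cs.simple_injective,
    ← Set.ncard_image_of_injective J cs.simple_injective,
    ← Set.ncard_image_of_injective _ (image_conj_injective g)]
  refine Set.ncard_le_ncard ?_ (Set.toFinite _)
  rintro _ ⟨_, ⟨i, hi, rfl⟩, rfl⟩
  obtain ⟨j, hj, e⟩ := hg i hi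
  exact ⟨j, hj, e.symm⟩

theorem ConjInto.conjSubsets [Finite B] (h : cs.ConjInto I J) (hc : J.ncard ≤ I.ncard) :
    ConjSubsets cs I J := by
  obtain ⟨g, hg⟩ := h
  refine ⟨g, Set.eq_of_subset_of_ncard_le ?_ ?_ (Set.toFinite _)⟩
  · rintro _ ⟨_, ⟨i, hi, rfl⟩, rfl⟩
    obtain ⟨j, hj, e⟩ := hg i hi
    exact ⟨j, hj, e.symm⟩
  · rwa [Set.ncard_image_of_injective _ (image_conj_injective g),
      Set.ncard_image_of_injective I cs.simple_injective,
      Set.ncard_image_of_injective J cs.simple_injective]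

theorem IsCuspidal.conj {v a : W} (h : cs.IsCuspidal I v) (ha : a ∈ parabolic cs I) :
    cs.IsCuspidal I (a * v * a⁻¹) := by
  refine ⟨mul_mem (mul_mem ha h.1) (inv_mem ha), fun K hK u hu hmem => ?_⟩
  refine h.2 K hK (u * a) (mul_mem hu ha) ?_
  convert hmem using 1; group

/-- A conjugation that takes a cuspidal element of `W_I` into `W_L` factors through an element
that takes simple reflections in `I` to simple reflections in `L`. -/
theorem IsCuspidal.exists_factor {v g : W} (h : cs.IsCuspidal I v)
    (hg : g⁻¹ * v * g ∈ parabolic cs L) :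
    ∃ a ∈ parabolic cs I, ∃ b ∈ parabolic cs L, ∃ d, g = a * d * b ∧
      ∀ i ∈ I, ∃ j ∈ L, d⁻¹ * cs.simple i * d⁻¹⁻¹ = cs.simple j := by
  obtain ⟨a, ha, b, hb, d, rfl, hd, hd'⟩ := cs.exists_doubleCoset_rep I L g
  refine ⟨a, ha, b, hb, d, rfl, ?_⟩
  have hu : a⁻¹ * v * a⁻¹⁻¹ ∈ parabolic cs I :=
    mul_mem (mul_mem (inv_mem ha) h.1) (inv_mem (inv_mem ha))
  have hx : d⁻¹ * (a⁻¹ * v * a) * d ∈ parabolic cs L := by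
    have := mul_mem (mul_mem hb hg) (inv_mem hb)
    convert this using 1; group
  have hmem := cs.conj_mem_parabolic_of_doubleCoset_rep hd hd' hu hx (by group)
  by_contra hcon
  push Not at hcon
  obtain ⟨i, hi, hij⟩ := hcon
  refine h.2 _ ⟨fun i hi => hi.1, fun hle => ?_⟩ a⁻¹ (inv_mem ha) hmem
  obtain ⟨j, hj, e⟩ := (hle hi).2
  refine hij j hj ?_
  rw [e]; group

theorem IsCuspidal.conjInto {v g : W} (h : cs.IsCuspidal I v)
    (hg : g⁻¹ * v * g ∈ parabolic cs L) : cs.ConjInto I L := by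
  obtain ⟨a, ha, b, hb, d, rfl, hd⟩ := h.exists_factor hg
  exact ⟨d⁻¹, hd⟩

theorem IsCuspidal.conj_mem {v g x : W} (h : cs.IsCuspidal I v)
    (hg : g⁻¹ * v * g ∈ parabolic cs L) (hx : x ∈ parabolic cs I) :
    g⁻¹ * x * g ∈ parabolic cs L := by
  obtain ⟨a, ha, b, hb, d, rfl, hd⟩ := h.exists_factor hg
  have key : ∀ y ∈ parabolic cs I, d⁻¹ * y * d ∈ parabolic cs L := by
    intro y hy
    induction hy using Subgroup.closure_induction with
    | mem y hy =>
      obtain ⟨i, hi, rfl⟩ := hy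
      obtain ⟨j, hj, e⟩ := hd i hi
      rw [inv_inv] at e
      rw [e]
      exact cs.simple_mem_parabolic hj
    | one => simp
    | mul y z _ _ hy hz =>
      have := mul_mem hy hz
      convert this using 1; group
    | inv y _ hy =>
      have := inv_mem hy
      convert this using 1; group
  have := mul_mem (mul_mem (inv_mem hb) (key _ (mul_mem (mul_mem (inv_mem ha) hx) ha))) hb
  convert this using 1; group

theorem IsCuspidal.of_isConj [Finite B] {v w : W} (h : cs.IsCuspidal I v) (hw : w ∈ parabolic cs I)
    (hc : IsConj v w) : cs.IsCuspidal I w := by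
  obtain ⟨g, rfl⟩ := isConj_iff.1 hc
  refine ⟨hw, fun K hK u hu hmem => ?_⟩
  have h1 : cs.ConjInto I K := h.conjInto (g := (u * g)⁻¹) (by convert hmem using 1; group)
  exact absurd (Set.ncard_lt_ncard hK (Set.toFinite _)) (not_lt.2 h1.ncard_le)

/-- Cuspidal elements of `W_I` that are conjugate in `W` are conjugate in `W_I`. -/
theorem IsCuspidal.exists_conj_of_isConj [Fintype W] [Fintype B] {v w : W} (h : cs.IsCuspidal I v)
    (hw : w ∈ parabolic cs I) (hc : IsConj v w) : ∃ u ∈ parabolic cs I, u * v * u⁻¹ = w := by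
  obtain ⟨g, rfl⟩ := isConj_iff.1 hc
  obtain ⟨a, ha, b, hb, d, e, hd⟩ := h.exists_factor (g := g⁻¹) (by simpa using hw)
  obtain ⟨π, hπ⟩ := exists_isConjPerm hd
  obtain ⟨u, hu, hu'⟩ := hπ.noFusion cs.gram_posDef _ (h.conj (inv_mem ha))
  refine ⟨b⁻¹ * (u * a⁻¹), mul_mem (inv_mem hb) (mul_mem hu (inv_mem ha)), ?_⟩
  obtain rfl : g = b⁻¹ * d⁻¹ * a⁻¹ := by rw [← inv_inv g, e]; group
  have h1 : b⁻¹ * (u * a⁻¹) * v * (b⁻¹ * (u * a⁻¹))⁻¹ =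
      b⁻¹ * (u * (a⁻¹ * v * a⁻¹⁻¹) * u⁻¹) * b := by group
  rw [h1, hu']; group

theorem isElementOf_iff [Fintype W] [Fintype B] {w : W} :
    IsElementOf cs I w ↔ ∃ v, cs.IsCuspidal I v ∧ IsConj w v := by
  constructor
  · rintro ⟨⟨v, hv, hC⟩, hcusp⟩
    have hmem : ∀ u ∈ parabolic cs I, u * v * u⁻¹ ∈
        {x : W | IsConj w x} ∩ (parabolic cs I : Set W) := fun u hu => by
      rw [hC]; exact ⟨u, hu, rfl⟩
    refine ⟨v, ⟨hv, fun K hK u hu hK' => ?_⟩, by simpa using (hmem 1 (one_mem _)).1⟩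
    have h1 : u * v * u⁻¹ ∈ (∅ : Set W) := hcusp K hK ▸ ⟨hmem u hu, hK'⟩
    exact h1
  · rintro ⟨v, hv, hc⟩
    refine ⟨⟨v, hv.1, ?_⟩, fun K hK => ?_⟩
    · ext x
      constructor
      · rintro ⟨h1, h2⟩
        exact hv.exists_conj_of_isConj h2 (hc.symm.trans h1)
      · rintro ⟨u, hu, rfl⟩
        exact ⟨hc.trans (isConj_iff.2 ⟨u, rfl⟩), mul_mem (mul_mem hu hv.1) (inv_mem hu)⟩
    · refine Set.eq_empty_of_forall_notMem ?_
      rintro x ⟨⟨h1, h2⟩, h3⟩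
      exact (hv.of_isConj h2 (hc.symm.trans h1)).2 K hK 1 (one_mem _) (by simpa using h3)

theorem exists_isElementOf [Fintype W] [Fintype B] (cs : CoxeterSystem M W) (w : W) :
    ∃ I, IsElementOf cs I w := by
  have hS : ∃ k, ∃ I : Set B, I.ncard = k ∧ ∃ v ∈ parabolic cs I, IsConj w v :=
    ⟨_, Set.univ, rfl, w, by rw [parabolic_univ]; trivial, IsConj.refl w⟩
  obtain ⟨I, hI, v, hv, hc⟩ := Nat.find_spec hS
  refine ⟨I, isElementOf_iff.2 ⟨v, ⟨hv, fun K hK u hu hmem => ?_⟩, hc⟩⟩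
  refine Nat.find_min hS (m := K.ncard) ?_ ⟨K, rfl, _, hmem, hc.trans (isConj_iff.2 ⟨u, rfl⟩)⟩
  rw [← hI]
  exact Set.ncard_lt_ncard hK (Set.toFinite _)

/-- The number of `g ∈ W` with `g⁻¹ W_I g ⊆ W_L`. -/
noncomputable def transporterCard (cs : CoxeterSystem M W) (L I : Set B) : ℕ :=
  Nat.card {g : W | ∀ x ∈ parabolic cs I, g⁻¹ * x * g ∈ parabolic cs L}

theorem transporterCard_congr (h : ConjSubsets cs I J) (L : Set B) :
    cs.transporterCard L I = cs.transporterCard L J := by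
  obtain ⟨n, hn⟩ := h
  have hJ : parabolic cs J = (parabolic cs I).map (MulAut.conj n).toMonoidHom := by
    rw [parabolic, parabolic, MonoidHom.map_closure, ← hn]
    rfl
  refine Nat.card_congr ((Equiv.mulLeft n).subtypeEquiv fun g => ?_)
  simp only [Set.mem_ofPred_eq, hJ, Subgroup.mem_map, Equiv.coe_mulLeft, forall_exists_index,
    and_imp]
  constructor
  · rintro h _ x hx rfl
    have := h x hx
    convert this using 1
    simp [mul_assoc]
  · intro h x hx
    have := h _ x hx rfl
    convert this using 1
    simp [mul_assoc]

theorem card_mul_indTriv [Fintype W] (cs : CoxeterSystem M W) (L : Set B) (w : W) :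
    (Nat.card (parabolic cs L) : ℚ) * indTriv cs L w =
      Nat.card {g : W | g⁻¹ * w * g ∈ parabolic cs L} := by
  rw [indTriv, ← Nat.cast_mul, ← Nat.card_prod]
  congr 1
  refine Nat.card_eq_of_bijective
    (fun p => ⟨(p.2 : W) * (p.1 : W), ?_⟩) ⟨?_, ?_⟩
  · have := mul_mem (mul_mem (inv_mem p.1.2) p.2.2.2) p.1.2
    show (_ : W) ∈ parabolic cs L
    convert this using 1; group
  · rintro ⟨⟨u, hu⟩, ⟨x, hx, hx'⟩⟩ ⟨⟨u', hu'⟩, ⟨y, hy, hy'⟩⟩ h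
    have h : x * u = y * u' := congrArg Subtype.val h
    have hxy : x = y := by
      refine cs.eq_of_mem_minReps hx hy ?_
      have h2 : x⁻¹ * y = u * u'⁻¹ := by
        rw [inv_mul_eq_iff_eq_mul, ← mul_assoc, eq_mul_inv_iff_mul_eq, h]
      rw [h2]
      exact mul_mem hu (inv_mem hu')
    subst hxy
    obtain rfl := mul_left_cancel h
    rfl
  · rintro ⟨g, hg⟩
    obtain ⟨u, hu, hgu⟩ := cs.exists_mem_minReps L g
    refine ⟨⟨⟨u⁻¹, inv_mem hu⟩, ⟨g * u, hgu, ?_⟩⟩, by simp⟩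
    have := mul_mem (mul_mem (inv_mem hu) hg) hu
    convert this using 1; group

theorem card_mul_indTriv_of_isElementOf [Fintype W] [Fintype B] {w : W} (h : IsElementOf cs I w)
    (L : Set B) :
    (Nat.card (parabolic cs L) : ℚ) * indTriv cs L w = cs.transporterCard L I := by
  rw [card_mul_indTriv]
  obtain ⟨v, hv, hc⟩ := isElementOf_iff.1 h
  obtain ⟨n, rfl⟩ := isConj_iff.1 hc
  congr 1
  refine Nat.card_congr ((Equiv.mulLeft n).subtypeEquiv fun g => ?_)
  simp only [Set.mem_ofPred_eq, Equiv.coe_mulLeft]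
  have e : g⁻¹ * w * g = (n * g)⁻¹ * (n * w * n⁻¹) * (n * g) := by group
  rw [e]
  exact ⟨fun h x hx => hv.conj_mem h hx, fun h => h _ hv.1⟩

theorem card_parabolic_ne_zero [Fintype W] (cs : CoxeterSystem M W) (L : Set B) :
    (Nat.card (parabolic cs L) : ℚ) ≠ 0 := by
  exact_mod_cast Nat.card_pos.ne'

theorem indTriv_eq_of_conjSubsets [Fintype W] [Fintype B] {v w : W} (hv : IsElementOf cs I v)
    (hw : IsElementOf cs J w) (h : ConjSubsets cs I J) (L : Set B) :
    indTriv cs L v = indTriv cs L w := by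
  refine mul_left_cancel₀ (cs.card_parabolic_ne_zero L) ?_
  rw [card_mul_indTriv_of_isElementOf hv, card_mul_indTriv_of_isElementOf hw,
    transporterCard_congr h]

theorem indTriv_ne_zero [Fintype W] [Fintype B] {w : W} (h : IsElementOf cs I w) :
    indTriv cs I w ≠ 0 := by
  intro h0
  have h1 := card_mul_indTriv_of_isElementOf h I
  rw [h0, mul_zero, eq_comm, Nat.cast_eq_zero, transporterCard, Nat.card_eq_zero] at h1
  rcases h1 with h1 | h1
  · exact h1.elim ⟨1, by simp⟩
  · exact not_finite_iff_infinite.2 h1 inferInstance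

theorem conjInto_of_indTriv_ne_zero [Fintype W] [Fintype B] {w : W} (h : IsElementOf cs I w)
    (hL : indTriv cs L w ≠ 0) : cs.ConjInto I L := by
  have h1 := card_mul_indTriv_of_isElementOf h L
  obtain ⟨v, hv, hc⟩ := isElementOf_iff.1 h
  have h2 : cs.transporterCard L I ≠ 0 := by
    intro h0
    rw [h0, Nat.cast_zero] at h1
    exact mul_ne_zero (cs.card_parabolic_ne_zero L) hL h1
  obtain ⟨⟨g, hg⟩⟩ := (Nat.card_ne_zero.1 h2).1
  exact hv.conjInto (hg v hv.1)

theorem mem_span_indTriv [Fintype W] [Fintype B] (cs : CoxeterSystem M W) (f : W → ℚ)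
    (hf : ∀ I J v w, IsElementOf cs I v → IsElementOf cs J w → ConjSubsets cs I J → f v = f w) :
    f ∈ Submodule.span ℚ (Set.range (indTriv cs)) := by
  induction hk : {I | ∃ J w, IsElementOf cs J w ∧ f w ≠ 0 ∧ cs.ConjInto I J}.ncard
    using Nat.strong_induction_on generalizing f with
  | _ k ih =>
    by_cases h0 : f = 0
    · rw [h0]; exact zero_mem _
    have hne : {I | ∃ w, IsElementOf cs I w ∧ f w ≠ 0}.Nonempty := by
      obtain ⟨w, hw⟩ := Function.ne_iff.1 h0
      obtain ⟨I, hI⟩ := cs.exists_isElementOf w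
      exact ⟨I, w, hI, hw⟩
    obtain ⟨I, ⟨w, hw, hfw⟩, hmax⟩ := Set.exists_max_image _ Set.ncard (Set.toFinite _) hne
    set g : W → ℚ := f - (f w / indTriv cs I w) • indTriv cs I with hg
    have hgw : g w = 0 := by
      simp [hg, div_mul_cancel₀ _ (indTriv_ne_zero hw)]
    have hgc : ∀ I J v w, IsElementOf cs I v → IsElementOf cs J w → ConjSubsets cs I J →
        g v = g w := by
      intro K J v w hv hw h
      simp only [hg, Pi.sub_apply, Pi.smul_apply, hf K J v w hv hw h,
        indTriv_eq_of_conjSubsets hv hw h]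
    have hsupp : ∀ J v, IsElementOf cs J v → g v ≠ 0 → f v ≠ 0 ∨ cs.ConjInto J I := by
      intro J v hv hgv
      by_cases hi : indTriv cs I v = 0
      · left
        simpa [hg, hi] using hgv
      · exact Or.inr (conjInto_of_indTriv_ne_zero hv hi)
    have hmem : g ∈ Submodule.span ℚ (Set.range (indTriv cs)) := by
      refine ih _ ?_ g hgc rfl
      rw [← hk]
      refine Set.ncard_lt_ncard ⟨?_, fun hle => ?_⟩ (Set.toFinite _)
      · rintro K ⟨J, v, hv, hgv, hKJ⟩
        rcases hsupp J v hv hgv with h | h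
        · exact ⟨J, v, hv, h, hKJ⟩
        · exact ⟨I, w, hw, hfw, hKJ.trans h⟩
      · obtain ⟨J, v, hv, hgv, hIJ⟩ := hle ⟨I, w, hw, hfw, cs.conjInto_refl I⟩
        have hc : J.ncard ≤ I.ncard := by
          rcases hsupp J v hv hgv with h | h
          · exact hmax J ⟨v, hv, h⟩
          · exact h.ncard_le
        exact hgv ((hgc I J w v hw hv (hIJ.conjSubsets hc)).symm.trans hgw)
    have e : f = g + (f w / indTriv cs I w) • indTriv cs I := by simp [hg]
    rw [e]
    exact add_mem hmem (Submodule.smul_mem _ _ (Submodule.subset_span ⟨I, rfl⟩))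

end CoxeterSystem

/-- A class function `f` lies in the span `ΓW` of the induced trivial
characters iff `f` is `ℚ`-valued and constant on every λ-set. -/
theorem statement4 [Fintype W] (cs : CoxeterSystem M W) (f : W → ℂ)
    (hf : ∀ v w : W, IsConj v w → f v = f w) :
    f ∈ Submodule.span ℚ
        (Set.range (fun I : Set B => fun w : W => ((indTriv cs I w : ℚ) : ℂ))) ↔
      ((∀ w : W, ∃ q : ℚ, f w = (q : ℂ)) ∧
        ∀ lam : CoxeterClass cs, ∀ v ∈ lambdaSetQ cs lam, ∀ w ∈ lambdaSetQ cs lam,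
          f v = f w) := by
  have : Finite B := cs.finite_index
  have : Fintype B := Fintype.ofFinite B
  clear hf
  constructor
  · intro h
    induction h using Submodule.span_induction with
    | mem f h =>
      obtain ⟨L, rfl⟩ := h
      refine ⟨fun w => ⟨_, rfl⟩, ?_⟩
      rintro lam v ⟨I, hI, hv⟩ w ⟨J, hJ, hw⟩
      have h := CoxeterSystem.indTriv_eq_of_conjSubsets hv hw (Quotient.exact (hI.trans hJ.symm)) L
      simp only [h]
    | zero => exact ⟨fun w => ⟨0, by simp⟩, by simp⟩
    | add f g _ _ ihf ihg =>
      refine ⟨fun w => ?_, fun lam v hv w hw => ?_⟩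
      · obtain ⟨p, hp⟩ := ihf.1 w
        obtain ⟨q, hq⟩ := ihg.1 w
        exact ⟨p + q, by simp [hp, hq]⟩
      · simp only [Pi.add_apply, ihf.2 lam v hv w hw, ihg.2 lam v hv w hw]
    | smul a f _ ih =>
      refine ⟨fun w => ?_, fun lam v hv w hw => ?_⟩
      · obtain ⟨p, hp⟩ := ih.1 w
        exact ⟨a * p, by simp [hp, Rat.smul_def]⟩
      · simp only [Pi.smul_apply, ih.2 lam v hv w hw]
  · rintro ⟨hq, hc⟩
    choose g hg using hq
    have hmem := cs.mem_span_indTriv g fun I J v w hv hw h => by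
      have h1 := hc (Quotient.mk (coxSetoid cs) J) v ⟨I, Quotient.sound h, hv⟩ w ⟨J, rfl, hw⟩
      rw [hg, hg] at h1
      exact_mod_cast h1
    have hmap := Submodule.mem_map_of_mem (f := (Algebra.linearMap ℚ ℂ).compLeft W) hmem
    rw [Submodule.map_span, ← Set.range_comp] at hmap
    rw [show f = (Algebra.linearMap ℚ ℂ).compLeft W g from funext hg]
    exact hmap
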